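/- For every dimension d ≥ 5 there exist λ₀(d) > 0 and a constant K(d) > 0 such that for every ρ ∈ (0,1] and every λ ∈ (0,λ₀], the functions B_m := Π_m/(λ c_m) of the weakly self-avoiding walk satisfy, for all m ≥ 1 and all x ∈ ℝ^d: |B_m(x)| ≤ K m^{−d/2} Σ_{k=1}^{m} k^{1−d/2} φ_{2k/5}(x). -/

import Mathlib

open MeasureTheory Filter Finset
open scoped Classical

noncomputable section

abbrev Ed (d : ℕ) := EuclideanSpace ℝ (Fin d)

/-- The centered Gaussian density `φ_t` on `ℝ^d` with covariance `t · Id`. -/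
def gauss (d : ℕ) (t : ℝ) (x : Ed d) : ℝ :=
  (2 * Real.pi * t) ^ (-(d : ℝ) / 2) * Real.exp (-‖x‖ ^ 2 / (2 * t))

/-- Convolution of two functions on `ℝ^d`. -/
def convl (d : ℕ) (f g : Ed d → ℝ) (x : Ed d) : ℝ := ∫ y, f y * g (x - y)

/-- `γ^{(k)}(m) = ∫ |y|^{2k} Γ_m(y) dy`. -/
def gammaMom {d : ℕ} (Γ : ℕ → Ed d → ℝ) (k m : ℕ) : ℝ := ∫ y, ‖y‖ ^ (2 * k) * Γ m y

/-- A rotationally invariant (radial) function on `ℝ^d`. -/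
def Radial {d : ℕ} (f : Ed d → ℝ) : Prop := ∀ x y : Ed d, ‖x‖ = ‖y‖ → f x = f y

/-- A function vanishing at infinity. -/
def VanishAtInfty {d : ℕ} (f : Ed d → ℝ) : Prop := Tendsto f (cocompact (Ed d)) (nhds 0)

/-- Condition B1–B4 on the dominating sequence `Γ`. -/
structure CondB (d : ℕ) (Γ : ℕ → Ed d → ℝ) (χ : ℕ → ℕ → ℝ) (K1 K2 K3 : ℝ) : Prop where
  pos : ∀ m, 1 ≤ m → ∀ x, 0 < Γ m x
  cont : ∀ m, 1 ≤ m → Continuous (Γ m)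
  radial : ∀ m, 1 ≤ m → Radial (Γ m)
  vanish : ∀ m, 1 ≤ m → VanishAtInfty (Γ m)
  integrable : ∀ m, 1 ≤ m → ∀ k, k ≤ 2 → Integrable fun y => ‖y‖ ^ (2 * k) * Γ m y
  chi_pos : ∀ n s, 1 ≤ s → s ≤ n → 0 < χ n s
  chi_symm : ∀ n s, 1 ≤ s → s ≤ n → χ n s = χ n (n - s)
  chi_sum : ∀ n : ℕ, (∑ s ∈ Finset.Ico 1 n, (↑(min s (n - s)) : ℝ) * χ n s) ≤ K1
  conv_le : ∀ m n, 1 ≤ m → 1 ≤ n → ∀ x, convl d (Γ m) (Γ n) x ≤ χ (m + n) m * Γ (m + n) x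
  doubling : ∀ t s : ℕ, 1 ≤ t → t ≤ s → s ≤ 2 * t → ∀ x, Γ s x ≤ K2 * Γ (2 * t) x
  smoothing : ∀ (m : ℕ) (t : ℝ), 1 ≤ m → (m : ℝ) ≤ t → ∀ k, k ≤ 2 → ∀ x,
    (∫ y, gauss d t (x - y) * (‖y‖ ^ (2 * k) * Γ m y)) ≤
      K3 * gammaMom Γ k m * gauss d (t + (m : ℝ)) x
  sum0 : Summable fun n : ℕ => (n : ℝ) * gammaMom Γ 0 n
  sum1 : Summable fun n : ℕ => gammaMom Γ 1 n
  sum2 : Summable fun n : ℕ => gammaMom Γ 2 n / (n : ℝ)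

/-- `b_k = ∫ B_k`. -/
def bInt {d : ℕ} (B : ℕ → Ed d → ℝ) (k : ℕ) : ℝ := ∫ y, B k y

/-- The scalar `b̄_m` with `∫ x xᵀ B_m(x) dx = b̄_m I_d`. -/
def bbar {d : ℕ} (B : ℕ → Ed d → ℝ) (m : ℕ) : ℝ := (∫ y, ‖y‖ ^ 2 * B m y) / d

/-- Regularity of the sequence `B`, dominated by `Γ`. -/
structure BSeq (d : ℕ) (B Γ : ℕ → Ed d → ℝ) : Prop where
  cont : ∀ m, 1 ≤ m → Continuous (B m)
  radial : ∀ m, 1 ≤ m → Radial (B m)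
  vanish : ∀ m, 1 ≤ m → VanishAtInfty (B m)
  integrable : ∀ m, 1 ≤ m → Integrable (B m)
  integrable2 : ∀ m, 1 ≤ m → Integrable fun y => ‖y‖ ^ 2 * B m y
  dom : ∀ m, 1 ≤ m → ∀ x, |B m x| ≤ Γ m x

/-- The recursion for the norming sequence `c`. -/
def cSeq {d : ℕ} (B : ℕ → Ed d → ℝ) (lam : ℝ) (c : ℕ → ℝ) : Prop :=
  c 0 = 1 ∧ ∀ n, 1 ≤ n →
    c n = c (n - 1) + lam * ∑ k ∈ Finset.Icc 1 n, c k * bInt B k * c (n - k)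

/-- The basic convolution recursion for `C` (with `C_0 = δ_0`). -/
def CSeq (d : ℕ) (B : ℕ → Ed d → ℝ) (lam : ℝ) (c : ℕ → ℝ) (C : ℕ → Ed d → ℝ) : Prop :=
  (∀ x, C 1 x = gauss d 1 x + lam * (c 1 * B 1 x)) ∧
  ∀ n, 2 ≤ n → ∀ x, C n x = convl d (C (n - 1)) (gauss d 1) x +
    lam * ((∑ k ∈ Finset.Icc 1 (n - 1), c k * convl d (B k) (C (n - k)) x) + c n * B n x)

/-- The drift parameter `δ`. -/
def deltaParam {d : ℕ} (B : ℕ → Ed d → ℝ) (lam μ : ℝ) (a : ℕ → ℝ) : ℝ :=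
  (μ⁻¹ + lam * ∑' m : ℕ, a (m + 1) * bbar B (m + 1)) /
    (μ⁻¹ + lam * ∑' m : ℕ, ((m : ℝ) + 1) * a (m + 1) * bInt B (m + 1))

def zeta1 {d : ℕ} (Γ : ℕ → Ed d → ℝ) (n : ℕ) : ℝ :=
  1 + ∑ i ∈ Finset.range 3, ∑ m ∈ Finset.Icc 1 n, (m : ℝ) ^ (2 - i) * gammaMom Γ i m

def zeta2 {d : ℕ} (Γ : ℕ → Ed d → ℝ) (n : ℕ) : ℝ :=
  ∑' m : ℕ, (gammaMom Γ 1 (n + m) + (↑(n + m) : ℝ) * gammaMom Γ 0 (n + m))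

def zetaBar {d : ℕ} (Γ : ℕ → Ed d → ℝ) (n : ℕ) : ℝ :=
  (∑ j ∈ Finset.Icc 1 n, zeta1 Γ j) / (n : ℝ) ^ 2 + (∑ j ∈ Finset.Icc 1 n, zeta2 Γ j) / (n : ℝ)

/-- `ψ_n = φ_{nδ(1+ε)}`. -/
def psiFun (d : ℕ) (δv ε : ℝ) (n : ℕ) : Ed d → ℝ := gauss d ((n : ℝ) * δv * (1 + ε))

/-- `f_n = Σ_{s=1}^{[n/2]} s (ψ_s * Γ_{n-s}) + ζ̄(n) ψ_n`. -/
def fFun (d : ℕ) (Γ : ℕ → Ed d → ℝ) (δv ε : ℝ) (n : ℕ) (x : Ed d) : ℝ :=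
  (∑ s ∈ Finset.Icc 1 (n / 2), (s : ℝ) * convl d (psiFun d δv ε s) (Γ (n - s)) x) +
    zetaBar Γ n * psiFun d δv ε n x

/-- `κ(n) = Σ_{s=1}^{[n/2]} ψ_s * Γ_{n-s} + (ζ̄(n)/n) ψ_n`. -/
def kapFun (d : ℕ) (Γ : ℕ → Ed d → ℝ) (δv ε : ℝ) (n : ℕ) (x : Ed d) : ℝ :=
  (∑ s ∈ Finset.Icc 1 (n / 2), convl d (psiFun d δv ε s) (Γ (n - s)) x) +
    zetaBar Γ n / n * psiFun d δv ε n x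

/-- `Δ(k,j)`, with the convention `φ_0 = δ_0` (the `m = k` term is `B_m` itself). -/
def DeltaFun (d : ℕ) (B : ℕ → Ed d → ℝ) (lam μ δv : ℝ) (a : ℕ → ℝ) (k j : ℕ) (x : Ed d) : ℝ :=
  a j * gauss d ((k : ℝ) * δv) x - μ⁻¹ * a (j - 1) * gauss d (((k : ℝ) - 1) * δv + 1) x -
    lam * ∑ m ∈ Finset.Icc 1 j, a m * a (j - m) *
      (if m = k then B m x else convl d (B m) (gauss d (((k : ℝ) - (m : ℝ)) * δv)) x)

/-! Weakly self-avoiding walk. -/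

/-- `I_ρ`, the indicator of the ball of radius `ρ`. -/
def indBall (d : ℕ) (ρ : ℝ) (x : Ed d) : ℝ := if ‖x‖ ≤ ρ then 1 else 0

/-- `K_{λ,ρ}[a,b]`. -/
def Ksaw (d : ℕ) (lam ρ : ℝ) (a b : ℕ) (y : ℕ → Ed d) : ℝ :=
  ∏ p ∈ (Finset.Icc a b ×ˢ Finset.Icc a b).filter fun p => p.1 < p.2,
    (1 - lam * indBall d ρ (y p.2 - y p.1))

/-- `Φ[a,b]`. -/
def PhiProd (d : ℕ) (a b : ℕ) (y : ℕ → Ed d) : ℝ :=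
  ∏ i ∈ Finset.Icc (a + 1) b, gauss d 1 (y i - y (i - 1))

/-- Extend a finite vector `z : Fin L → ℝ^d` to indices `1,…,L` in `ℕ`. -/
def extPath (d L : ℕ) (z : Fin L → Ed d) (i : ℕ) : Ed d :=
  if h : 1 ≤ i ∧ i ≤ L then z ⟨i - 1, by omega⟩ else 0

/-- The path `0, x_1, …, x_{n-1}, x`. -/
def sawPath (d n : ℕ) (x : Ed d) (z : ℕ → Ed d) (j : ℕ) : Ed d :=
  if j = 0 then 0 else if j = n then x else z j

/-- The connectivity function `C_n^{SAW}`. -/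
def Csaw (d : ℕ) (lam ρ : ℝ) (n : ℕ) (x : Ed d) : ℝ :=
  ∫ z : Fin (n - 1) → Ed d,
    Ksaw d lam ρ 0 n (sawPath d n x (extPath d (n - 1) z)) *
      PhiProd d 0 n (sawPath d n x (extPath d (n - 1) z))

/-- `c_n^{SAW} = ∫ C_n^{SAW}`. -/
def csawInt (d : ℕ) (lam ρ : ℝ) (n : ℕ) : ℝ := ∫ x, Csaw d lam ρ n x

/-- Connected graphs on `[a,b]` (in the sense of the lace expansion). -/
def IsConnGraph (a b : ℕ) (G : Finset (ℕ × ℕ)) : Prop :=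
  (∀ p ∈ G, a ≤ p.1 ∧ p.1 < p.2 ∧ p.2 ≤ b) ∧
    (∃ p ∈ G, p.1 = a ∨ p.2 = a) ∧ (∃ p ∈ G, p.1 = b ∨ p.2 = b) ∧
    ∀ c, a < c → c < b → ∃ p ∈ G, p.1 < c ∧ c < p.2

/-- `J[a,b]`, the sum over connected graphs. -/
def Jsaw (d : ℕ) (lam ρ : ℝ) (a b : ℕ) (y : ℕ → Ed d) : ℝ :=
  ∑ G ∈ ((Finset.Icc a b ×ˢ Finset.Icc a b).powerset).filter (IsConnGraph a b),
    ∏ p ∈ G, -(lam * indBall d ρ (y p.2 - y p.1))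

/-- The lace functions `Π_n`. -/
def Pisaw (d : ℕ) (lam ρ : ℝ) (n : ℕ) (x : Ed d) : ℝ :=
  ∫ z : Fin (n - 1) → Ed d,
    Jsaw d lam ρ 0 n (sawPath d n x (extPath d (n - 1) z)) *
      PhiProd d 0 n (sawPath d n x (extPath d (n - 1) z))

/-- The error rates `r_n`. -/
def rseq (d n : ℕ) : ℝ :=
  if d = 5 then (n : ℝ) ^ (-(1 : ℝ) / 2)
  else if d = 6 then Real.log n / n
  else (n : ℝ)⁻¹

/-- `Γ_n = K n^{-d/2} Σ_{k=1}^n k^{1-d/2} φ_{2k/5}`. -/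
def GammaSAW (d : ℕ) (K : ℝ) (n : ℕ) (x : Ed d) : ℝ :=
  K * (n : ℝ) ^ (-(d : ℝ) / 2) *
    ∑ k ∈ Finset.Icc 1 n, (k : ℝ) ^ (1 - (d : ℝ) / 2) * gauss d (2 * k / 5) x

/-- `χ_n(s) = LK (n/(s(n-s)))^{d/2}`. -/
def chiSAW (d : ℕ) (LK : ℝ) (n s : ℕ) : ℝ :=
  LK * ((n : ℝ) / ((s : ℝ) * (↑(n - s) : ℝ))) ^ ((d : ℝ) / 2)

/-! Laces. -/

/-- `β(j)`: index of the bond of the basic `N`-lace containing the vertex `j`. -/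
def betaIdx (N j : ℕ) : ℕ :=
  if j = 0 then 1 else if j = 2 * N - 1 then N else if j % 2 = 0 then j / 2 else (j + 3) / 2

/-- `Φ^{(ν)}_{N,m,t}(x₁,…,x_{N-1})` (with `x 0 = 0` as convention on the argument). -/
def PhiLace (d N : ℕ) (ν : ℝ) (m : Fin (2 * N - 1) → ℕ) (t : Fin (2 * N - 1) → ℝ)
    (x : ℕ → Ed d) : ℝ :=
  ∏ i : Fin (2 * N - 1),
    gauss d (ν * m i + t i) (x (betaIdx N ((i : ℕ) + 1) - 1) - x (betaIdx N (i : ℕ) - 1))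

/-- `L^{(N)}_r[0,n]`: interdistance vectors summing to `n`, bounded below by `r`. -/
def laceFinset (len n : ℕ) (r : Fin len → ℕ) : Finset (Fin len → ℕ) :=
  (Fintype.piFinset fun _ => Finset.range (n + 1)).filter fun m =>
    (∑ i, m i) = n ∧ ∀ i, r i ≤ m i

/-- Extend a vector `Fin len → ℕ` to indices `1,…,len`. -/
def extVec (len : ℕ) (m : Fin len → ℕ) (i : ℕ) : ℕ :=
  if h : 1 ≤ i ∧ i ≤ len then m ⟨i - 1, by omega⟩ else 0

/-- The vertices of a lace diagram, collapsing steps with `m_i = 0` (`G_0 = δ_0`). -/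
def laceVertex (d N : ℕ) (m : ℕ → ℕ) (x : Ed d) (z : ℕ → Ed d) : ℕ → Ed d
  | 0 => 0
  | i + 1 =>
    if i + 1 = 2 * N - 1 then x
    else if m (i + 1) = 0 then laceVertex d N m x z i
    else z (i + 1)

/-- Lower endpoint `i̲` of the `i`-th bond of the basic `N`-lace. -/
def bLow (i : ℕ) : ℕ := if i = 1 then 0 else 2 * i - 3

/-- Upper endpoint `ī` of the `i`-th bond of the basic `N`-lace. -/
def bHigh (N i : ℕ) : ℕ := if i = N then 2 * N - 1 else 2 * i

/-- `Ξ_ℓ(G,ρ)(x)`; coordinates with `m_i = 0` are collapsed (the `δ_0` convention),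
and the corresponding unused integration variables are normalized away by a
standard Gaussian factor. -/
def XiLace (d N : ℕ) (G : ℕ → Ed d → ℝ) (ρ : ℝ) (m : Fin (2 * N - 1) → ℕ) (x : Ed d) : ℝ :=
  ∫ z : Fin (2 * N - 2) → Ed d,
    (∏ i ∈ Finset.Icc 1 (2 * N - 1),
      if extVec (2 * N - 1) m i = 0 then gauss d 1 (extPath d (2 * N - 2) z i)
      else
        G (extVec (2 * N - 1) m i)
          (laceVertex d N (extVec (2 * N - 1) m) x (extPath d (2 * N - 2) z) i -
            laceVertex d N (extVec (2 * N - 1) m) x (extPath d (2 * N - 2) z) (i - 1))) *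
    ∏ i ∈ Finset.Icc 1 N,
      indBall d ρ
        (laceVertex d N (extVec (2 * N - 1) m) x (extPath d (2 * N - 2) z) (bHigh N i) -
          laceVertex d N (extVec (2 * N - 1) m) x (extPath d (2 * N - 2) z) (bLow i))

/-- The natural restriction vector `r⁰` for `N`-laces (`0`-indexed). -/
def r0vec (N : ℕ) (j : Fin (2 * N - 1)) : ℕ :=
  if (j : ℕ) % 2 = 1 ∨ (j : ℕ) = 0 ∨ (j : ℕ) = 2 * N - 2 then 1 else 0

/-- `ξ_n^{(N)}(G,ρ) = Σ_{ℓ ∈ L^{(N)}[0,n]} Ξ_ℓ(G,ρ)`. -/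
def xiLace (d N : ℕ) (G : ℕ → Ed d → ℝ) (ρ : ℝ) (n : ℕ) (x : Ed d) : ℝ :=
  ∑ m ∈ laceFinset (2 * N - 1) n (r0vec N), XiLace d N G ρ m x

/-- `Γ_n = n^{-a} φ_{n/2}`. -/
def GammaPoly (d : ℕ) (a : ℝ) (n : ℕ) (x : Ed d) : ℝ := (n : ℝ) ^ (-a) * gauss d ((n : ℝ) / 2) x

open scoped ENNReal

/-! ### Gaussian densities -/

variable {d : ℕ}

theorem gauss_pos {t : ℝ} (ht : 0 < t) (x : Ed d) : 0 < gauss d t x := by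
  unfold gauss; positivity

theorem gauss_nonneg {t : ℝ} (ht : 0 ≤ t) (x : Ed d) : 0 ≤ gauss d t x := by
  unfold gauss; positivity

theorem gauss_neg (t : ℝ) (x : Ed d) : gauss d t (-x) = gauss d t x := by
  simp [gauss]

theorem gauss_sub_comm (t : ℝ) (x y : Ed d) : gauss d t (x - y) = gauss d t (y - x) := by
  rw [← gauss_neg, neg_sub]

theorem gauss_zero (hd : d ≠ 0) (x : Ed d) : gauss d 0 x = 0 := by
  unfold gauss
  rw [mul_zero, Real.zero_rpow, zero_mul]
  have : (d : ℝ) ≠ 0 := by exact_mod_cast hd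
  intro h; apply this; linarith

theorem continuous_gauss (t : ℝ) : Continuous (gauss d t) := by
  unfold gauss; fun_prop

@[fun_prop]
theorem measurable_gauss (t : ℝ) : Measurable (gauss d t) := (continuous_gauss t).measurable

theorem integral_gauss {t : ℝ} (ht : 0 < t) : ∫ x, gauss d t x = 1 := by
  unfold gauss
  rw [integral_const_mul]
  have h := GaussianFourier.integral_rexp_neg_mul_sq_norm (V := Ed d) (b := 1 / (2 * t))
    (by positivity)
  have e : ∀ x : Ed d, -‖x‖ ^ 2 / (2 * t) = -(1 / (2 * t)) * ‖x‖ ^ 2 := fun x => by ring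
  simp_rw [e]
  rw [h]
  have hp : Real.pi / (1 / (2 * t)) = 2 * Real.pi * t := by field_simp
  rw [hp, finrank_euclideanSpace, Fintype.card_fin, neg_div, Real.rpow_neg (by positivity)]
  apply inv_mul_cancel₀
  positivity

theorem integrable_gauss {t : ℝ} (ht : 0 < t) : Integrable (gauss d t) := by
  by_contra h
  have := integral_gauss (d := d) ht
  rw [integral_undef h] at this
  norm_num at this

theorem lintegral_gauss {t : ℝ} (ht : 0 < t) : ∫⁻ x, ENNReal.ofReal (gauss d t x) = 1 := by
  rw [← ofReal_integral_eq_lintegral_ofReal (integrable_gauss ht)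
    (Eventually.of_forall fun x => gauss_nonneg ht.le x), integral_gauss ht, ENNReal.ofReal_one]

theorem gauss_mul_gauss {s t : ℝ} (hs : 0 < s) (ht : 0 < t) (u x y : Ed d) :
    gauss d s (y - u) * gauss d t (x - y) = gauss d (s + t) (x - u) *
      gauss d (s * t / (s + t)) (y - (t / (s + t)) • u - (s / (s + t)) • x) := by
  unfold gauss
  have hst : 0 < s + t := by positivity
  have e1 : (2 * Real.pi * s) ^ (-(d : ℝ) / 2) * (2 * Real.pi * t) ^ (-(d : ℝ) / 2) =
      (2 * Real.pi * (s + t)) ^ (-(d : ℝ) / 2) *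
        (2 * Real.pi * (s * t / (s + t))) ^ (-(d : ℝ) / 2) := by
    rw [← Real.mul_rpow (by positivity) (by positivity),
      ← Real.mul_rpow (by positivity) (by positivity)]
    congr 1
    field_simp
  have e2 : -‖y - u‖ ^ 2 / (2 * s) + -‖x - y‖ ^ 2 / (2 * t) = -‖x - u‖ ^ 2 / (2 * (s + t)) +
      -‖y - (t / (s + t)) • u - (s / (s + t)) • x‖ ^ 2 / (2 * (s * t / (s + t))) := by
    set a := y - u with ha
    set b := x - y with hb
    have h1 : x - u = a + b := by rw [ha, hb]; abel
    have h2 : y - (t / (s + t)) • u - (s / (s + t)) • x = (t / (s + t)) • a - (s / (s + t)) • b := by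
      rw [ha, hb, smul_sub, smul_sub]
      have : y = (t / (s + t)) • y + (s / (s + t)) • y := by
        rw [← add_smul, ← add_div, add_comm t s, div_self hst.ne', one_smul]
      nth_rewrite 1 [this]
      abel
    clear_value a b
    rw [h1, h2, norm_add_sq_real, norm_sub_sq_real, norm_smul, norm_smul, real_inner_smul_left,
      real_inner_smul_right, Real.norm_of_nonneg (by positivity), Real.norm_of_nonneg (by positivity)]
    field_simp
    ring
  rw [mul_mul_mul_comm, ← Real.exp_add, e1, e2, Real.exp_add]
  ring

theorem integral_gauss_sub {t : ℝ} (ht : 0 < t) (u : Ed d) : ∫ x, gauss d t (x - u) = 1 := by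
  rw [integral_sub_right_eq_self (gauss d t) u, integral_gauss ht]

theorem lintegral_gauss_sub {t : ℝ} (ht : 0 < t) (u : Ed d) :
    ∫⁻ x, ENNReal.ofReal (gauss d t (x - u)) = 1 := by
  rw [lintegral_sub_right_eq_self (fun x => ENNReal.ofReal (gauss d t x)) u, lintegral_gauss ht]

theorem integral_gauss_mul_gauss {s t : ℝ} (hs : 0 < s) (ht : 0 < t) (u x : Ed d) :
    ∫ y, gauss d s (y - u) * gauss d t (x - y) = gauss d (s + t) (x - u) := by
  simp_rw [gauss_mul_gauss hs ht, sub_sub]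
  rw [integral_const_mul, integral_gauss_sub (by positivity), mul_one]

theorem lintegral_gauss_mul_gauss {s t : ℝ} (hs : 0 < s) (ht : 0 < t) (u x : Ed d) :
    ∫⁻ y, ENNReal.ofReal (gauss d s (y - u)) * ENNReal.ofReal (gauss d t (x - y)) =
      ENNReal.ofReal (gauss d (s + t) (x - u)) := by
  have : ∀ y : Ed d, ENNReal.ofReal (gauss d s (y - u)) * ENNReal.ofReal (gauss d t (x - y)) =
      ENNReal.ofReal (gauss d (s + t) (x - u)) * ENNReal.ofReal (gauss d (s * t / (s + t))
        (y - ((t / (s + t)) • u + (s / (s + t)) • x))) := fun y => by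
    rw [← ENNReal.ofReal_mul (gauss_nonneg hs.le _), gauss_mul_gauss hs ht,
      ENNReal.ofReal_mul (gauss_nonneg (by positivity) _), sub_sub]
  simp_rw [this]
  rw [lintegral_const_mul _ (by fun_prop), lintegral_gauss_sub (by positivity), mul_one]

theorem gauss_le_rpow {t : ℝ} (ht : 0 < t) (x : Ed d) : gauss d t x ≤ t ^ (-(d : ℝ) / 2) := by
  unfold gauss
  have h1 : Real.exp (-‖x‖ ^ 2 / (2 * t)) ≤ 1 := by
    rw [Real.exp_le_one_iff]
    apply div_nonpos_of_nonpos_of_nonneg <;> [simp; positivity]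
  calc _ ≤ (2 * Real.pi * t) ^ (-(d : ℝ) / 2) * 1 := by gcongr
    _ ≤ t ^ (-(d : ℝ) / 2) := by
      rw [mul_one]
      apply Real.rpow_le_rpow_of_nonpos ht
      · nlinarith [Real.pi_gt_three]
      · have : (0:ℝ) ≤ d := by positivity
        linarith

theorem gauss_le_gauss {s t M : ℝ} (hs : 0 < s) (hst : s ≤ t) (hM : t ≤ M * s) (x : Ed d) :
    gauss d s x ≤ M ^ ((d : ℝ) / 2) * gauss d t x := by
  unfold gauss
  have ht : 0 < t := hs.trans_le hst
  have hM0 : 0 < M := pos_of_mul_pos_left (ht.trans_le hM) hs.le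
  rw [← mul_assoc]
  gcongr ?_ * Real.exp ?_
  · rw [neg_div, Real.rpow_neg (by positivity), Real.rpow_neg (by positivity)]
    rw [← div_eq_mul_inv, inv_le_iff_one_le_mul₀ (by positivity), div_mul_eq_mul_div,
      le_div_iff₀ (by positivity), one_mul, ← Real.mul_rpow (by positivity) (by positivity)]
    apply Real.rpow_le_rpow (by positivity) _ (by positivity)
    nlinarith [Real.pi_pos]
  · rw [neg_div, neg_div, neg_le_neg_iff]
    gcongr

theorem gauss_shift {v : ℝ} (hv : 1 / 20 ≤ v) {w y : Ed d} (h : ‖w - y‖ ≤ 1) :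
    gauss d v y ≤ 2 ^ ((d : ℝ) / 2) * Real.exp 10 * gauss d (v + 1 / 20) w := by
  have hv0 : 0 < v := by linarith
  unfold gauss
  have e1 : (2 * Real.pi * v) ^ (-(d : ℝ) / 2) ≤
      2 ^ ((d : ℝ) / 2) * (2 * Real.pi * (v + 1 / 20)) ^ (-(d : ℝ) / 2) := by
    rw [neg_div, Real.rpow_neg (by positivity), Real.rpow_neg (by positivity)]
    rw [← div_eq_mul_inv, inv_le_iff_one_le_mul₀ (by positivity), div_mul_eq_mul_div,
      le_div_iff₀ (by positivity), one_mul, ← Real.mul_rpow (by positivity) (by positivity)]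
    apply Real.rpow_le_rpow (by positivity) _ (by positivity)
    nlinarith [Real.pi_pos]
  have e2 : Real.exp (-‖y‖ ^ 2 / (2 * v)) ≤
      Real.exp 10 * Real.exp (-‖w‖ ^ 2 / (2 * (v + 1 / 20))) := by
    rw [← Real.exp_add]
    gcongr
    have h1 : ‖w‖ ≤ ‖y‖ + 1 := by
      calc ‖w‖ = ‖y + (w - y)‖ := by congr 1; abel
        _ ≤ _ := (norm_add_le _ _).trans (by gcongr)
    have h2 : ‖w‖ ^ 2 ≤ (‖y‖ + 1) ^ 2 := by gcongr
    have h3 : ‖w‖ ^ 2 / (2 * (v + 1 / 20)) ≤ ‖y‖ ^ 2 / (2 * v) + 10 := by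
      rw [div_add' _ _ _ (by positivity), div_le_div_iff₀ (by positivity) (by positivity)]
      have h4 : ‖w‖ ^ 2 * (2 * v) ≤ (‖y‖ + 1) ^ 2 * (2 * v) := by gcongr
      nlinarith [sq_nonneg (20 * v - ‖y‖)]
    rw [neg_div, neg_div]
    linarith
  calc _ ≤ (2 ^ ((d : ℝ) / 2) * (2 * Real.pi * (v + 1 / 20)) ^ (-(d : ℝ) / 2)) *
      (Real.exp 10 * Real.exp (-‖w‖ ^ 2 / (2 * (v + 1 / 20)))) := by gcongr
    _ = _ := by ring

theorem harmonic_min_le {s t : ℝ} (hs : 0 < s) (ht : 0 < t) : min s t / 2 ≤ s * t / (s + t) := by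
  rw [div_le_div_iff₀ (by norm_num) (by positivity)]
  rcases le_total s t with h | h
  · rw [min_eq_left h]; nlinarith
  · rw [min_eq_right h]; nlinarith

theorem lintegral_four_gauss_le {a b p q : ℝ} (ha : 0 < a) (hb : 0 < b) (hp : 0 < p) (hq : 0 < q)
    (u v x : Ed d) :
    ∫⁻ w, ENNReal.ofReal (gauss d a (w - u) * gauss d p (x - w) *
        (gauss d b (w - v) * gauss d q (x - w))) ≤
      ENNReal.ofReal (((min a p + min b q) / 2) ^ (-(d : ℝ) / 2) *
        (gauss d (a + p) (x - u) * gauss d (b + q) (x - v))) := by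
  have e : ∀ w : Ed d, gauss d a (w - u) * gauss d p (x - w) *
        (gauss d b (w - v) * gauss d q (x - w)) =
      (gauss d (a + p) (x - u) * gauss d (b + q) (x - v)) *
      (gauss d (a * p / (a + p)) (w - ((p / (a + p)) • u + (a / (a + p)) • x)) *
       gauss d (b * q / (b + q)) ((((q / (b + q)) • v + (b / (b + q)) • x)) - w)) := fun w => by
    rw [gauss_mul_gauss ha hp, gauss_mul_gauss hb hq, sub_sub, sub_sub,
      gauss_sub_comm (b * q / (b + q))]
    ring
  simp_rw [e]
  have h0 : 0 ≤ gauss d (a + p) (x - u) * gauss d (b + q) (x - v) :=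
    mul_nonneg (gauss_nonneg (by positivity) _) (gauss_nonneg (by positivity) _)
  simp_rw [ENNReal.ofReal_mul h0]
  rw [lintegral_const_mul _ (by fun_prop)]
  have : ∀ w m m' : Ed d, ENNReal.ofReal (gauss d (a * p / (a + p)) (w - m) *
       gauss d (b * q / (b + q)) (m' - w)) = ENNReal.ofReal (gauss d (a * p / (a + p)) (w - m)) *
       ENNReal.ofReal (gauss d (b * q / (b + q)) (m' - w)) := fun w m m' => by
    rw [ENNReal.ofReal_mul (gauss_nonneg (by positivity) _)]
  simp_rw [this]
  rw [lintegral_gauss_mul_gauss (by positivity) (by positivity), ← ENNReal.ofReal_mul h0]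
  apply ENNReal.ofReal_le_ofReal
  rw [mul_comm]
  gcongr
  refine (gauss_le_rpow (by positivity) _).trans ?_
  apply Real.rpow_le_rpow_of_nonpos (by positivity)
  · rw [add_div]
    exact add_le_add (harmonic_min_le ha hp) (harmonic_min_le hb hq)
  · have : (0:ℝ) ≤ d := by positivity
    linarith

/-! ### Marginal integrals over paths -/

/-- Integration of a path functional over the positions at the times in `s`. -/
abbrev pint {d : ℕ} (s : Finset ℕ) (f : (ℕ → Ed d) → ℝ≥0∞) : (ℕ → Ed d) → ℝ≥0∞ :=
  lmarginal (fun _ => (volume : Measure (Ed d))) s f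

section PathIntegral

variable {d : ℕ} {s : Finset ℕ} {f g : (ℕ → Ed d) → ℝ≥0∞}

theorem pint_eq_lintegral (f : (ℕ → Ed d) → ℝ≥0∞) (y : ℕ → Ed d) :
    pint s f y = ∫⁻ z : s → Ed d, f (Function.updateFinset y s z) := rfl

theorem measurable_comp_updateFinset (hf : Measurable f) (y : ℕ → Ed d) :
    Measurable fun z : s → Ed d => f (Function.updateFinset y s z) :=
  hf.comp measurable_updateFinset

theorem pint_dependsOn {S : Set ℕ} (hf : DependsOn f S) : DependsOn (pint s f) (S \ s) := by
  intro x y h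
  unfold pint lmarginal
  congr 1
  ext z
  exact hf.updateFinset z h

theorem pint_mul_left {S : Set ℕ} (hf : DependsOn f S) (hS : Disjoint S s) (hg : Measurable g)
    (y : ℕ → Ed d) : pint s (fun y => f y * g y) y = f y * pint s g y := by
  rw [pint_eq_lintegral, pint_eq_lintegral,
    ← lintegral_const_mul _ (measurable_comp_updateFinset hg y)]
  congr 1
  ext z
  congr 1
  apply hf
  intro i hi
  have : i ∉ s := fun h => Set.disjoint_left.mp hS hi h
  simp [Function.updateFinset, this]

theorem pint_const_mul (c : ℝ≥0∞) (hg : Measurable g) (y : ℕ → Ed d) :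
    pint s (fun y => c * g y) y = c * pint s g y :=
  pint_mul_left (dependsOn_const c) (by simp) hg y

theorem pint_sum {ι : Type*} (A : Finset ι) (F : ι → (ℕ → Ed d) → ℝ≥0∞)
    (hF : ∀ i ∈ A, Measurable (F i)) (y : ℕ → Ed d) :
    pint s (fun y => ∑ i ∈ A, F i y) y = ∑ i ∈ A, pint s (F i) y := by
  simp_rw [pint_eq_lintegral]
  rw [lintegral_finsetSum _ (fun i hi => measurable_comp_updateFinset (hF i hi) y)]

theorem pint_add (hf : Measurable f) (y : ℕ → Ed d) :
    pint s (fun y => f y + g y) y = pint s f y + pint s g y := by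
  simp_rw [pint_eq_lintegral]
  rw [lintegral_add_left (measurable_comp_updateFinset hf y)]

theorem pint_map {T : Ed d → Ed d} (hT : MeasurePreserving T volume volume) (hf : Measurable f)
    (y : ℕ → Ed d) :
    pint s (fun y => f (fun i => T (y i))) y = pint s f (fun i => T (y i)) := by
  simp_rw [pint_eq_lintegral]
  have hm := measurePreserving_pi (ι := s) (fun _ => (volume : Measure (Ed d)))
    (fun _ => (volume : Measure (Ed d))) (f := fun _ => T) (fun _ => hT)
  refine Eq.trans ?_ (hm.lintegral_comp (measurable_comp_updateFinset hf (fun i => T (y i))))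
  congr 1
  ext z
  congr 1
  ext1 i
  by_cases hi : i ∈ s <;> simp [Function.updateFinset, hi]

theorem pint_split {a m b : ℕ} (ham : a < m) (hmb : m < b)
    (hf : DependsOn f (Set.Icc a m)) (hg : DependsOn g (Set.Icc m b))
    (hfm : Measurable f) (hgm : Measurable g) (y : ℕ → Ed d) :
    pint (Ioo a b) (fun y => f y * g y) y = ∫⁻ v,
      pint (Ioo a m) f (Function.update y m v) * pint (Ioo m b) g (Function.update y m v) := by
  have hI : Ioo a b = insert m (Ioo a m ∪ Ioo m b) := by
    ext i; simp only [Finset.mem_insert, Finset.mem_union, Finset.mem_Ioo]; omega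
  have hfg : Measurable fun y => f y * g y := hfm.mul hgm
  rw [hI, pint, lmarginal_insert _ hfg (by simp)]
  congr 1
  ext v
  rw [lmarginal_union _ _ hfg
    (Finset.disjoint_left.mpr fun i => by simp only [Finset.mem_Ioo]; omega)]
  have h1 : (∫⋯∫⁻_Ioo m b, (fun y => f y * g y) ∂fun _ => (volume : Measure (Ed d))) =
      fun y => (pint (Ioo m b) g) y * f y := by
    ext y
    rw [mul_comm]
    exact pint_mul_left hf (Set.disjoint_left.mpr fun i => by simp; omega) hgm y
  rw [h1, mul_comm]
  refine pint_mul_left (pint_dependsOn hg) (Set.disjoint_left.mpr fun i => ?_) hfm _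
  simp only [coe_Ioo, Set.mem_sdiff, Set.mem_Icc, Set.mem_Ioo]; omega

theorem pint_translate (v : Ed d) (hf : Measurable f) (y : ℕ → Ed d) :
    pint s (fun y => f (fun i => y i - v)) y = pint s f (fun i => y i - v) :=
  pint_map (measurePreserving_sub_right volume v) hf y

theorem pint_shift {a b : ℕ} (hab : a ≤ b) (hf : Measurable f) (y : ℕ → Ed d) :
    pint (Ioo a b) (fun y => f (fun i => y (a + i) - y a)) y =
      pint (Ioo 0 (b - a)) f (fun i => y (a + i) - y a) := by
  have h1 : pint (Ioo a b) (fun y => f (fun i => y (a + i) - y a)) y =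
      pint (Ioo a b) (fun z => f (fun i => z (a + i) - y a)) y := by
    unfold pint lmarginal
    simp [Function.updateFinset]
  have h2 : Ioo a b = (Ioo 0 (b - a)).image (fun i => a + i) := by
    ext i
    simp only [Finset.mem_Ioo, Finset.mem_image]
    constructor
    · intro h; exact ⟨i - a, by omega, by omega⟩
    · rintro ⟨j, hj, rfl⟩; omega
  have hinj : Function.Injective (fun i : ℕ => a + i) := fun i j h => by simpa using h
  have hfm : Measurable (fun z : ℕ → Ed d => f (fun i => z i - y a)) :=
    hf.comp (measurable_pi_lambda _ fun i => (measurable_pi_apply i).sub_const _)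
  rw [h1, h2]
  refine (lmarginal_image (μ := fun _ => (volume : Measure (Ed d))) hinj (Ioo 0 (b - a)) hfm y).trans ?_
  exact pint_translate (y a) hf _

end PathIntegral

/-! ### The self-avoiding walk functionals -/

section Functionals

variable {d : ℕ} {lam ρ : ℝ}

theorem indBall_nonneg (x : Ed d) : 0 ≤ indBall d ρ x := by
  unfold indBall; split_ifs <;> norm_num

theorem indBall_le_one (x : Ed d) : indBall d ρ x ≤ 1 := by
  unfold indBall; split_ifs <;> norm_num

@[fun_prop]
theorem measurable_indBall : Measurable (indBall d ρ) := by
  unfold indBall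
  exact Measurable.ite (measurableSet_le measurable_norm measurable_const)
    measurable_const measurable_const

theorem measurable_indBall_path (i j : ℕ) :
    Measurable fun y : ℕ → Ed d => indBall d ρ (y j - y i) :=
  measurable_indBall.comp ((measurable_pi_apply j).sub (measurable_pi_apply i))

theorem measurable_Ksaw (a b : ℕ) : Measurable (Ksaw d lam ρ a b) := by
  unfold Ksaw
  exact Finset.measurable_prod _ fun p _ =>
    measurable_const.sub ((measurable_indBall_path p.1 p.2).const_mul _)

theorem measurable_PhiProd (a b : ℕ) : Measurable (PhiProd d a b) := by
  unfold PhiProd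
  exact Finset.measurable_prod _ fun p _ =>
    (measurable_gauss 1).comp ((measurable_pi_apply _).sub (measurable_pi_apply _))

theorem dependsOn_Ksaw (a b : ℕ) : DependsOn (Ksaw d lam ρ a b) (Set.Icc a b) := by
  intro x y h
  unfold Ksaw
  refine Finset.prod_congr rfl fun p hp => ?_
  simp only [Finset.mem_filter, Finset.mem_product, Finset.mem_Icc] at hp
  rw [h p.1 (by simp; omega), h p.2 (by simp; omega)]

theorem dependsOn_PhiProd (a b : ℕ) : DependsOn (PhiProd d a b) (Set.Icc a b) := by
  intro x y h
  unfold PhiProd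
  refine Finset.prod_congr rfl fun p hp => ?_
  simp only [Finset.mem_Icc] at hp
  rw [h p (by simp; omega), h (p - 1) (by simp; omega)]

theorem Ksaw_shift {a b : ℕ} (hab : a ≤ b) (y : ℕ → Ed d) :
    Ksaw d lam ρ a b y = Ksaw d lam ρ 0 (b - a) (fun i => y (a + i) - y a) := by
  unfold Ksaw
  symm
  refine Finset.prod_nbij (fun p => (a + p.1, a + p.2)) ?_ ?_ ?_ ?_
  · intro p hp
    simp only [Finset.mem_filter, Finset.mem_product, Finset.mem_Icc] at hp ⊢
    omega
  · rintro ⟨p, q⟩ - ⟨p', q'⟩ - h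
    simp only [Prod.mk.injEq, Nat.add_left_cancel_iff] at h ⊢
    exact h
  · rintro ⟨p, q⟩ hp
    simp only [coe_filter, Finset.mem_product, Finset.mem_Icc, Set.mem_ofPred_eq] at hp
    refine ⟨(p - a, q - a), ?_, ?_⟩
    · simp only [coe_filter, Finset.mem_product, Finset.mem_Icc, Set.mem_ofPred_eq]; omega
    · simp only [Prod.mk.injEq]; omega
  · intro p hp
    simp

theorem PhiProd_shift {a b : ℕ} (hab : a ≤ b) (y : ℕ → Ed d) :
    PhiProd d a b y = PhiProd d 0 (b - a) (fun i => y (a + i) - y a) := by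
  unfold PhiProd
  symm
  refine Finset.prod_nbij (fun p => a + p) ?_ ?_ ?_ ?_
  · intro p hp
    simp only [Finset.mem_Icc] at hp ⊢
    omega
  · rintro p - p' - h
    simpa using h
  · rintro p hp
    simp only [coe_Icc, Set.mem_Icc] at hp
    exact ⟨p - a, by simp; omega, by simp; omega⟩
  · intro p hp
    simp only [Finset.mem_Icc] at hp
    simp only [sub_sub_sub_cancel_right]
    rw [Nat.add_sub_assoc (by omega)]

theorem PhiProd_nonneg (a b : ℕ) (y : ℕ → Ed d) : 0 ≤ PhiProd d a b y :=
  Finset.prod_nonneg fun _ _ => gauss_nonneg zero_le_one _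

theorem PhiProd_mul {a m b : ℕ} (ham : a ≤ m) (hmb : m ≤ b) (y : ℕ → Ed d) :
    PhiProd d a b y = PhiProd d a m y * PhiProd d m b y := by
  unfold PhiProd
  rw [← Finset.prod_union]
  · congr 1
    ext i; simp only [Finset.mem_union, Finset.mem_Icc]; omega
  · exact Finset.disjoint_left.mpr fun i => by simp only [Finset.mem_Icc]; omega

theorem PhiProd_succ (a : ℕ) (y : ℕ → Ed d) : PhiProd d a (a + 1) y = gauss d 1 (y (a + 1) - y a) := by
  simp [PhiProd]

theorem edge_factor_nonneg (hl1 : lam ≤ 1) (x : Ed d) :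
    0 ≤ 1 - lam * indBall d ρ x := by
  have := indBall_nonneg (ρ := ρ) x
  have := indBall_le_one (ρ := ρ) x
  nlinarith

theorem edge_factor_le_one (hl0 : 0 ≤ lam) (x : Ed d) : 1 - lam * indBall d ρ x ≤ 1 := by
  have := indBall_nonneg (ρ := ρ) x
  nlinarith

theorem Ksaw_nonneg (hl1 : lam ≤ 1) (a b : ℕ) (y : ℕ → Ed d) :
    0 ≤ Ksaw d lam ρ a b y :=
  Finset.prod_nonneg fun _ _ => edge_factor_nonneg hl1 _

theorem Ksaw_le_one (hl0 : 0 ≤ lam) (hl1 : lam ≤ 1) (a b : ℕ) (y : ℕ → Ed d) :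
    Ksaw d lam ρ a b y ≤ 1 :=
  Finset.prod_le_one (fun _ _ => edge_factor_nonneg hl1 _) fun _ _ => edge_factor_le_one hl0 _

theorem Ksaw_self (a : ℕ) (y : ℕ → Ed d) : Ksaw d lam ρ a a y = 1 := by
  unfold Ksaw
  refine Finset.prod_eq_one fun p hp => ?_
  simp only [Finset.mem_filter, Finset.mem_product, Finset.mem_Icc] at hp
  omega

/-- Factorisation of the interaction at an intermediate time. -/
theorem Ksaw_factor {a m b : ℕ} (ham : a ≤ m) (hmb : m ≤ b) (y : ℕ → Ed d) :
    Ksaw d lam ρ a b y = Ksaw d lam ρ a m y * Ksaw d lam ρ m b y *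
      ∏ p ∈ Ico a m ×ˢ Ioc m b, (1 - lam * indBall d ρ (y p.2 - y p.1)) := by
  unfold Ksaw
  rw [← Finset.prod_union, ← Finset.prod_union]
  · congr 1
    ext p
    simp only [Finset.mem_union, Finset.mem_filter, Finset.mem_product, Finset.mem_Icc,
      Finset.mem_Ico, Finset.mem_Ioc]
    omega
  · refine Finset.disjoint_left.mpr fun p => ?_
    simp only [Finset.mem_union, Finset.mem_filter, Finset.mem_product, Finset.mem_Icc,
      Finset.mem_Ico, Finset.mem_Ioc]
    omega
  · refine Finset.disjoint_left.mpr fun p => ?_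
    simp only [Finset.mem_filter, Finset.mem_product, Finset.mem_Icc]
    omega

theorem Ksaw_le_mul (hl0 : 0 ≤ lam) (hl1 : lam ≤ 1) {a m b : ℕ} (ham : a ≤ m) (hmb : m ≤ b)
    (y : ℕ → Ed d) : Ksaw d lam ρ a b y ≤ Ksaw d lam ρ a m y * Ksaw d lam ρ m b y := by
  rw [Ksaw_factor ham hmb]
  refine mul_le_of_le_one_right (mul_nonneg (Ksaw_nonneg hl1 _ _ _) (Ksaw_nonneg hl1 _ _ _)) ?_
  exact Finset.prod_le_one (fun _ _ => edge_factor_nonneg hl1 _) fun _ _ => edge_factor_le_one hl0 _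

/-- The reference weight of a path segment, in extended nonnegative reals. -/
def phiE (d a b : ℕ) (y : ℕ → Ed d) : ℝ≥0∞ := ENNReal.ofReal (PhiProd d a b y)

/-- The interaction of a path segment, in extended nonnegative reals. -/
def kE (d : ℕ) (lam ρ : ℝ) (a b : ℕ) (y : ℕ → Ed d) : ℝ≥0∞ := ENNReal.ofReal (Ksaw d lam ρ a b y)

/-- The self-avoidance constraint of a single pair. -/
def uE (d : ℕ) (ρ : ℝ) (x : Ed d) : ℝ≥0∞ := ENNReal.ofReal (indBall d ρ x)

/-- The connectivity function, in extended nonnegative reals. -/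
def CE (d : ℕ) (lam ρ : ℝ) (n : ℕ) (x : Ed d) : ℝ≥0∞ :=
  pint (Ioo 0 n) (fun y => kE d lam ρ 0 n y * phiE d 0 n y) (Function.update 0 n x)

/-- The total mass of the connectivity function. -/
def cE (d : ℕ) (lam ρ : ℝ) (n : ℕ) : ℝ≥0∞ := if n = 0 then 1 else ∫⁻ x, CE d lam ρ n x

@[fun_prop]
theorem measurable_phiE (a b : ℕ) : Measurable (phiE d a b) :=
  (measurable_PhiProd a b).ennreal_ofReal

@[fun_prop]
theorem measurable_kE (a b : ℕ) : Measurable (kE d lam ρ a b) :=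
  (measurable_Ksaw a b).ennreal_ofReal

@[fun_prop]
theorem measurable_uE : Measurable (uE d ρ) := measurable_indBall.ennreal_ofReal

theorem dependsOn_phiE (a b : ℕ) : DependsOn (phiE d a b) (Set.Icc a b) := fun x y h => by
  rw [phiE, phiE, dependsOn_PhiProd a b h]

theorem dependsOn_kE (a b : ℕ) : DependsOn (kE d lam ρ a b) (Set.Icc a b) := fun x y h => by
  rw [kE, kE, dependsOn_Ksaw a b h]

theorem dependsOn_mul {f g : (ℕ → Ed d) → ℝ≥0∞} {S : Set ℕ} (hf : DependsOn f S)
    (hg : DependsOn g S) : DependsOn (fun y => f y * g y) S := fun x y h => by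
  simp only [hf h, hg h]

theorem phiE_mul {a m b : ℕ} (ham : a ≤ m) (hmb : m ≤ b) (y : ℕ → Ed d) :
    phiE d a b y = phiE d a m y * phiE d m b y := by
  rw [phiE, PhiProd_mul ham hmb, ENNReal.ofReal_mul (PhiProd_nonneg _ _ _), phiE, phiE]

theorem phiE_succ (a : ℕ) (y : ℕ → Ed d) :
    phiE d a (a + 1) y = ENNReal.ofReal (gauss d 1 (y (a + 1) - y a)) := by
  rw [phiE, PhiProd_succ]

theorem phiE_self (a : ℕ) (y : ℕ → Ed d) : phiE d a a y = 1 := by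
  simp [phiE, PhiProd]

theorem kE_self (a : ℕ) (y : ℕ → Ed d) : kE d lam ρ a a y = 1 := by
  simp [kE, Ksaw_self]

theorem kE_le_one (hl0 : 0 ≤ lam) (hl1 : lam ≤ 1) (a b : ℕ) (y : ℕ → Ed d) :
    kE d lam ρ a b y ≤ 1 := by
  rw [kE, ENNReal.ofReal_le_one]; exact Ksaw_le_one hl0 hl1 _ _ _

theorem kE_le_mul (hl0 : 0 ≤ lam) (hl1 : lam ≤ 1) {a m b : ℕ} (ham : a ≤ m) (hmb : m ≤ b)
    (y : ℕ → Ed d) : kE d lam ρ a b y ≤ kE d lam ρ a m y * kE d lam ρ m b y := by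
  rw [kE, kE, kE, ← ENNReal.ofReal_mul (Ksaw_nonneg hl1 _ _ _)]
  exact ENNReal.ofReal_le_ofReal (Ksaw_le_mul hl0 hl1 ham hmb y)

theorem uE_le_one (x : Ed d) : uE d ρ x ≤ 1 := by
  rw [uE, ENNReal.ofReal_le_one]; exact indBall_le_one _

theorem uE_ne_zero {x : Ed d} (h : uE d ρ x ≠ 0) : ‖x‖ ≤ ρ := by
  by_contra hx
  exact h (by simp [uE, indBall, hx])

theorem pint_kphi {a b : ℕ} (hab : a < b) (y : ℕ → Ed d) :
    pint (Ioo a b) (fun y => kE d lam ρ a b y * phiE d a b y) y = CE d lam ρ (b - a) (y b - y a) := by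
  have h1 : (fun y => kE d lam ρ a b y * phiE d a b y) = fun y : ℕ → Ed d =>
      (fun z => kE d lam ρ 0 (b - a) z * phiE d 0 (b - a) z) (fun i => y (a + i) - y a) := by
    ext y
    simp only [kE, phiE]
    rw [Ksaw_shift hab.le, PhiProd_shift hab.le]
  rw [h1, pint_shift hab.le (f := fun z => kE d lam ρ 0 (b - a) z * phiE d 0 (b - a) z) (by fun_prop),
    CE]
  refine pint_dependsOn (dependsOn_mul (dependsOn_kE _ _) (dependsOn_phiE _ _)) fun i hi => ?_
  simp only [coe_Ioo, Set.mem_sdiff, Set.mem_Icc, Set.mem_Ioo] at hi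
  obtain rfl | rfl : i = 0 ∨ i = b - a := by omega
  · rw [Function.update_of_ne (by omega)]; simp
  · rw [Function.update_self, Nat.add_sub_cancel' hab.le]

theorem pint_phi {a b : ℕ} (hab : a < b) (y : ℕ → Ed d) :
    pint (Ioo a b) (phiE d a b) y = ENNReal.ofReal (gauss d ((b - a : ℕ) : ℝ) (y b - y a)) := by
  induction b, hab using Nat.le_induction generalizing y with
  | base =>
    rw [Nat.succ_eq_add_one, show Ioo a (a + 1) = ∅ by ext i; simp, pint, lmarginal_empty,
      phiE_succ]
    simp
  | succ b hb ih =>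
    have hb' : a < b := hb
    have h1 : phiE d a (b + 1) = fun y => phiE d a b y * phiE d b (b + 1) y := by
      ext y; exact phiE_mul hb'.le (Nat.le_succ b) y
    rw [h1, pint_split hb' (Nat.lt_succ_self b) (dependsOn_phiE _ _) (dependsOn_phiE _ _)
      (by fun_prop) (by fun_prop)]
    simp_rw [ih, show Ioo b (b + 1) = ∅ by ext i; simp, pint, lmarginal_empty, phiE_succ]
    have e1 : ∀ v, Function.update y b v a = y a := fun v => Function.update_of_ne (by omega) _ _
    have e2 : ∀ v, Function.update y b v (b + 1) = y (b + 1) :=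
      fun v => Function.update_of_ne (by omega) _ _
    simp_rw [e1, e2, Function.update_self]
    have hpos : (0 : ℝ) < ((b - a : ℕ) : ℝ) := by
      have : 0 < b - a := by omega
      exact_mod_cast this
    rw [lintegral_gauss_mul_gauss hpos one_pos, show b + 1 - a = (b - a) + 1 by omega]
    push_cast; rfl

theorem CE_le_gauss (hl0 : 0 ≤ lam) (hl1 : lam ≤ 1) {n : ℕ} (hn : 1 ≤ n) (x : Ed d) :
    CE d lam ρ n x ≤ ENNReal.ofReal (gauss d n x) := by
  have h := pint_phi (d := d) (a := 0) (b := n) hn (Function.update 0 n x)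
  rw [Function.update_self, Function.update_of_ne (by omega), Pi.zero_apply, sub_zero,
    Nat.sub_zero] at h
  rw [← h, CE]
  refine lmarginal_mono (fun y => ?_) _
  exact mul_le_of_le_one_left zero_le (kE_le_one hl0 hl1 _ _ _)

theorem measurable_pin (n : ℕ) : Measurable fun x : Ed d => Function.update (0 : ℕ → Ed d) n x :=
  measurable_update _

@[fun_prop]
theorem measurable_CE (n : ℕ) : Measurable (CE d lam ρ n) := by
  unfold CE
  exact (Measurable.lmarginal _ (by fun_prop)).comp (measurable_pin n)

theorem cE_zero : cE d lam ρ 0 = 1 := if_pos rfl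

theorem cE_eq {n : ℕ} (hn : 1 ≤ n) : cE d lam ρ n = ∫⁻ x, CE d lam ρ n x := if_neg (by omega)

theorem cE_le_one (hl0 : 0 ≤ lam) (hl1 : lam ≤ 1) (n : ℕ) : cE d lam ρ n ≤ 1 := by
  rcases Nat.eq_zero_or_pos n with rfl | hn
  · rw [cE_zero]
  · rw [cE_eq hn]
    refine (lintegral_mono (CE_le_gauss hl0 hl1 hn)).trans ?_
    rw [lintegral_gauss (by exact_mod_cast hn)]

theorem pint_kphi_Ioc {a b : ℕ} (hab : a ≤ b) (y : ℕ → Ed d) :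
    pint (Ioc a b) (fun y => kE d lam ρ a b y * phiE d a b y) y = cE d lam ρ (b - a) := by
  rcases hab.eq_or_lt with rfl | hab
  · simp [pint, cE_zero, kE_self, phiE_self]
  · rw [cE_eq (by omega), show Ioc a b = insert b (Ioo a b) by
      ext i; simp only [Finset.mem_Ioc, Finset.mem_insert, Finset.mem_Ioo]; omega, pint,
      lmarginal_insert _ (by fun_prop) (by simp)]
    have h := fun v => pint_kphi (d := d) (lam := lam) (ρ := ρ) hab (Function.update y b v)
    simp only [pint, Function.update_self, Function.update_of_ne hab.ne] at h
    simp_rw [h]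
    exact lintegral_sub_right_eq_self (CE d lam ρ (b - a)) (y a)

end Functionals

/-! ### Graph expansion -/

section Graphs

/-- The edges on the interval `[a,n]`. -/
def edgesOn (a n : ℕ) : Finset (ℕ × ℕ) := (Icc a n ×ˢ Icc a n).filter fun p => p.1 < p.2

/-- The edges of `[a,n]` starting before `t`. -/
def edgesFrom (a t n : ℕ) : Finset (ℕ × ℕ) := (Ico a t ×ˢ Icc a n).filter fun p => p.1 < p.2

theorem mem_edgesOn {a n : ℕ} {p : ℕ × ℕ} : p ∈ edgesOn a n ↔ a ≤ p.1 ∧ p.1 < p.2 ∧ p.2 ≤ n := by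
  simp only [edgesOn, Finset.mem_filter, Finset.mem_product, Finset.mem_Icc]; omega

theorem mem_edgesFrom {a t n : ℕ} {p : ℕ × ℕ} :
    p ∈ edgesFrom a t n ↔ a ≤ p.1 ∧ p.1 < t ∧ p.1 < p.2 ∧ p.2 ≤ n := by
  simp only [edgesFrom, Finset.mem_filter, Finset.mem_product, Finset.mem_Icc, Finset.mem_Ico]
  omega

/-- Every time in `[t,n)` is strictly covered by an edge of `G`. -/
def Covers (t n : ℕ) (G : Finset (ℕ × ℕ)) : Prop :=
  ∀ c, t ≤ c → c < n → ∃ p ∈ G, p.1 < c ∧ c < p.2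

variable (w : ℕ × ℕ → ℝ)

/-- The full interaction on `[a,n]`. -/
def Kw (a n : ℕ) : ℝ := ∏ p ∈ edgesOn a n, (1 + w p)

/-- The interaction of edges of `[a,n]` starting before `t`. -/
def Pw (a t n : ℕ) : ℝ := ∏ p ∈ edgesFrom a t n, (1 + w p)

/-- The sum over graphs on `[a,n]` covering `[t,n)`. -/
def Rw (a t n : ℕ) : ℝ := ∑ G ∈ (edgesOn a n).powerset.filter (Covers t n), ∏ p ∈ G, w p

theorem Rw_self (a n : ℕ) : Rw w a n n = Kw w a n := by
  rw [Rw, Kw, Finset.prod_one_add, Finset.filter_true_of_mem]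
  intro G _ c h1 h2
  omega

theorem edgesOn_eq_union {a t n : ℕ} (hat : a ≤ t) :
    edgesOn a n = edgesFrom a t n ∪ edgesOn t n := by
  ext p
  simp only [Finset.mem_union, mem_edgesOn, mem_edgesFrom]
  omega

theorem disjoint_edges {a t n : ℕ} : Disjoint (edgesFrom a t n) (edgesOn t n) :=
  Finset.disjoint_left.mpr fun p => by simp only [mem_edgesOn, mem_edgesFrom]; omega

theorem Kw_eq_mul {a t n : ℕ} (hat : a ≤ t) : Kw w a n = Pw w a t n * Kw w t n := by
  rw [Kw, edgesOn_eq_union hat, Finset.prod_union disjoint_edges, Pw, Kw]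

theorem Pw_diag (a t : ℕ) : Pw w a t t = Kw w a t := by
  rw [Pw, Kw]
  congr 1
  ext p
  simp only [mem_edgesOn, mem_edgesFrom]
  omega

theorem sum_powerset_union {ι : Type*} [DecidableEq ι] {s t : Finset ι} (h : Disjoint s t)
    (f : Finset ι → ℝ) :
    ∑ G ∈ (s ∪ t).powerset, f G = ∑ A ∈ s.powerset, ∑ B ∈ t.powerset, f (A ∪ B) := by
  rw [← Finset.sum_product']
  symm
  refine Finset.sum_nbij' (fun p => p.1 ∪ p.2) (fun G => (G ∩ s, G ∩ t)) ?_ ?_ ?_ ?_ ?_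
  · rintro ⟨A, B⟩ hp
    simp only [Finset.mem_product, Finset.mem_powerset] at hp ⊢
    exact Finset.union_subset_union hp.1 hp.2
  · intro G hG
    simp only [Finset.mem_product, Finset.mem_powerset] at hG ⊢
    exact ⟨Finset.inter_subset_right, Finset.inter_subset_right⟩
  · rintro ⟨A, B⟩ hp
    simp only [Finset.mem_product, Finset.mem_powerset] at hp ⊢
    have hst := Finset.disjoint_left.mp h
    ext x
    · simp only [Finset.mem_inter, Finset.mem_union]
      constructor
      · rintro ⟨hA | hB, hs⟩
        · exact hA
        · exact absurd (hp.2 hB) (hst hs)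
      · exact fun hA => ⟨Or.inl hA, hp.1 hA⟩
    · simp only [Finset.mem_inter, Finset.mem_union]
      constructor
      · rintro ⟨hA | hB, hs⟩
        · exact absurd hs (hst (hp.1 hA))
        · exact hB
      · exact fun hB => ⟨Or.inr hB, hp.2 hB⟩
  · intro G hG
    simp only [Finset.mem_powerset] at hG
    rw [← Finset.inter_union_distrib_left, Finset.inter_eq_left.mpr hG]
  · intros; rfl

theorem sum_powerset_sup_le (s : Finset (ℕ × ℕ)) (t : ℕ) :
    ∑ A ∈ s.powerset, (if A.sup Prod.snd ≤ t then ∏ p ∈ A, w p else 0) =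
      ∏ p ∈ s.filter (fun p => p.2 ≤ t), (1 + w p) := by
  rw [Finset.prod_one_add, ← Finset.sum_filter]
  congr 1
  ext A
  simp only [Finset.mem_filter, Finset.mem_powerset, Finset.sup_le_iff, Finset.subset_iff]
  constructor
  · rintro ⟨h1, h2⟩ p hp
    exact ⟨h1 hp, h2 p hp⟩
  · intro h
    exact ⟨fun p hp => (h hp).1, fun p hp => (h hp).2⟩

theorem Pw_eq_filter {a t t' n : ℕ} (h : t' ≤ n) :
    Pw w a t t' = ∏ p ∈ (edgesFrom a t n).filter (fun p => p.2 ≤ t'), (1 + w p) := by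
  rw [Pw]
  congr 1
  ext p
  simp only [Finset.mem_filter, mem_edgesFrom]
  omega

theorem covers_union {a t n : ℕ} (htn : t < n) {A B : Finset (ℕ × ℕ)}
    (hA : A ⊆ edgesFrom a t n) (hB : B ⊆ edgesOn t n) :
    Covers t n (A ∪ B) ↔ t < A.sup Prod.snd ∧ Covers (A.sup Prod.snd) n B := by
  have hsup : ∀ p ∈ A, p.2 ≤ A.sup Prod.snd := fun p hp => Finset.le_sup (f := Prod.snd) hp
  constructor
  · intro h
    have h1 : t < A.sup Prod.snd := by
      obtain ⟨p, hp, hp1, hp2⟩ := h t le_rfl htn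
      rcases Finset.mem_union.mp hp with hp | hp
      · exact hp2.trans_le (hsup p hp)
      · have := mem_edgesOn.mp (hB hp); omega
    refine ⟨h1, fun c hc hcn => ?_⟩
    obtain ⟨p, hp, hp1, hp2⟩ := h c (h1.le.trans hc) hcn
    rcases Finset.mem_union.mp hp with hp | hp
    · have := hsup p hp; omega
    · exact ⟨p, hp, hp1, hp2⟩
  · rintro ⟨h1, h2⟩ c hc hcn
    rcases lt_or_ge c (A.sup Prod.snd) with h | h
    · obtain ⟨p, hp, hp2⟩ := Finset.lt_sup_iff.mp h
      exact ⟨p, Finset.mem_union_left _ hp, (mem_edgesFrom.mp (hA hp)).2.1.trans_le hc, hp2⟩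
    · obtain ⟨p, hp, hp2⟩ := h2 c h hcn
      exact ⟨p, Finset.mem_union_right _ hp, hp2⟩

theorem Rw_recursion {a t n : ℕ} (hat : a ≤ t) (htn : t < n) :
    Rw w a t n = ∑ t' ∈ Ioc t n, (Pw w a t t' - Pw w a t (t' - 1)) * Rw w t t' n := by
  have h1 : Rw w a t n = ∑ A ∈ (edgesFrom a t n).powerset, ∑ B ∈ (edgesOn t n).powerset,
      ∑ t' ∈ Ioc t n, (if A.sup Prod.snd = t' then ∏ p ∈ A, w p else 0) *
        (if Covers t' n B then ∏ p ∈ B, w p else 0) := by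
    rw [Rw, Finset.sum_filter, edgesOn_eq_union hat, sum_powerset_union disjoint_edges]
    refine Finset.sum_congr rfl fun A hA => Finset.sum_congr rfl fun B hB => ?_
    rw [Finset.mem_powerset] at hA hB
    have hle : A.sup Prod.snd ≤ n := Finset.sup_le fun p hp => (mem_edgesFrom.mp (hA hp)).2.2.2
    have hdis : Disjoint A B := Finset.disjoint_of_subset_left hA
      (Finset.disjoint_of_subset_right hB disjoint_edges)
    simp only [covers_union htn hA hB, Finset.prod_union hdis, ite_mul, zero_mul,
      Finset.sum_ite_eq, Finset.mem_Ioc, hle, and_true]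
    by_cases h2 : t < A.sup Prod.snd <;> simp [h2]
  rw [h1]
  have h2 : ∀ t' ∈ Ioc t n, Pw w a t t' - Pw w a t (t' - 1) =
      ∑ A ∈ (edgesFrom a t n).powerset, (if A.sup Prod.snd = t' then ∏ p ∈ A, w p else 0) := by
    intro t' ht'
    rw [Finset.mem_Ioc] at ht'
    rw [Pw_eq_filter w (t' := t') ht'.2, Pw_eq_filter w (t' := t' - 1) (by omega : t' - 1 ≤ n),
      ← sum_powerset_sup_le, ← sum_powerset_sup_le, ← Finset.sum_sub_distrib]
    refine Finset.sum_congr rfl fun A _ => ?_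
    rcases lt_trichotomy (A.sup Prod.snd) t' with h | h | h
    · rw [if_pos (by omega), if_pos (by omega), if_neg (by omega), sub_self]
    · rw [if_pos (by omega), if_neg (by omega), if_pos h, sub_zero]
    · rw [if_neg (by omega), if_neg (by omega), if_neg (by omega), sub_self]
  have h3 : ∀ A : Finset (ℕ × ℕ), ∑ B ∈ (edgesOn t n).powerset,
      ∑ t' ∈ Ioc t n, (if A.sup Prod.snd = t' then ∏ p ∈ A, w p else 0) *
        (if Covers t' n B then ∏ p ∈ B, w p else 0) =
      ∑ t' ∈ Ioc t n, (if A.sup Prod.snd = t' then ∏ p ∈ A, w p else 0) * Rw w t t' n := by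
    intro A
    rw [Finset.sum_comm]
    refine Finset.sum_congr rfl fun t' _ => ?_
    rw [← Finset.mul_sum, Rw, Finset.sum_filter]
  simp_rw [h3]
  rw [Finset.sum_comm]
  refine Finset.sum_congr rfl fun t' ht' => ?_
  rw [h2 t' ht', Finset.sum_mul]

theorem sum_Ioc_sub_pred (f : ℕ → ℝ) {t n : ℕ} (htn : t ≤ n) :
    ∑ i ∈ Ioc t n, (f i - f (i - 1)) = f n - f t := by
  induction n, htn using Nat.le_induction with
  | base => simp
  | succ n hn ih =>
    rw [Finset.sum_Ioc_succ_top hn, ih]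
    simp

/-- The expansion of the interaction at the end of the component of `[a,t]`. -/
theorem Kw_eq_sum_Rw {a t n : ℕ} (hat : a ≤ t) (htn : t ≤ n) :
    Kw w a n = ∑ c ∈ Icc t n, Rw w a t c * Kw w c n := by
  induction h : n - t using Nat.strong_induction_on generalizing a t with
  | _ k ih =>
    subst h
    have hI : Icc t n = insert t (Ioc t n) := by
      ext i; simp only [Finset.mem_insert, Finset.mem_Icc, Finset.mem_Ioc]; omega
    rw [hI, Finset.sum_insert (by simp), Rw_self]
    have h1 : ∑ c ∈ Ioc t n, Rw w a t c * Kw w c n =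
        ∑ c ∈ Ioc t n, ∑ t' ∈ Ioc t n, if t' ≤ c then
          (Pw w a t t' - Pw w a t (t' - 1)) * (Rw w t t' c * Kw w c n) else 0 := by
      refine Finset.sum_congr rfl fun c hc => ?_
      rw [Finset.mem_Ioc] at hc
      rw [Rw_recursion w hat hc.1, Finset.sum_mul, ← Finset.sum_filter]
      refine Finset.sum_congr ?_ fun t' _ => by ring
      ext i; simp only [Finset.mem_filter, Finset.mem_Ioc]; omega
    rw [h1, Finset.sum_comm]
    have h2 : ∀ t' ∈ Ioc t n, (∑ c ∈ Ioc t n, if t' ≤ c then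
          (Pw w a t t' - Pw w a t (t' - 1)) * (Rw w t t' c * Kw w c n) else 0) =
        (Pw w a t t' - Pw w a t (t' - 1)) * Kw w t n := by
      intro t' ht'
      rw [Finset.mem_Ioc] at ht'
      rw [ih (n - t') (by omega) ht'.1.le ht'.2 rfl, Finset.mul_sum, ← Finset.sum_filter]
      refine Finset.sum_congr ?_ fun _ _ => rfl
      ext i; simp only [Finset.mem_filter, Finset.mem_Ioc, Finset.mem_Icc]; omega
    rw [Finset.sum_congr rfl h2, ← Finset.sum_mul, sum_Ioc_sub_pred _ htn, ← Pw_diag w a t,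
      Kw_eq_mul w (n := n) hat]
    ring

theorem one_sub_prod_le_sum {ι : Type*} (s : Finset ι) (f : ι → ℝ) (h0 : ∀ i ∈ s, 0 ≤ f i)
    (h1 : ∀ i ∈ s, f i ≤ 1) : 1 - ∏ i ∈ s, (1 - f i) ≤ ∑ i ∈ s, f i := by
  induction s using Finset.induction_on with
  | empty => simp
  | insert i s hi ih =>
    rw [Finset.prod_insert hi, Finset.sum_insert hi]
    have h2 := ih (fun j hj => h0 j (Finset.mem_insert_of_mem hj))
      (fun j hj => h1 j (Finset.mem_insert_of_mem hj))
    have h3 : ∏ j ∈ s, (1 - f j) ≤ 1 := Finset.prod_le_one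
      (fun j hj => sub_nonneg.mpr (h1 j (Finset.mem_insert_of_mem hj)))
      (fun j hj => sub_le_self _ (h0 j (Finset.mem_insert_of_mem hj)))
    have h4 := h0 i (Finset.mem_insert_self _ _)
    nlinarith

variable {w}

theorem Kw_nonneg (h1 : ∀ p, -1 ≤ w p) (a n : ℕ) : 0 ≤ Kw w a n :=
  Finset.prod_nonneg fun p _ => by linarith [h1 p]

theorem Pw_anti (h0 : ∀ p, w p ≤ 0) (h1 : ∀ p, -1 ≤ w p) (a t : ℕ) {m n : ℕ} (hmn : m ≤ n) :
    Pw w a t n ≤ Pw w a t m := by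
  unfold Pw
  refine Finset.prod_le_prod_of_subset_of_le_one ?_ ?_ ?_
  · intro p; simp only [mem_edgesFrom]; omega
  · exact fun p _ => by linarith [h1 p]
  · exact fun p _ _ => by linarith [h0 p]

theorem Kw_le_mul (h0 : ∀ p, w p ≤ 0) (h1 : ∀ p, -1 ≤ w p) {a s t : ℕ} (has : a ≤ s) (hst : s ≤ t) :
    Kw w a t ≤ Kw w a s * Kw w s t := by
  rw [Kw_eq_mul w (n := t) has, ← Pw_diag w a s]
  exact mul_le_mul_of_nonneg_right (Pw_anti h0 h1 a s hst) (Kw_nonneg h1 _ _)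

theorem abs_Pw_sub_le (h0 : ∀ p, w p ≤ 0) (h1 : ∀ p, -1 ≤ w p) {a t t' : ℕ} (htt : t < t') :
    |Pw w a t t' - Pw w a t (t' - 1)| ≤ ∑ s ∈ Ico a t, -w (s, t') * (Kw w a s * Kw w s t) := by
  have hle : ∀ m, Pw w a t m ≤ 1 ∧ 0 ≤ Pw w a t m := fun m =>
    ⟨Finset.prod_le_one (fun p _ => by linarith [h1 p]) (fun p _ => by linarith [h0 p]),
      Finset.prod_nonneg fun p _ => by linarith [h1 p]⟩
  have hdec : Pw w a t t' = Pw w a t (t' - 1) * ∏ s ∈ Ico a t, (1 - -w (s, t')) := by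
    have : ∏ s ∈ Ico a t, (1 - -w (s, t')) = ∏ p ∈ (Ico a t).image (fun s => (s, t')), (1 + w p) := by
      rw [Finset.prod_image (by intro x _ y _ h; simpa using h)]
      simp
    rw [this, Pw, Pw, ← Finset.prod_union]
    · congr 1
      ext ⟨p, q⟩
      simp only [Finset.mem_union, mem_edgesFrom, Finset.mem_image, Prod.mk.injEq, Finset.mem_Ico]
      constructor
      · intro h
        rcases eq_or_ne q t' with rfl | hq
        · exact Or.inr ⟨p, by omega, rfl, rfl⟩
        · exact Or.inl (by omega)
      · rintro (h | ⟨x, hx, rfl, rfl⟩) <;> omega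
    · refine Finset.disjoint_left.mpr ?_
      rintro ⟨p, q⟩
      simp only [mem_edgesFrom, Finset.mem_image, Prod.mk.injEq, Finset.mem_Ico]
      rintro h ⟨x, hx, rfl, rfl⟩
      omega
  have h3 := one_sub_prod_le_sum (Ico a t) (fun s => -w (s, t'))
    (fun s _ => by linarith [h0 (s, t')]) (fun s _ => by linarith [h1 (s, t')])
  have h4 : ∏ s ∈ Ico a t, (1 - -w (s, t')) ≤ 1 := Finset.prod_le_one
    (fun s _ => by linarith [h1 (s, t')]) (fun s _ => by linarith [h0 (s, t')])
  have h5 : Pw w a t (t' - 1) ≤ Kw w a t := by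
    rw [← Pw_diag]
    exact Pw_anti h0 h1 a t (by omega)
  rw [abs_sub_comm, hdec]
  calc |Pw w a t (t' - 1) - Pw w a t (t' - 1) * ∏ s ∈ Ico a t, (1 - -w (s, t'))|
      = Pw w a t (t' - 1) * (1 - ∏ s ∈ Ico a t, (1 - -w (s, t'))) := by
        rw [abs_of_nonneg] <;> nlinarith [hle (t' - 1)]
    _ ≤ Kw w a t * ∑ s ∈ Ico a t, -w (s, t') := by
        refine mul_le_mul h5 h3 (by linarith) (Kw_nonneg h1 _ _)
    _ ≤ _ := by
        rw [Finset.mul_sum]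
        refine Finset.sum_le_sum fun s hs => ?_
        rw [Finset.mem_Ico] at hs
        rw [mul_comm]
        exact mul_le_mul_of_nonneg_left (Kw_le_mul h0 h1 hs.1 hs.2.le) (by linarith [h0 (s, t')])

theorem abs_Rw_le (h0 : ∀ p, w p ≤ 0) (h1 : ∀ p, -1 ≤ w p) {a t n : ℕ} (hat : a ≤ t) (htn : t < n) :
    |Rw w a t n| ≤ ∑ t' ∈ Ioc t n, ∑ s ∈ Ico a t,
      -w (s, t') * (Kw w a s * Kw w s t) * |Rw w t t' n| := by
  rw [Rw_recursion w hat htn]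
  refine (Finset.abs_sum_le_sum_abs _ _).trans (Finset.sum_le_sum fun t' ht' => ?_)
  rw [abs_mul, ← Finset.sum_mul]
  exact mul_le_mul_of_nonneg_right (abs_Pw_sub_le h0 h1 (Finset.mem_Ioc.mp ht').1) (abs_nonneg _)

end Graphs

/-! ### The lace expansion -/

section Lace

variable {d : ℕ} {lam ρ : ℝ}

/-- The weight of an edge. -/
def edgeW (d : ℕ) (lam ρ : ℝ) (y : ℕ → Ed d) (p : ℕ × ℕ) : ℝ :=
  -(lam * indBall d ρ (y p.2 - y p.1))

theorem edgeW_nonpos (hl0 : 0 ≤ lam) (y : ℕ → Ed d) (p : ℕ × ℕ) : edgeW d lam ρ y p ≤ 0 := by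
  have := mul_nonneg hl0 (indBall_nonneg (ρ := ρ) (y p.2 - y p.1))
  simp only [edgeW]; linarith

theorem edgeW_ge (hl1 : lam ≤ 1) (y : ℕ → Ed d) (p : ℕ × ℕ) : -1 ≤ edgeW d lam ρ y p := by
  have := edge_factor_nonneg hl1 (ρ := ρ) (y p.2 - y p.1)
  simp only [edgeW]; linarith

theorem Kw_edgeW (a n : ℕ) (y : ℕ → Ed d) : Kw (edgeW d lam ρ y) a n = Ksaw d lam ρ a n y := by
  simp only [Kw, Ksaw, edgesOn, edgeW, sub_eq_add_neg]

theorem Jsaw_eq_Rw {n : ℕ} (hn : 2 ≤ n) (y : ℕ → Ed d) :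
    Jsaw d lam ρ 0 n y = Rw (edgeW d lam ρ y) 0 1 n := by
  unfold Jsaw Rw
  refine Finset.sum_congr ?_ fun _ _ => rfl
  ext G
  simp only [Finset.mem_filter, Finset.mem_powerset, IsConnGraph]
  constructor
  · rintro ⟨-, h1, -, -, h2⟩
    refine ⟨fun p hp => mem_edgesOn.mpr (h1 p hp), fun c hc hcn => h2 c (by omega) hcn⟩
  · rintro ⟨h1, h2⟩
    have h3 : ∀ p ∈ G, 0 ≤ p.1 ∧ p.1 < p.2 ∧ p.2 ≤ n := fun p hp => mem_edgesOn.mp (h1 hp)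
    refine ⟨fun p hp => (Finset.mem_filter.mp (h1 hp)).1, h3, ?_, ?_, fun c hc hcn => h2 c hc hcn⟩
    · obtain ⟨p, hp, hp1, hp2⟩ := h2 1 le_rfl (by omega)
      exact ⟨p, hp, Or.inl (by omega)⟩
    · obtain ⟨p, hp, hp1, hp2⟩ := h2 (n - 1) (by omega) (by omega)
      exact ⟨p, hp, Or.inr (by have := h3 p hp; omega)⟩

theorem Jsaw_one (y : ℕ → Ed d) : Jsaw d lam ρ 0 1 y = edgeW d lam ρ y (0, 1) := by
  unfold Jsaw
  rw [Finset.sum_eq_single {(0, 1)}]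
  · simp [edgeW]
  · intro G hG hne
    simp only [Finset.mem_filter, IsConnGraph] at hG
    obtain ⟨-, h1, ⟨q, hq, -⟩, -⟩ := hG
    have hall : ∀ p ∈ G, p = (0, 1) := by
      rintro ⟨p1, p2⟩ hp
      have := h1 _ hp
      simp only [Prod.mk.injEq]
      simp only at this
      omega
    exact absurd (Finset.eq_singleton_iff_unique_mem.mpr ⟨hall q hq ▸ hq, hall⟩) hne
  · intro h
    exfalso
    apply h
    simp only [Finset.mem_filter, IsConnGraph]
    refine ⟨by simp, by simp, ⟨(0, 1), by simp, by simp⟩, ⟨(0, 1), by simp, by simp⟩, ?_⟩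
    intro c h1 h2; omega

theorem Ksaw_lace {n : ℕ} (hn : 1 ≤ n) (y : ℕ → Ed d) :
    Ksaw d lam ρ 0 n y = Ksaw d lam ρ 1 n y +
      ∑ m ∈ Icc 1 n, Jsaw d lam ρ 0 m y * Ksaw d lam ρ m n y := by
  have h := Kw_eq_sum_Rw (edgeW d lam ρ y) (a := 0) (t := 1) (n := n) zero_le_one hn
  have hI : Icc 1 n = insert 1 (Icc 2 n) := by
    ext i; simp only [Finset.mem_insert, Finset.mem_Icc]; omega
  rw [hI, Finset.sum_insert (by simp)] at h ⊢
  simp only [Kw_edgeW, Rw_self] at h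
  have h01 : Ksaw d lam ρ 0 1 y = 1 + Jsaw d lam ρ 0 1 y := by
    rw [Jsaw_one, ← Kw_edgeW, Kw, show edgesOn 0 1 = {(0, 1)} by decide, Finset.prod_singleton]
  rw [h, h01, add_mul, one_mul, add_assoc]
  congr 2
  refine Finset.sum_congr rfl fun m hm => ?_
  rw [Jsaw_eq_Rw (Finset.mem_Icc.mp hm).1]

theorem measurable_Jsaw (a b : ℕ) : Measurable (Jsaw d lam ρ a b) := by
  unfold Jsaw
  exact Finset.measurable_sum _ fun G _ => Finset.measurable_prod _ fun p _ =>
    ((measurable_indBall_path p.1 p.2).const_mul _).neg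

theorem dependsOn_Jsaw (a b : ℕ) : DependsOn (Jsaw d lam ρ a b) (Set.Icc a b) := by
  intro x y h
  unfold Jsaw
  refine Finset.sum_congr rfl fun G hG => Finset.prod_congr rfl fun p hp => ?_
  have := (Finset.mem_filter.mp hG).2.1 p hp
  rw [h p.1 (by simp; omega), h p.2 (by simp; omega)]

theorem abs_Jsaw_le (hl0 : 0 ≤ lam) (hl1 : lam ≤ 1) (a b : ℕ) (y : ℕ → Ed d) :
    |Jsaw d lam ρ a b y| ≤ (((Icc a b ×ˢ Icc a b).powerset.filter (IsConnGraph a b)).card : ℝ) := by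
  unfold Jsaw
  refine (Finset.abs_sum_le_sum_abs _ _).trans ?_
  rw [Finset.card_eq_sum_ones]
  push_cast
  refine Finset.sum_le_sum fun G _ => ?_
  rw [Finset.abs_prod]
  refine Finset.prod_le_one (fun _ _ => abs_nonneg _) fun p _ => ?_
  have h1 := edgeW_nonpos hl0 (ρ := ρ) y p
  have h2 := edgeW_ge hl1 (ρ := ρ) y p
  simp only [edgeW] at h1 h2
  rw [abs_le]; constructor <;> linarith

/-- The integral of a path functional over paths from the origin to `x`. -/
def PE (F : (ℕ → Ed d) → ℝ≥0∞) (n : ℕ) (x : Ed d) : ℝ≥0∞ :=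
  pint (Ioo 0 n) F (Function.update 0 n x)

theorem CE_eq_PE (n : ℕ) (x : Ed d) :
    CE d lam ρ n x = PE (fun y => kE d lam ρ 0 n y * phiE d 0 n y) n x := rfl

theorem measurable_PE {F : (ℕ → Ed d) → ℝ≥0∞} (hF : Measurable F) (n : ℕ) : Measurable (PE F n) :=
  (Measurable.lmarginal _ hF).comp (measurable_pin n)

theorem PE_isometry {F : (ℕ → Ed d) → ℝ≥0∞} (hF : Measurable F) (T : Ed d ≃ₗᵢ[ℝ] Ed d)
    (hT : ∀ y, F (fun i => T (y i)) = F y) {n : ℕ} (x : Ed d) : PE F n (T x) = PE F n x := by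
  unfold PE
  have h := pint_map (s := Ioo 0 n) T.measurePreserving hF (Function.update 0 n x)
  simp_rw [hT] at h
  rw [h]
  congr 1
  ext1 i
  rcases eq_or_ne i n with rfl | hi
  · simp
  · simp [Function.update_of_ne hi]

theorem PE_conv {F : (ℕ → Ed d) → ℝ≥0∞} (hF : Measurable F) {m n : ℕ} (hm : 1 ≤ m) (hmn : m < n)
    (hdep : DependsOn F (Set.Icc 0 m)) (x : Ed d) :
    PE (fun y => F y * (kE d lam ρ m n y * phiE d m n y)) n x =
      ∫⁻ v, PE F m v * CE d lam ρ (n - m) (x - v) := by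
  unfold PE
  rw [pint_split hm hmn hdep (dependsOn_mul (dependsOn_kE _ _) (dependsOn_phiE _ _)) hF
    (by fun_prop)]
  congr 1
  ext v
  rw [pint_kphi hmn, Function.update_self, Function.update_of_ne hmn.ne', Function.update_self]
  congr 1
  refine pint_dependsOn hdep fun i hi => ?_
  simp only [coe_Ioo, Set.mem_sdiff, Set.mem_Icc, Set.mem_Ioo] at hi
  obtain rfl | rfl : i = 0 ∨ i = m := by omega
  · rw [Function.update_of_ne (by omega), Function.update_of_ne (by omega),
      Function.update_of_ne (by omega)]
  · rw [Function.update_self, Function.update_self]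

/-- Positive part of the lace functional. -/
def jP (d : ℕ) (lam ρ : ℝ) (n : ℕ) (y : ℕ → Ed d) : ℝ≥0∞ :=
  ENNReal.ofReal (Jsaw d lam ρ 0 n y) * phiE d 0 n y

/-- Negative part of the lace functional. -/
def jM (d : ℕ) (lam ρ : ℝ) (n : ℕ) (y : ℕ → Ed d) : ℝ≥0∞ :=
  ENNReal.ofReal (-Jsaw d lam ρ 0 n y) * phiE d 0 n y

/-- Absolute value of the lace functional. -/
def jA (d : ℕ) (lam ρ : ℝ) (n : ℕ) (y : ℕ → Ed d) : ℝ≥0∞ :=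
  ENNReal.ofReal |Jsaw d lam ρ 0 n y| * phiE d 0 n y

theorem measurable_jP (n : ℕ) : Measurable (jP d lam ρ n) :=
  (measurable_Jsaw 0 n).ennreal_ofReal.mul (measurable_phiE 0 n)

theorem measurable_jM (n : ℕ) : Measurable (jM d lam ρ n) :=
  (measurable_Jsaw 0 n).neg.ennreal_ofReal.mul (measurable_phiE 0 n)

theorem dependsOn_jP (n : ℕ) : DependsOn (jP d lam ρ n) (Set.Icc 0 n) := fun x y h => by
  simp only [jP, dependsOn_Jsaw 0 n h, dependsOn_phiE 0 n h]

theorem dependsOn_jM (n : ℕ) : DependsOn (jM d lam ρ n) (Set.Icc 0 n) := fun x y h => by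
  simp only [jM, dependsOn_Jsaw 0 n h, dependsOn_phiE 0 n h]

theorem jP_le_jA (n : ℕ) (y : ℕ → Ed d) : jP d lam ρ n y ≤ jA d lam ρ n y := by
  unfold jP jA; gcongr; exact le_abs_self _

theorem jM_le_jA (n : ℕ) (y : ℕ → Ed d) : jM d lam ρ n y ≤ jA d lam ρ n y := by
  unfold jM jA; gcongr; exact neg_le_abs _

theorem kE_lace (hl1 : lam ≤ 1) {n : ℕ} (hn : 1 ≤ n) (y : ℕ → Ed d) :
    kE d lam ρ 0 n y * phiE d 0 n y +
        ∑ m ∈ Icc 1 n, jM d lam ρ m y * (kE d lam ρ m n y * phiE d m n y) =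
      phiE d 0 1 y * (kE d lam ρ 1 n y * phiE d 1 n y) +
        ∑ m ∈ Icc 1 n, jP d lam ρ m y * (kE d lam ρ m n y * phiE d m n y) := by
  have e1 : phiE d 0 1 y * (kE d lam ρ 1 n y * phiE d 1 n y) =
      kE d lam ρ 1 n y * phiE d 0 n y := by
    rw [phiE_mul zero_le_one hn]; ring
  have e2 : ∑ m ∈ Icc 1 n, jM d lam ρ m y * (kE d lam ρ m n y * phiE d m n y) =
      (∑ m ∈ Icc 1 n, ENNReal.ofReal (-Jsaw d lam ρ 0 m y) * kE d lam ρ m n y) * phiE d 0 n y := by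
    rw [Finset.sum_mul]
    refine Finset.sum_congr rfl fun m hm => ?_
    rw [jM, phiE_mul (Nat.zero_le m) (Finset.mem_Icc.mp hm).2]; ring
  have e3 : ∑ m ∈ Icc 1 n, jP d lam ρ m y * (kE d lam ρ m n y * phiE d m n y) =
      (∑ m ∈ Icc 1 n, ENNReal.ofReal (Jsaw d lam ρ 0 m y) * kE d lam ρ m n y) * phiE d 0 n y := by
    rw [Finset.sum_mul]
    refine Finset.sum_congr rfl fun m hm => ?_
    rw [jP, phiE_mul (Nat.zero_le m) (Finset.mem_Icc.mp hm).2]; ring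
  rw [e1, e2, e3, ← add_mul, ← add_mul]
  congr 1
  have hK := fun m => Ksaw_nonneg hl1 (ρ := ρ) m n y
  have f : ∀ r : ℕ → ℝ, ∑ m ∈ Icc 1 n, ENNReal.ofReal (r m) * kE d lam ρ m n y =
      ENNReal.ofReal (∑ m ∈ Icc 1 n, max (r m) 0 * Ksaw d lam ρ m n y) := by
    intro r
    rw [ENNReal.ofReal_sum_of_nonneg fun m _ => mul_nonneg (le_max_right _ _) (hK m)]
    refine Finset.sum_congr rfl fun m _ => ?_
    rw [ENNReal.ofReal_mul (le_max_right _ _), kE, ENNReal.ofReal_max]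
    simp
  have hs : ∀ r : ℕ → ℝ, 0 ≤ ∑ m ∈ Icc 1 n, max (r m) 0 * Ksaw d lam ρ m n y := fun r =>
    Finset.sum_nonneg fun m _ => mul_nonneg (le_max_right _ _) (hK m)
  rw [f (fun m => -Jsaw d lam ρ 0 m y), f (fun m => Jsaw d lam ρ 0 m y), kE, kE,
    ← ENNReal.ofReal_add (hK 0) (hs _), ← ENNReal.ofReal_add (hK 1) (hs _), Ksaw_lace hn, add_assoc,
    ← Finset.sum_add_distrib]
  congr 2
  refine Finset.sum_congr rfl fun m _ => ?_
  rw [← add_mul]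
  congr 1
  rcases le_total 0 (Jsaw d lam ρ 0 m y) with h | h
  · rw [max_eq_right (by linarith), max_eq_left h]; ring
  · rw [max_eq_left (by linarith), max_eq_right h]; ring

theorem PE_phi_one (v : Ed d) : PE (phiE d 0 1) 1 v = ENNReal.ofReal (gauss d 1 v) := by
  have h := pint_phi (d := d) (a := 0) (b := 1) one_pos (Function.update 0 1 v)
  rw [PE]
  simpa using h

/-- The convolution recursion of the lace expansion. -/
theorem CE_lace (hl1 : lam ≤ 1) {n : ℕ} (hn : 2 ≤ n) (x : Ed d) :
    CE d lam ρ n x + (∑ m ∈ Ico 1 n, (∫⁻ v, PE (jM d lam ρ m) m v * CE d lam ρ (n - m) (x - v)) +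
        PE (jM d lam ρ n) n x) =
      (∫⁻ v, ENNReal.ofReal (gauss d 1 v) * CE d lam ρ (n - 1) (x - v)) +
      (∑ m ∈ Ico 1 n, (∫⁻ v, PE (jP d lam ρ m) m v * CE d lam ρ (n - m) (x - v)) +
        PE (jP d lam ρ n) n x) := by
  have hm1 : ∀ m, Measurable fun y : ℕ → Ed d => jM d lam ρ m y * (kE d lam ρ m n y * phiE d m n y) :=
    fun m => (measurable_jM m).mul (by fun_prop)
  have hm2 : ∀ m, Measurable fun y : ℕ → Ed d => jP d lam ρ m y * (kE d lam ρ m n y * phiE d m n y) :=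
    fun m => (measurable_jP m).mul (by fun_prop)
  have h := congrArg (fun F => pint (Ioo 0 n) F (Function.update 0 n x))
    (funext fun y => kE_lace (d := d) (ρ := ρ) hl1 (by omega : 1 ≤ n) y)
  beta_reduce at h
  rw [pint_add (by fun_prop), pint_add (by fun_prop), pint_sum _ _ fun m _ => hm1 m,
    pint_sum _ _ fun m _ => hm2 m, show Icc 1 n = insert n (Ico 1 n) by
      ext i; simp only [Finset.mem_insert, Finset.mem_Icc, Finset.mem_Ico]; omega,
    Finset.sum_insert (by simp), Finset.sum_insert (by simp)] at h
  have g1 : ∀ m ∈ Ico 1 n, pint (Ioo 0 n) (fun y => jM d lam ρ m y * (kE d lam ρ m n y * phiE d m n y))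
      (Function.update 0 n x) = ∫⁻ v, PE (jM d lam ρ m) m v * CE d lam ρ (n - m) (x - v) :=
    fun m hm => PE_conv (measurable_jM m) (Finset.mem_Ico.mp hm).1 (Finset.mem_Ico.mp hm).2
      (dependsOn_jM m) x
  have g2 : ∀ m ∈ Ico 1 n, pint (Ioo 0 n) (fun y => jP d lam ρ m y * (kE d lam ρ m n y * phiE d m n y))
      (Function.update 0 n x) = ∫⁻ v, PE (jP d lam ρ m) m v * CE d lam ρ (n - m) (x - v) :=
    fun m hm => PE_conv (measurable_jP m) (Finset.mem_Ico.mp hm).1 (Finset.mem_Ico.mp hm).2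
      (dependsOn_jP m) x
  have g3 : pint (Ioo 0 n) (fun y => phiE d 0 1 y * (kE d lam ρ 1 n y * phiE d 1 n y))
      (Function.update 0 n x) = ∫⁻ v, ENNReal.ofReal (gauss d 1 v) * CE d lam ρ (n - 1) (x - v) := by
    have := PE_conv (lam := lam) (ρ := ρ) (measurable_phiE 0 1) le_rfl (by omega : 1 < n)
      (dependsOn_phiE 0 1) x
    simp_rw [PE_phi_one] at this
    exact this
  rw [Finset.sum_congr rfl g1, Finset.sum_congr rfl g2, g3] at h
  simp only [kE_self, phiE_self, mul_one] at h
  rw [add_comm (∑ m ∈ Ico 1 n, _), add_comm (∑ m ∈ Ico 1 n, _)]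
  exact h

theorem CE_lace_one (hl1 : lam ≤ 1) (x : Ed d) :
    CE d lam ρ 1 x + PE (jM d lam ρ 1) 1 x =
      ENNReal.ofReal (gauss d 1 x) + PE (jP d lam ρ 1) 1 x := by
  have h := congrArg (fun F => pint (Ioo 0 1) F (Function.update 0 1 x))
    (funext fun y => kE_lace (d := d) (ρ := ρ) hl1 (le_refl 1) y)
  simp only [Finset.Icc_self, Finset.sum_singleton, kE_self, phiE_self, mul_one] at h
  rw [pint_add (by fun_prop), pint_add (by fun_prop)] at h
  rw [← PE_phi_one]
  exact h

theorem PE_jA_le (hl0 : 0 ≤ lam) (hl1 : lam ≤ 1) (n : ℕ) (hn : 1 ≤ n) :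
    ∃ M : ℝ≥0∞, M ≠ ⊤ ∧ ∀ x : Ed d, PE (jA d lam ρ n) n x ≤ M * ENNReal.ofReal (gauss d n x) := by
  refine ⟨ENNReal.ofReal ((((Icc 0 n ×ˢ Icc 0 n).powerset.filter (IsConnGraph 0 n)).card : ℝ)),
    ENNReal.ofReal_ne_top, fun x => ?_⟩
  have h := pint_phi (d := d) (a := 0) (b := n) hn (Function.update 0 n x)
  rw [Function.update_self, Function.update_of_ne (by omega), Pi.zero_apply, sub_zero,
    Nat.sub_zero] at h
  rw [← h, ← pint_const_mul _ (measurable_phiE 0 n), PE]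
  refine lmarginal_mono (fun y => ?_) _
  unfold jA
  gcongr
  exact abs_Jsaw_le hl0 hl1 0 n y

theorem Jsaw_isometry (T : Ed d ≃ₗᵢ[ℝ] Ed d) (a b : ℕ) (y : ℕ → Ed d) :
    Jsaw d lam ρ a b (fun i => T (y i)) = Jsaw d lam ρ a b y := by
  unfold Jsaw indBall
  simp only [← map_sub, LinearIsometryEquiv.norm_map]

theorem phiE_isometry (T : Ed d ≃ₗᵢ[ℝ] Ed d) (a b : ℕ) (y : ℕ → Ed d) :
    phiE d a b (fun i => T (y i)) = phiE d a b y := by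
  unfold phiE PhiProd gauss
  simp only [← map_sub, LinearIsometryEquiv.norm_map]

end Lace

section Conversion

variable {d : ℕ} {lam ρ : ℝ}

theorem lintegral_sawPath (F : (ℕ → Ed d) → ℝ≥0∞) {n : ℕ} (hn : 1 ≤ n) (x : Ed d) :
    ∫⁻ z : Fin (n - 1) → Ed d, F (sawPath d n x (extPath d (n - 1) z)) = PE F n x := by
  let e : Fin (n - 1) ≃ (Ioo 0 n : Finset ℕ) :=
    { toFun := fun i => ⟨i + 1, by have := i.2; simp only [Finset.mem_Ioo]; omega⟩
      invFun := fun i => ⟨i - 1, by have := Finset.mem_Ioo.mp i.2; omega⟩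
      left_inv := fun i => by simp
      right_inv := fun i => by
        have := Finset.mem_Ioo.mp i.2
        ext; simp only; omega }
  have hmp := volume_measurePreserving_piCongrLeft (fun _ : (Ioo 0 n : Finset ℕ) => Ed d) e
  rw [PE, pint_eq_lintegral, ← hmp.lintegral_comp_emb (MeasurableEquiv.measurableEmbedding _)]
  refine lintegral_congr fun z => ?_
  congr 1
  ext1 j
  have key : ∀ i : Fin (n - 1), (MeasurableEquiv.piCongrLeft (fun _ : (Ioo 0 n : Finset ℕ) => Ed d) e) z
      (e i) = z i := fun i => Equiv.piCongrLeft_apply_apply (fun _ => Ed d) e z i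
  unfold sawPath extPath Function.updateFinset
  rcases Nat.eq_zero_or_pos j with rfl | hj
  · simp [Function.update_of_ne (by omega : (0:ℕ) ≠ n)]
  · rw [if_neg (by omega)]
    rcases lt_trichotomy j n with h | rfl | h
    · rw [if_neg (by omega), dif_pos (by omega), dif_pos (by simp; omega)]
      have hj' : e ⟨j - 1, by omega⟩ = ⟨j, by simp; omega⟩ := Subtype.ext (by
        change j - 1 + 1 = j
        omega)
      rw [← key, hj']
    · simp
    · rw [if_neg (by omega), dif_neg (by omega), dif_neg (by simp; omega),
        Function.update_of_ne (by omega)]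
      rfl

theorem measurable_sawPath (n : ℕ) (x : Ed d) :
    Measurable fun z : Fin (n - 1) → Ed d => sawPath d n x (extPath d (n - 1) z) := by
  refine measurable_pi_lambda _ fun j => ?_
  unfold sawPath extPath
  split_ifs
  all_goals first | exact measurable_const | exact measurable_pi_apply _

theorem Csaw_eq (hl1 : lam ≤ 1) {n : ℕ} (hn : 1 ≤ n) (x : Ed d) :
    Csaw d lam ρ n x = (CE d lam ρ n x).toReal := by
  rw [CE_eq_PE, ← lintegral_sawPath _ hn, Csaw, integral_eq_lintegral_of_nonneg_ae]
  · congr 1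
    refine lintegral_congr fun z => ?_
    rw [ENNReal.ofReal_mul (Ksaw_nonneg hl1 _ _ _), kE, phiE]
  · exact Eventually.of_forall fun z => mul_nonneg (Ksaw_nonneg hl1 _ _ _) (PhiProd_nonneg _ _ _)
  · exact (((measurable_Ksaw 0 n).mul (measurable_PhiProd 0 n)).comp
      (measurable_sawPath n x)).aestronglyMeasurable

theorem csawInt_eq (hl0 : 0 ≤ lam) (hl1 : lam ≤ 1) {n : ℕ} (hn : 1 ≤ n) :
    csawInt d lam ρ n = (cE d lam ρ n).toReal := by
  rw [csawInt, cE_eq hn]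
  simp_rw [Csaw_eq hl1 hn]
  refine integral_toReal (measurable_CE n).aemeasurable (Eventually.of_forall fun x => ?_)
  exact (CE_le_gauss hl0 hl1 hn x).trans_lt ENNReal.ofReal_lt_top

theorem abs_Pisaw_le (hl0 : 0 ≤ lam) (hl1 : lam ≤ 1) {n : ℕ} (hn : 1 ≤ n) (x : Ed d) :
    |Pisaw d lam ρ n x| ≤ (PE (jA d lam ρ n) n x).toReal := by
  obtain ⟨M, hM, hle⟩ := PE_jA_le (d := d) (ρ := ρ) hl0 hl1 n hn
  rw [← lintegral_sawPath _ hn, Pisaw, ← Real.norm_eq_abs]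
  have heq : ∀ z : Fin (n - 1) → Ed d,
      ENNReal.ofReal ‖Jsaw d lam ρ 0 n (sawPath d n x (extPath d (n - 1) z)) *
      PhiProd d 0 n (sawPath d n x (extPath d (n - 1) z))‖ =
      jA d lam ρ n (sawPath d n x (extPath d (n - 1) z)) := fun z => by
    rw [norm_mul, Real.norm_eq_abs, Real.norm_of_nonneg (PhiProd_nonneg _ _ _),
      ENNReal.ofReal_mul (abs_nonneg _), jA, phiE]
  simp_rw [← heq]
  exact norm_integral_le_lintegral_norm _

end Conversion

/-! ### Reduction of the lace functional to chains of Gaussian lines -/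

/-- The Gaussian density of variance `l / 20`, in extended nonnegative reals. -/
def gE (d l : ℕ) (x : Ed d) : ℝ≥0∞ := ENNReal.ofReal (gauss d ((l : ℝ) / 20) x)

/-- The constant lost when a Gaussian is shifted by a bounded vector. -/
def kS (d : ℕ) : ℝ≥0∞ := ENNReal.ofReal (2 ^ ((d : ℝ) / 2) * Real.exp 10)

/-- The constant dominating the indicator of the unit ball by a Gaussian. -/
def kU (d : ℕ) : ℝ≥0∞ := ENNReal.ofReal ((2 * Real.pi * (1 / 20)) ^ ((d : ℝ) / 2) * Real.exp 10)

section GaussianLines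

variable {d : ℕ} {lam ρ : ℝ}

@[fun_prop]
theorem measurable_gE (l : ℕ) : Measurable (gE d l) := by
  unfold gE; fun_prop

theorem gE_zero (hd : d ≠ 0) (x : Ed d) : gE d 0 x = 0 := by
  simp [gE, gauss_zero hd]

theorem gE_neg (l : ℕ) (x : Ed d) : gE d l (-x) = gE d l x := by
  rw [gE, gauss_neg, gE]

theorem gE_sub_comm (l : ℕ) (x y : Ed d) : gE d l (x - y) = gE d l (y - x) := by
  rw [← gE_neg, neg_sub]

theorem gE_shift {l : ℕ} (hl : 1 ≤ l) {w y : Ed d} (h : ‖w - y‖ ≤ 1) :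
    gE d l y ≤ kS d * gE d (l + 1) w := by
  have hl' : (1 : ℝ) ≤ l := by exact_mod_cast hl
  rw [gE, kS, gE, ← ENNReal.ofReal_mul (by positivity)]
  refine ENNReal.ofReal_le_ofReal ?_
  have := gauss_shift (d := d) (v := (l : ℝ) / 20) (by linarith) h
  rw [show ((l + 1 : ℕ) : ℝ) / 20 = (l : ℝ) / 20 + 1 / 20 by push_cast; ring]
  exact this

theorem uE_le (hρ : ρ ≤ 1) (x : Ed d) : uE d ρ x ≤ kU d * gE d 1 x := by
  by_cases h : ‖x‖ ≤ ρ
  · refine (uE_le_one x).trans ?_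
    rw [kU, gE, ← ENNReal.ofReal_mul (by positivity), ← ENNReal.ofReal_one]
    refine ENNReal.ofReal_le_ofReal ?_
    have hx : ‖x‖ ^ 2 ≤ 1 := by nlinarith [norm_nonneg x]
    have e : ((2 * Real.pi * (1 / 20)) ^ ((d : ℝ) / 2) * Real.exp 10) *
        gauss d (((1 : ℕ) : ℝ) / 20) x = Real.exp (10 - 10 * ‖x‖ ^ 2) := by
      rw [gauss, Nat.cast_one, neg_div, Real.rpow_neg (by positivity),
        show (10 - 10 * ‖x‖ ^ 2) = 10 + (-‖x‖ ^ 2 / (2 * (1 / 20))) by ring, Real.exp_add]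
      field_simp
    rw [e, Real.one_le_exp_iff]
    linarith
  · have : uE d ρ x = 0 := by
      by_contra h0; exact h (uE_ne_zero h0)
    rw [this]; exact zero_le

theorem lintegral_gE_sub {l : ℕ} (hl : 1 ≤ l) (u : Ed d) : ∫⁻ x, gE d l (u - x) = 1 := by
  have hl' : (0 : ℝ) < l := by exact_mod_cast hl
  simp_rw [gE_sub_comm l u]
  unfold gE
  exact lintegral_gauss_sub (by positivity) u

theorem lintegral_uE_le (hρ : ρ ≤ 1) (w : Ed d) : ∫⁻ v, uE d ρ (w - v) ≤ kU d := by
  refine (lintegral_mono fun v => uE_le hρ (w - v)).trans ?_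
  rw [lintegral_const_mul _ (by fun_prop), lintegral_gE_sub le_rfl, mul_one]

theorem uE_mul_gE_le (hρ : ρ ≤ 1) {l : ℕ} (hl : 1 ≤ l) (w v x : Ed d) :
    uE d ρ (w - v) * gE d l (x - v) ≤ uE d ρ (w - v) * (kS d * gE d (l + 1) (x - w)) := by
  by_cases h0 : uE d ρ (w - v) = 0
  · simp [h0]
  · have h := (uE_ne_zero h0).trans hρ
    gcongr
    exact gE_shift hl (by rwa [show x - w - (x - v) = -(w - v) by abel, norm_neg])

theorem one_le_kS : 1 ≤ kS d := by
  rw [kS, ENNReal.one_le_ofReal]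
  have h1 : (1 : ℝ) ≤ 2 ^ ((d : ℝ) / 2) := Real.one_le_rpow (by norm_num) (by positivity)
  have h2 : (1 : ℝ) ≤ Real.exp 10 := Real.one_le_exp (by norm_num)
  nlinarith

theorem kS_ne_top : kS d ≠ ⊤ := ENNReal.ofReal_ne_top

theorem kU_ne_top : kU d ≠ ⊤ := ENNReal.ofReal_ne_top

/-- Two consecutive segments of a walk, the vertex at time `s` being within range of `w`. -/
def segE (d : ℕ) (lam ρ : ℝ) (a s t : ℕ) (w : Ed d) (y : ℕ → Ed d) : ℝ≥0∞ :=
  pint (Ioo a t) (fun z => uE d ρ (w - z s) * ((kE d lam ρ a s z * kE d lam ρ s t z) * phiE d a t z)) y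

/-- Absolute value of the sum over graphs covering `[t, n]`. -/
def rE (d : ℕ) (lam ρ : ℝ) (a t n : ℕ) (y : ℕ → Ed d) : ℝ≥0∞ :=
  ENNReal.ofReal |Rw (edgeW d lam ρ y) a t n|

/-- Integral of the graph sum over all positions strictly between `a` and `n` but that at `t`. -/
def qE (d : ℕ) (lam ρ : ℝ) (a t n : ℕ) (y : ℕ → Ed d) : ℝ≥0∞ :=
  pint ((Ioo a n).erase t) (fun z => rE d lam ρ a t n z * phiE d a n z) y

theorem measurable_edgeW (p : ℕ × ℕ) : Measurable fun y : ℕ → Ed d => edgeW d lam ρ y p := by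
  unfold edgeW
  exact ((measurable_indBall_path p.1 p.2).const_mul _).neg

@[fun_prop]
theorem measurable_rE (a t n : ℕ) : Measurable (rE d lam ρ a t n) := by
  have h : Measurable fun y : ℕ → Ed d => Rw (edgeW d lam ρ y) a t n := by
    unfold Rw
    exact Finset.measurable_sum _ fun G _ => Finset.measurable_prod _ fun p _ => measurable_edgeW p
  exact (measurable_norm.comp h).ennreal_ofReal

theorem dependsOn_rE (a t n : ℕ) : DependsOn (rE d lam ρ a t n) (Set.Icc a n) := by
  intro x y h
  unfold rE Rw
  congr 2
  refine Finset.sum_congr rfl fun G hG => Finset.prod_congr rfl fun p hp => ?_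
  have := mem_edgesOn.mp (Finset.mem_powerset.mp (Finset.mem_filter.mp hG).1 hp)
  unfold edgeW
  rw [h p.1 (by simp; omega), h p.2 (by simp; omega)]

theorem rE_self (hl1 : lam ≤ 1) (a n : ℕ) (y : ℕ → Ed d) : rE d lam ρ a n n y = kE d lam ρ a n y := by
  rw [rE, Rw_self, Kw_edgeW, abs_of_nonneg (Ksaw_nonneg hl1 _ _ _), kE]

theorem rE_le (hl0 : 0 ≤ lam) (hl1 : lam ≤ 1) {a t n : ℕ} (hat : a ≤ t) (htn : t < n)
    (y : ℕ → Ed d) :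
    rE d lam ρ a t n y ≤ ∑ t' ∈ Ioc t n, ∑ s ∈ Ico a t, ENNReal.ofReal lam *
      (uE d ρ (y t' - y s) * (kE d lam ρ a s y * kE d lam ρ s t y) * rE d lam ρ t t' n y) := by
  have h := abs_Rw_le (w := edgeW d lam ρ y) (fun p => edgeW_nonpos hl0 y p) (fun p => edgeW_ge hl1 y p)
    hat htn
  refine (ENNReal.ofReal_le_ofReal h).trans (le_of_eq ?_)
  have hn : ∀ t' s, 0 ≤ -edgeW d lam ρ y (s, t') * (Kw (edgeW d lam ρ y) a s * Kw (edgeW d lam ρ y) s t) *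
      |Rw (edgeW d lam ρ y) t t' n| := fun t' s => by
    rw [Kw_edgeW, Kw_edgeW]
    have := edgeW_nonpos hl0 (ρ := ρ) y (s, t')
    exact mul_nonneg (mul_nonneg (by linarith) (mul_nonneg (Ksaw_nonneg hl1 _ _ _)
      (Ksaw_nonneg hl1 _ _ _))) (abs_nonneg _)
  rw [ENNReal.ofReal_sum_of_nonneg fun t' _ => Finset.sum_nonneg fun s _ => hn t' s]
  refine Finset.sum_congr rfl fun t' _ => ?_
  rw [ENNReal.ofReal_sum_of_nonneg fun s _ => hn t' s]
  refine Finset.sum_congr rfl fun s _ => ?_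
  have e : -edgeW d lam ρ y (s, t') = lam * indBall d ρ (y t' - y s) := by simp [edgeW]
  rw [Kw_edgeW, Kw_edgeW, e, mul_assoc, mul_assoc, ENNReal.ofReal_mul hl0,
    ENNReal.ofReal_mul (indBall_nonneg _), ENNReal.ofReal_mul
      (mul_nonneg (Ksaw_nonneg hl1 _ _ _) (Ksaw_nonneg hl1 _ _ _)),
    ENNReal.ofReal_mul (Ksaw_nonneg hl1 _ _ _), uE, kE, kE, rE]
  ring

theorem qE_term {a s t t' n : ℕ} (has : a ≤ s) (hst : s < t) (htt : t < t') (htn : t' < n)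
    (y : ℕ → Ed d) :
    pint ((Ioo a n).erase t) (fun z => uE d ρ (z t' - z s) * (kE d lam ρ a s z * kE d lam ρ s t z) *
      rE d lam ρ t t' n z * phiE d a n z) y =
    ∫⁻ w, segE d lam ρ a s t w y * qE d lam ρ t t' n (Function.update y t' w) := by
  have hI : (Ioo a n).erase t = insert t' (Ioo a t ∪ (Ioo t n).erase t') := by
    ext i; simp only [Finset.mem_insert, Finset.mem_union, Finset.mem_Ioo, Finset.mem_erase]; omega
  have hm : Measurable fun z : ℕ → Ed d => uE d ρ (z t' - z s) *
      (kE d lam ρ a s z * kE d lam ρ s t z) * rE d lam ρ t t' n z * phiE d a n z := by fun_prop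
  rw [hI, pint, lmarginal_insert _ hm (by simp; omega)]
  refine lintegral_congr fun w => ?_
  rw [lmarginal_union _ _ hm (Finset.disjoint_left.mpr fun i => by
    simp only [Finset.mem_Ioo, Finset.mem_erase]; omega)]
  have h1 : ∀ z : ℕ → Ed d, (∫⋯∫⁻_(Ioo t n).erase t', (fun z => uE d ρ (z t' - z s) *
      (kE d lam ρ a s z * kE d lam ρ s t z) * rE d lam ρ t t' n z * phiE d a n z)
        ∂fun _ => (volume : Measure (Ed d))) z =
      (uE d ρ (z t' - z s) * ((kE d lam ρ a s z * kE d lam ρ s t z) * phiE d a t z)) *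
        qE d lam ρ t t' n z := by
    intro z
    have e : (fun z : ℕ → Ed d => uE d ρ (z t' - z s) *
      (kE d lam ρ a s z * kE d lam ρ s t z) * rE d lam ρ t t' n z * phiE d a n z) = fun z =>
      (uE d ρ (z t' - z s) * ((kE d lam ρ a s z * kE d lam ρ s t z) * phiE d a t z)) *
        (rE d lam ρ t t' n z * phiE d t n z) := by
      ext z; rw [phiE_mul (by omega : a ≤ t) (by omega : t ≤ n)]; ring
    rw [e]
    refine pint_mul_left (S := Set.Icc a t ∪ {t'}) ?_ ?_ (by fun_prop) z
    · intro u v h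
      have hk1 := dependsOn_kE (d := d) (lam := lam) (ρ := ρ) a s (x := u) (y := v)
        fun i hi => h i (by left; simp only [Set.mem_Icc] at hi ⊢; omega)
      have hk2 := dependsOn_kE (d := d) (lam := lam) (ρ := ρ) s t (x := u) (y := v)
        fun i hi => h i (by left; simp only [Set.mem_Icc] at hi ⊢; omega)
      have hk3 := dependsOn_phiE (d := d) a t (x := u) (y := v)
        fun i hi => h i (by left; exact hi)
      simp only [hk1, hk2, hk3, h s (by left; simp only [Set.mem_Icc]; omega), h t' (by right; rfl)]
    · rw [Set.disjoint_left]
      intro i hi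
      simp only [Set.mem_union, Set.mem_Icc, Set.mem_singleton_iff] at hi
      simp only [coe_erase, coe_Ioo, Set.mem_sdiff, Set.mem_Ioo, Set.mem_singleton_iff]
      omega
  rw [lmarginal]
  simp_rw [h1]
  change pint (Ioo a t) (fun z => (uE d ρ (z t' - z s) * ((kE d lam ρ a s z * kE d lam ρ s t z) *
    phiE d a t z)) * qE d lam ρ t t' n z) (Function.update y t' w) = _
  have hdq : DependsOn (qE d lam ρ t t' n) (Set.Icc t n \ ((Ioo t n).erase t' : Finset ℕ)) :=
    pint_dependsOn (dependsOn_mul (dependsOn_rE _ _ _) (dependsOn_phiE _ _))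
  have e2 : (fun z : ℕ → Ed d => (uE d ρ (z t' - z s) * ((kE d lam ρ a s z * kE d lam ρ s t z) *
    phiE d a t z)) * qE d lam ρ t t' n z) = fun z => qE d lam ρ t t' n z *
      (uE d ρ (z t' - z s) * ((kE d lam ρ a s z * kE d lam ρ s t z) * phiE d a t z)) := by
    ext z; rw [mul_comm]
  rw [e2, pint_mul_left hdq ?_ (by fun_prop), mul_comm]
  · congr 1
    rw [segE, pint_eq_lintegral, pint_eq_lintegral]
    refine lintegral_congr fun z => ?_
    have hk : ∀ i ∈ Set.Icc a t, Function.updateFinset (Function.update y t' w) (Ioo a t) z i =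
        Function.updateFinset y (Ioo a t) z i := by
      intro i hi
      simp only [Set.mem_Icc] at hi
      unfold Function.updateFinset
      split_ifs
      · rfl
      · exact Function.update_of_ne (by omega) _ _
    have ht' : Function.updateFinset (Function.update y t' w) (Ioo a t) z t' = w := by
      unfold Function.updateFinset
      rw [dif_neg (by simp; omega), Function.update_self]
    rw [ht', hk s (by simp; omega), dependsOn_kE a s fun i hi => hk i (by simp at hi ⊢; omega),
      dependsOn_kE s t fun i hi => hk i (by simp at hi ⊢; omega), dependsOn_phiE a t hk]
  · rw [Set.disjoint_left]
    intro i hi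
    simp only [coe_erase, coe_Ioo, Set.mem_sdiff, Set.mem_Ioo, Set.mem_singleton_iff,
      Set.mem_Icc] at hi ⊢
    omega

theorem qE_term_last (hl1 : lam ≤ 1) {a s t n : ℕ} (has : a ≤ s) (hst : s < t) (htn : t < n)
    (y : ℕ → Ed d) :
    pint ((Ioo a n).erase t) (fun z => uE d ρ (z n - z s) * (kE d lam ρ a s z * kE d lam ρ s t z) *
      rE d lam ρ t n n z * phiE d a n z) y =
    segE d lam ρ a s t (y n) y * CE d lam ρ (n - t) (y n - y t) := by
  have hI : (Ioo a n).erase t = Ioo a t ∪ Ioo t n := by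
    ext i; simp only [Finset.mem_union, Finset.mem_Ioo, Finset.mem_erase]; omega
  have e : (fun z : ℕ → Ed d => uE d ρ (z n - z s) *
      (kE d lam ρ a s z * kE d lam ρ s t z) * rE d lam ρ t n n z * phiE d a n z) = fun z =>
      (uE d ρ (z n - z s) * ((kE d lam ρ a s z * kE d lam ρ s t z) * phiE d a t z)) *
        (kE d lam ρ t n z * phiE d t n z) := by
    ext z; rw [phiE_mul (by omega : a ≤ t) (by omega : t ≤ n), rE_self hl1]; ring
  rw [e, hI, pint, lmarginal_union _ _ (by fun_prop) (Finset.disjoint_left.mpr fun i => by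
    simp only [Finset.mem_Ioo]; omega)]
  have h1 : ∀ z : ℕ → Ed d, (∫⋯∫⁻_Ioo t n, (fun z => (uE d ρ (z n - z s) *
      ((kE d lam ρ a s z * kE d lam ρ s t z) * phiE d a t z)) *
        (kE d lam ρ t n z * phiE d t n z)) ∂fun _ => (volume : Measure (Ed d))) z =
      CE d lam ρ (n - t) (z n - z t) *
        (uE d ρ (z n - z s) * ((kE d lam ρ a s z * kE d lam ρ s t z) * phiE d a t z)) := by
    intro z
    rw [← pint_kphi htn, mul_comm]
    refine pint_mul_left (S := Set.Icc a t ∪ {n}) ?_ ?_ (by fun_prop) z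
    · intro u v h
      have hk1 := dependsOn_kE (d := d) (lam := lam) (ρ := ρ) a s (x := u) (y := v)
        fun i hi => h i (by left; simp only [Set.mem_Icc] at hi ⊢; omega)
      have hk2 := dependsOn_kE (d := d) (lam := lam) (ρ := ρ) s t (x := u) (y := v)
        fun i hi => h i (by left; simp only [Set.mem_Icc] at hi ⊢; omega)
      have hk3 := dependsOn_phiE (d := d) a t (x := u) (y := v)
        fun i hi => h i (by left; exact hi)
      simp only [hk1, hk2, hk3, h s (by left; simp only [Set.mem_Icc]; omega), h n (by right; rfl)]
    · rw [Set.disjoint_left]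
      intro i hi
      simp only [Set.mem_union, Set.mem_Icc, Set.mem_singleton_iff] at hi
      simp only [coe_Ioo, Set.mem_Ioo]
      omega
  rw [lmarginal]
  simp_rw [h1]
  change pint (Ioo a t) (fun z => CE d lam ρ (n - t) (z n - z t) * (uE d ρ (z n - z s) *
    ((kE d lam ρ a s z * kE d lam ρ s t z) * phiE d a t z))) y = _
  have hdc : DependsOn (fun z : ℕ → Ed d => CE d lam ρ (n - t) (z n - z t)) ({n, t} : Set ℕ) := by
    intro u v h
    simp only [h n (by simp), h t (by simp)]
  rw [pint_mul_left hdc (by rw [Set.disjoint_left]; intro i hi; simp at hi ⊢; omega) (by fun_prop),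
    mul_comm]
  congr 1
  rw [segE, pint_eq_lintegral, pint_eq_lintegral]
  refine lintegral_congr fun z => ?_
  have : Function.updateFinset y (Ioo a t) z n = y n := by
    unfold Function.updateFinset
    rw [dif_neg (by simp; omega)]
  rw [this]

/-- The first bond of a lace is peeled off. -/
theorem qE_le (hl0 : 0 ≤ lam) (hl1 : lam ≤ 1) {a t n : ℕ} (hat : a < t) (htn : t < n)
    (y : ℕ → Ed d) :
    qE d lam ρ a t n y ≤ ENNReal.ofReal lam * ∑ s ∈ Ico a t,
      (segE d lam ρ a s t (y n) y * CE d lam ρ (n - t) (y n - y t) +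
        ∑ t' ∈ Ioo t n, ∫⁻ w, segE d lam ρ a s t w y * qE d lam ρ t t' n (Function.update y t' w)) := by
  set F : ℕ → ℕ → (ℕ → Ed d) → ℝ≥0∞ := fun t' s z => uE d ρ (z t' - z s) *
    (kE d lam ρ a s z * kE d lam ρ s t z) * rE d lam ρ t t' n z * phiE d a n z with hF
  have hFm : ∀ t' s, Measurable (F t' s) := fun t' s => by simp only [hF]; fun_prop
  have h1 : qE d lam ρ a t n y ≤ pint ((Ioo a n).erase t) (fun z => ENNReal.ofReal lam *
      ∑ t' ∈ Ioc t n, ∑ s ∈ Ico a t, F t' s z) y := by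
    unfold qE
    refine lmarginal_mono (fun z => ?_) _
    refine (mul_le_mul_left (rE_le hl0 hl1 hat.le htn z) _).trans (le_of_eq ?_)
    simp only [hF, Finset.mul_sum, Finset.sum_mul]
    refine Finset.sum_congr rfl fun t' _ => Finset.sum_congr rfl fun s _ => ?_
    ring
  refine h1.trans (le_of_eq ?_)
  rw [pint_const_mul _ (Finset.measurable_sum _ fun t' _ => Finset.measurable_sum _ fun s _ => hFm t' s),
    pint_sum _ _ (fun t' _ => Finset.measurable_sum _ fun s _ => hFm t' s)]
  congr 1
  simp_rw [pint_sum _ _ (fun s _ => hFm _ s)]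
  rw [Finset.sum_comm]
  refine Finset.sum_congr rfl fun s hs => ?_
  have hs' := Finset.mem_Ico.mp hs
  rw [show Ioc t n = insert n (Ioo t n) by
      ext i; simp only [Finset.mem_insert, Finset.mem_Ioc, Finset.mem_Ioo]; omega,
    Finset.sum_insert (by simp)]
  congr 1
  · exact qE_term_last hl1 hs'.1 hs'.2 htn y
  · refine Finset.sum_congr rfl fun t' ht' => ?_
    exact qE_term hs'.1 hs'.2 (Finset.mem_Ioo.mp ht').1 (Finset.mem_Ioo.mp ht').2 y

theorem segE_start {a t : ℕ} (hat : a < t) (w : Ed d) (y : ℕ → Ed d) :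
    segE d lam ρ a a t w y = uE d ρ (w - y a) * CE d lam ρ (t - a) (y t - y a) := by
  rw [segE, ← pint_kphi hat]
  simp only [kE_self, one_mul]
  exact pint_mul_left (S := {a}) (fun u v h => by simp only [h a rfl])
    (by simp) (by fun_prop) y

theorem segE_mid {a s t : ℕ} (has : a < s) (hst : s < t) (w : Ed d) (y : ℕ → Ed d) :
    segE d lam ρ a s t w y =
      ∫⁻ v, uE d ρ (w - v) * CE d lam ρ (s - a) (v - y a) * CE d lam ρ (t - s) (y t - v) := by
  have e : (fun z : ℕ → Ed d => uE d ρ (w - z s) * ((kE d lam ρ a s z * kE d lam ρ s t z) *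
      phiE d a t z)) = fun z => (uE d ρ (w - z s) * (kE d lam ρ a s z * phiE d a s z)) *
        (kE d lam ρ s t z * phiE d s t z) := by
    ext z; rw [phiE_mul has.le hst.le]; ring
  rw [segE, e, pint_split has hst ?_ (dependsOn_mul (dependsOn_kE _ _) (dependsOn_phiE _ _))
    (by fun_prop) (by fun_prop)]
  · refine lintegral_congr fun v => ?_
    rw [pint_mul_left (S := {s}) (fun u v h => by simp only [h s rfl]) (by simp) (by fun_prop),
      pint_kphi has, pint_kphi hst, Function.update_self, Function.update_of_ne has.ne,
      Function.update_of_ne hst.ne']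
  · exact dependsOn_mul (fun u v h => by simp only [h s (by simp; omega)])
      (dependsOn_mul (dependsOn_kE _ _) (dependsOn_phiE _ _))

theorem segE_le (hρ : ρ ≤ 1) {A : ℝ≥0∞} (hA1 : 1 ≤ A) {a s t : ℕ} (has : a ≤ s) (hst : s < t)
    (hA : ∀ m, 1 ≤ m → m ≤ t - a → ∀ x, CE d lam ρ m x ≤ A * cE d lam ρ m * gE d (22 * m) x)
    (hR : ∀ k ≤ t - a, cE d lam ρ k * cE d lam ρ (t - a - k) ≤ 2 * cE d lam ρ (t - a))
    (w : Ed d) (y : ℕ → Ed d) :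
    segE d lam ρ a s t w y ≤ (2 * A ^ 2 * kS d ^ 2 * kU d) * cE d lam ρ (t - a) *
      (gE d (22 * (s - a) + 1) (w - y a) * gE d (22 * (t - s) + 1) (w - y t)) := by
  rcases has.eq_or_lt with rfl | has
  · rw [segE_start hst]
    calc uE d ρ (w - y a) * CE d lam ρ (t - a) (y t - y a)
        ≤ uE d ρ (w - y a) * (A * cE d lam ρ (t - a) * gE d (22 * (t - a)) (y t - y a)) := by
          gcongr; exact hA _ (by omega) le_rfl _
      _ = A * cE d lam ρ (t - a) * (uE d ρ (w - y a) * gE d (22 * (t - a)) (y t - y a)) := by ring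
      _ ≤ A * cE d lam ρ (t - a) * (uE d ρ (w - y a) *
          (kS d * gE d (22 * (t - a) + 1) (y t - w))) := by
          gcongr A * cE d lam ρ (t - a) * ?_; exact uE_mul_gE_le hρ (by omega) _ _ _
      _ ≤ A * cE d lam ρ (t - a) * ((kU d * gE d 1 (w - y a)) *
          (kS d * gE d (22 * (t - a) + 1) (y t - w))) := by
          gcongr; exact uE_le hρ _
      _ = (1 * A * kS d * kU d) * cE d lam ρ (t - a) *
          (gE d (22 * (a - a) + 1) (w - y a) * gE d (22 * (t - a) + 1) (w - y t)) := by
          rw [gE_sub_comm _ (y t) w, Nat.sub_self, mul_zero, zero_add]; ring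
      _ ≤ _ := by
          gcongr
          · exact one_le_two
          · exact le_self_pow hA1 (by norm_num)
          · exact le_self_pow one_le_kS (by norm_num)
  · rw [segE_mid has hst]
    have hpt : ∀ v, uE d ρ (w - v) * CE d lam ρ (s - a) (v - y a) * CE d lam ρ (t - s) (y t - v) ≤
        uE d ρ (w - v) * ((A * kS d) ^ 2 * (2 * cE d lam ρ (t - a)) *
        (gE d (22 * (s - a) + 1) (w - y a) * gE d (22 * (t - s) + 1) (w - y t))) := by
      intro v
      by_cases h0 : uE d ρ (w - v) = 0
      · simp [h0]
      have h := (uE_ne_zero h0).trans hρ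
      have g1 : gE d (22 * (s - a)) (v - y a) ≤ kS d * gE d (22 * (s - a) + 1) (w - y a) :=
        gE_shift (by omega) (by rwa [show w - y a - (v - y a) = w - v by abel])
      have g2 : gE d (22 * (t - s)) (y t - v) ≤ kS d * gE d (22 * (t - s) + 1) (w - y t) := by
        rw [gE_sub_comm _ w]
        exact gE_shift (by omega) (by rwa [show y t - w - (y t - v) = -(w - v) by abel, norm_neg])
      have hc := hR (s - a) (by omega)
      rw [show t - a - (s - a) = t - s by omega] at hc
      calc uE d ρ (w - v) * CE d lam ρ (s - a) (v - y a) * CE d lam ρ (t - s) (y t - v)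
          ≤ uE d ρ (w - v) * (A * cE d lam ρ (s - a) * (kS d * gE d (22 * (s - a) + 1) (w - y a))) *
            (A * cE d lam ρ (t - s) * (kS d * gE d (22 * (t - s) + 1) (w - y t))) := by
            gcongr
            · exact (hA _ (by omega) (by omega) _).trans (by gcongr)
            · exact (hA _ (by omega) (by omega) _).trans (by gcongr)
        _ = uE d ρ (w - v) * ((A * kS d) ^ 2 * (cE d lam ρ (s - a) * cE d lam ρ (t - s)) *
          (gE d (22 * (s - a) + 1) (w - y a) * gE d (22 * (t - s) + 1) (w - y t))) := by ring
        _ ≤ _ := by gcongr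
    refine (lintegral_mono hpt).trans ?_
    rw [lintegral_mul_const _ (by fun_prop)]
    calc _ ≤ kU d * ((A * kS d) ^ 2 * (2 * cE d lam ρ (t - a)) *
        (gE d (22 * (s - a) + 1) (w - y a) * gE d (22 * (t - s) + 1) (w - y t))) := by
          gcongr; exact lintegral_uE_le hρ w
      _ = _ := by ring

end GaussianLines

/-! ### Summation of the lace diagrams -/

/-- Weight of a triple of lines of total length `T` in a diagram with `r` steps. -/
def wE (r T : ℕ) : ℝ≥0∞ := if 22 * r ≤ T ∧ T ≤ 24 * r then (2⁻¹ : ℝ≥0∞) ^ (T - 22 * r) else 0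

/-- Sum over the third line of a triple of Gaussian lines. -/
def fE (d r : ℕ) (p q : Ed d) (X Y : ℕ) : ℝ≥0∞ :=
  ∑' C : ℕ, wE r (X + Y + C) * (gE d X p * gE d Y q * gE d C q)

/-- Weighted sum over triples of Gaussian lines. -/
def tE (d r : ℕ) (p q : Ed d) : ℝ≥0∞ := ∑' X : ℕ, ∑' Y : ℕ, fE d r p q X Y

/-- Loss of a double convolution of Gaussian lines. -/
def mE (d i j : ℕ) : ℝ≥0∞ :=
  if i = 0 ∨ j = 0 then 0 else ENNReal.ofReal ((((i : ℝ) + j) / 40) ^ (-(d : ℝ) / 2))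

/-- Total loss of double convolutions. -/
def zE (d : ℕ) : ℝ≥0∞ := ∑' i : ℕ, ∑' j : ℕ, mE d i j

section DiagramSums

variable {d : ℕ} {lam ρ : ℝ}

theorem wE_step {r p T : ℕ} (hp : 1 ≤ p) (hpr : p ≤ r) :
    wE (r - p) T ≤ 4 * wE r (22 * p + 2 + T) := by
  unfold wE
  by_cases h : 22 * (r - p) ≤ T ∧ T ≤ 24 * (r - p)
  · rw [if_pos h, if_pos (by omega), show 22 * p + 2 + T - 22 * r = (T - 22 * (r - p)) + 2 by omega,
      pow_add, mul_left_comm, show (4 : ℝ≥0∞) = 2 ^ 2 by norm_num, ← mul_pow,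
      ENNReal.mul_inv_cancel (by norm_num) (by norm_num), one_pow, mul_one]
  · rw [if_neg h]; exact zero_le

theorem one_le_wE {r : ℕ} (hr : 1 ≤ r) : 1 ≤ 4 * wE r (22 * r + 2) := by
  unfold wE
  rw [if_pos (by omega), show 22 * r + 2 - 22 * r = 2 by omega,
    show (4 : ℝ≥0∞) = 2 ^ 2 by norm_num, ← mul_pow,
    ENNReal.mul_inv_cancel (by norm_num) (by norm_num), one_pow]

theorem gE_four_le (hd : d ≠ 0) {a b : ℕ} (ha : 1 ≤ a) (hb : 1 ≤ b) (B C : ℕ) (u v x : Ed d) :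
    ∫⁻ w, gE d a (w - u) * gE d b (w - v) * (gE d B (x - w) * gE d C (x - w)) ≤
      mE d (min a B) (min b C) * (gE d (a + B) (x - u) * gE d (b + C) (x - v)) := by
  rcases Nat.eq_zero_or_pos B with rfl | hB
  · simp [gE_zero hd]
  rcases Nat.eq_zero_or_pos C with rfl | hC
  · simp [gE_zero hd]
  have ha' : (0 : ℝ) < a := by exact_mod_cast ha
  have hb' : (0 : ℝ) < b := by exact_mod_cast hb
  have hB' : (0 : ℝ) < B := by exact_mod_cast hB
  have hC' : (0 : ℝ) < C := by exact_mod_cast hC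
  have h := lintegral_four_gauss_le (d := d) (a := (a : ℝ) / 20) (b := (b : ℝ) / 20)
    (p := (B : ℝ) / 20) (q := (C : ℝ) / 20) (by positivity) (by positivity) (by positivity)
    (by positivity) u v x
  rw [mE, if_neg (by omega)]
  unfold gE
  have g0 := fun (l : ℕ) (z : Ed d) => gauss_nonneg (d := d) (t := (l : ℝ) / 20) (by positivity) z
  rw [← ENNReal.ofReal_mul (g0 _ _), ← ENNReal.ofReal_mul (by positivity)]
  refine Eq.trans_le (lintegral_congr fun w => ?_) (h.trans (le_of_eq ?_))
  · rw [← ENNReal.ofReal_mul (g0 _ _), ← ENNReal.ofReal_mul (g0 _ _),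
      ← ENNReal.ofReal_mul (mul_nonneg (g0 _ _) (g0 _ _))]
    congr 1; ring
  · have e1 : min ((a : ℝ) / 20) ((B : ℝ) / 20) = (min a B : ℕ) / 20 := by
      rw [Nat.cast_min, min_div_div_right (by norm_num)]
    have e2 : min ((b : ℝ) / 20) ((C : ℝ) / 20) = (min b C : ℕ) / 20 := by
      rw [Nat.cast_min, min_div_div_right (by norm_num)]
    rw [e1, e2, ← add_div, ← add_div, ← add_div, div_div]
    push_cast
    norm_num

theorem tsum_add_min_le (h : ℕ → ℕ → ℝ≥0∞) :
    ∑' a : ℕ, ∑' B : ℕ, h (a + B) (min a B) ≤ 2 * ∑' X : ℕ, ∑' i : ℕ, h X i := by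
  have h1 : ∑' a : ℕ, ∑' B : ℕ, h (a + B) a ≤ ∑' X : ℕ, ∑' i : ℕ, h X i := by
    rw [ENNReal.tsum_comm (f := h)]
    refine ENNReal.tsum_le_tsum fun a => ?_
    exact ENNReal.tsum_comp_le_tsum_of_injective (f := fun B => a + B) (fun _ _ e => by simpa using e)
      (fun X => h X a)
  have h2 : ∑' a : ℕ, ∑' B : ℕ, h (a + B) B ≤ ∑' X : ℕ, ∑' i : ℕ, h X i := by
    rw [ENNReal.tsum_comm]
    simpa only [add_comm] using h1
  calc ∑' a : ℕ, ∑' B : ℕ, h (a + B) (min a B)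
      ≤ ∑' a : ℕ, ∑' B : ℕ, (h (a + B) a + h (a + B) B) := by
        refine ENNReal.tsum_le_tsum fun a => ENNReal.tsum_le_tsum fun B => ?_
        rcases le_total a B with hab | hab
        · rw [min_eq_left hab]; exact le_self_add
        · rw [min_eq_right hab]; exact le_add_self
    _ = ∑' a : ℕ, ∑' B : ℕ, h (a + B) a + ∑' a : ℕ, ∑' B : ℕ, h (a + B) B := by
        simp_rw [ENNReal.tsum_add]
    _ ≤ _ := by rw [two_mul]; gcongr

theorem tsum_mE_le (f : ℕ → ℕ → ℝ≥0∞) :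
    ∑' a : ℕ, ∑' b : ℕ, ∑' B : ℕ, ∑' C : ℕ, mE d (min a B) (min b C) * f (a + B) (b + C) ≤
      4 * zE d * ∑' X : ℕ, ∑' Y : ℕ, f X Y := by
  calc ∑' a : ℕ, ∑' b : ℕ, ∑' B : ℕ, ∑' C : ℕ, mE d (min a B) (min b C) * f (a + B) (b + C)
      = ∑' a : ℕ, ∑' B : ℕ, ∑' b : ℕ, ∑' C : ℕ, mE d (min a B) (min b C) * f (a + B) (b + C) := by
        congr 1; ext a; exact ENNReal.tsum_comm
    _ ≤ ∑' a : ℕ, ∑' B : ℕ, 2 * ∑' Y : ℕ, ∑' j : ℕ, mE d (min a B) j * f (a + B) Y := by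
        refine ENNReal.tsum_le_tsum fun a => ENNReal.tsum_le_tsum fun B => ?_
        exact tsum_add_min_le fun Y j => mE d (min a B) j * f (a + B) Y
    _ ≤ 2 * ∑' X : ℕ, ∑' i : ℕ, 2 * ∑' Y : ℕ, ∑' j : ℕ, mE d i j * f X Y :=
        tsum_add_min_le fun X i => 2 * ∑' Y : ℕ, ∑' j : ℕ, mE d i j * f X Y
    _ = _ := by
        have e : ∀ X, ∑' i : ℕ, 2 * ∑' Y : ℕ, ∑' j : ℕ, mE d i j * f X Y =
            2 * zE d * ∑' Y : ℕ, f X Y := by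
          intro X
          rw [ENNReal.tsum_mul_left, mul_assoc, zE, ← ENNReal.tsum_mul_right]
          congr 2; ext i
          rw [← ENNReal.tsum_mul_left]
          congr 1; ext Y
          rw [ENNReal.tsum_mul_right]
        simp_rw [e]
        rw [ENNReal.tsum_mul_left]
        ring

theorem sum_lines_le (F : ℕ → ℕ → ℝ≥0∞) (a n : ℕ) :
    ∑ t ∈ Ioo a n, ∑ s ∈ Ico a t, F (22 * (s - a) + 1) (22 * (t - s) + 1) ≤
      ∑' X : ℕ, ∑' Y : ℕ, F X Y := by
  rw [Finset.sum_sigma']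
  let g : (Σ _ : ℕ, ℕ) → ℕ × ℕ := fun p => (22 * (p.2 - a) + 1, 22 * (p.1 - p.2) + 1)
  have hg : Set.InjOn g ((Ioo a n).sigma fun t => Ico a t : Finset (Σ _ : ℕ, ℕ)) := by
    rintro ⟨t, s⟩ h1 ⟨t', s'⟩ h2 e
    simp only [coe_sigma, Set.mem_sigma_iff, coe_Ioo, Set.mem_Ioo, coe_Ico, Set.mem_Ico] at h1 h2
    simp only [g, Prod.mk.injEq] at e
    obtain rfl : s = s' := by omega
    obtain rfl : t = t' := by omega
    rfl
  rw [← ENNReal.tsum_prod (f := F)]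
  refine le_trans (le_of_eq ?_) (ENNReal.sum_le_tsum (f := fun q : ℕ × ℕ => F q.1 q.2)
    (((Ioo a n).sigma fun t => Ico a t).image g))
  rw [Finset.sum_image hg]

theorem measurable_qE_update (a t n t' : ℕ) (y : ℕ → Ed d) :
    Measurable fun w : Ed d => qE d lam ρ a t n (Function.update y t' w) := by
  unfold qE
  exact (Measurable.lmarginal _ (by fun_prop)).comp (measurable_update _)

theorem measurable_tE (r : ℕ) (p : Ed d) : Measurable fun q : Ed d => tE d r p q := by
  unfold tE fE
  exact Measurable.tsum fun X => Measurable.tsum fun Y =>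
    Measurable.tsum fun C => by fun_prop

/-- One inductive step of the chain bound. -/
theorem lintegral_chain_le (hd : d ≠ 0) {a' b' p r : ℕ} (hp : 1 ≤ p) (hpr : p ≤ r)
    (ha : 1 ≤ a') (hb : 1 ≤ b') (hab : a' + b' = 22 * p + 2) (u v x : Ed d) :
    ∫⁻ w, gE d a' (w - u) * gE d b' (w - v) * tE d (r - p) (x - v) (x - w) ≤
      4 * ∑' B : ℕ, ∑' C : ℕ, mE d (min a' B) (min b' C) *
        fE d r (x - u) (x - v) (a' + B) (b' + C) := by
  unfold tE fE
  simp_rw [← ENNReal.tsum_mul_left]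
  rw [lintegral_tsum fun A => (by fun_prop)]
  have h1 : ∀ A : ℕ, (∫⁻ w, ∑' B : ℕ, ∑' C : ℕ, gE d a' (w - u) * gE d b' (w - v) *
      (wE (r - p) (A + B + C) * (gE d A (x - v) * gE d B (x - w) * gE d C (x - w)))) ≤
      ∑' B : ℕ, ∑' C : ℕ, 4 * (mE d (min a' B) (min b' C) * (wE r (a' + B + (b' + C) + A) *
        (gE d (a' + B) (x - u) * gE d (b' + C) (x - v) * gE d A (x - v)))) := by
    intro A
    rw [lintegral_tsum fun B => by fun_prop]
    refine ENNReal.tsum_le_tsum fun B => ?_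
    rw [lintegral_tsum fun C => by fun_prop]
    refine ENNReal.tsum_le_tsum fun C => ?_
    calc (∫⁻ w, gE d a' (w - u) * gE d b' (w - v) *
          (wE (r - p) (A + B + C) * (gE d A (x - v) * gE d B (x - w) * gE d C (x - w))))
        = (wE (r - p) (A + B + C) * gE d A (x - v)) *
          ∫⁻ w, gE d a' (w - u) * gE d b' (w - v) * (gE d B (x - w) * gE d C (x - w)) := by
          rw [← lintegral_const_mul _ (by fun_prop)]
          refine lintegral_congr fun w => ?_
          ring
      _ ≤ (4 * wE r (22 * p + 2 + (A + B + C)) * gE d A (x - v)) *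
          (mE d (min a' B) (min b' C) * (gE d (a' + B) (x - u) * gE d (b' + C) (x - v))) := by
          gcongr
          · exact wE_step hp hpr
          · exact gE_four_le hd ha hb B C u v x
      _ = _ := by
          rw [show 22 * p + 2 + (A + B + C) = a' + B + (b' + C) + A by omega]; ring
  refine (ENNReal.tsum_le_tsum h1).trans (le_of_eq ?_)
  rw [ENNReal.tsum_comm]
  refine tsum_congr fun B => ?_
  rw [ENNReal.tsum_comm]

/-- The constant in the bound of a pair of segments. -/
def kSeg (d : ℕ) (A : ℝ≥0∞) : ℝ≥0∞ := 2 * A ^ 2 * kS d ^ 2 * kU d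

theorem chain_le (hd : d ≠ 0) (hl0 : 0 ≤ lam) (hl1 : lam ≤ 1) (hρ : ρ ≤ 1) {A β : ℝ≥0∞}
    (hA1 : 1 ≤ A) {N : ℕ}
    (hA : ∀ m, 1 ≤ m → m ≤ N → ∀ x, CE d lam ρ m x ≤ A * cE d lam ρ m * gE d (22 * m) x)
    (hR : ∀ m ≤ N, ∀ k ≤ m, cE d lam ρ k * cE d lam ρ (m - k) ≤ 2 * cE d lam ρ m)
    (hβ : ENNReal.ofReal lam * (8 * kSeg d A * A) + ENNReal.ofReal lam * (32 * kSeg d A * zE d) * β ≤ β)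
    (a n : ℕ) (hn : n - a ≤ N) (y : ℕ → Ed d) (v : Ed d) :
    ∑ t ∈ Ioo a n, qE d lam ρ a t n (Function.update y t v) ≤
      β * cE d lam ρ (n - a) * tE d (n - a) (y n - y a) (y n - v) := by
  induction hr : n - a using Nat.strong_induction_on generalizing a y v with
  | _ r ih =>
  subst hr
  set r := n - a with hr
  set L := ENNReal.ofReal lam
  set κ := kSeg d A with hκ
  set c := cE d lam ρ with hc
  set p := y n - y a with hp
  set q := y n - v with hq
  have hterm : ∀ t ∈ Ioo a n, qE d lam ρ a t n (Function.update y t v) ≤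
      ∑ s ∈ Ico a t, L * ((8 * κ * A * c r) * fE d r p q (22 * (s - a) + 1) (22 * (t - s) + 1) +
        (8 * κ * β * c r) * ∑' B : ℕ, ∑' C : ℕ,
          mE d (min (22 * (s - a) + 1) B) (min (22 * (t - s) + 1) C) *
          fE d r p q (22 * (s - a) + 1 + B) (22 * (t - s) + 1 + C)) := by
    intro t ht
    obtain ⟨hat, htn⟩ := Finset.mem_Ioo.mp ht
    refine (qE_le hl0 hl1 hat htn _).trans ?_
    rw [Finset.mul_sum]
    refine Finset.sum_le_sum fun s hs => ?_
    obtain ⟨has, hst⟩ := Finset.mem_Ico.mp hs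
    have ea : Function.update y t v a = y a := Function.update_of_ne hat.ne _ _
    have en : Function.update y t v n = y n := Function.update_of_ne htn.ne' _ _
    have et : Function.update y t v t = v := Function.update_self _ _ _
    have hcc : c (t - a) * c (n - t) ≤ 2 * c r := by
      have := hR r hn (t - a) (by omega)
      rwa [show r - (t - a) = n - t by omega] at this
    have hseg : ∀ w, segE d lam ρ a s t w (Function.update y t v) ≤ κ * c (t - a) *
        (gE d (22 * (s - a) + 1) (w - y a) * gE d (22 * (t - s) + 1) (w - v)) := by
      intro w
      have := segE_le hρ hA1 has hst (fun m h1 h2 => hA m h1 (by omega)) (hR (t - a) (by omega)) w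
        (Function.update y t v)
      rwa [ea, et] at this
    refine mul_le_mul_right ?_ L
    refine add_le_add ?_ ?_
    · rw [en, et]
      calc segE d lam ρ a s t (y n) (Function.update y t v) * CE d lam ρ (n - t) (y n - v)
          ≤ (κ * c (t - a) * (gE d (22 * (s - a) + 1) p * gE d (22 * (t - s) + 1) q)) *
            (A * c (n - t) * gE d (22 * (n - t)) q) := by
            gcongr
            · exact hseg _
            · exact hA _ (by omega) (by omega) _
        _ = κ * A * (c (t - a) * c (n - t)) * 1 * (gE d (22 * (s - a) + 1) p *
            gE d (22 * (t - s) + 1) q * gE d (22 * (n - t)) q) := by ring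
        _ ≤ κ * A * (2 * c r) * (4 * wE r (22 * r + 2)) * (gE d (22 * (s - a) + 1) p *
            gE d (22 * (t - s) + 1) q * gE d (22 * (n - t)) q) := by
            gcongr
            exact one_le_wE (by omega)
        _ = (8 * κ * A * c r) * (wE r (22 * (s - a) + 1 + (22 * (t - s) + 1) + 22 * (n - t)) *
            (gE d (22 * (s - a) + 1) p * gE d (22 * (t - s) + 1) q * gE d (22 * (n - t)) q)) := by
            rw [show 22 * (s - a) + 1 + (22 * (t - s) + 1) + 22 * (n - t) = 22 * r + 2 by omega]
            ring
        _ ≤ _ := by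
            gcongr
            exact ENNReal.le_tsum (22 * (n - t))
    · calc (∑ t' ∈ Ioo t n, ∫⁻ w, segE d lam ρ a s t w (Function.update y t v) *
            qE d lam ρ t t' n (Function.update (Function.update y t v) t' w))
          ≤ ∑ t' ∈ Ioo t n, ∫⁻ w, (κ * c (t - a) *
            (gE d (22 * (s - a) + 1) (w - y a) * gE d (22 * (t - s) + 1) (w - v))) *
            qE d lam ρ t t' n (Function.update (Function.update y t v) t' w) := by
            refine Finset.sum_le_sum fun t' _ => lintegral_mono fun w => ?_
            exact mul_le_mul_left (hseg w) _
        _ = ∫⁻ w, (κ * c (t - a) *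
            (gE d (22 * (s - a) + 1) (w - y a) * gE d (22 * (t - s) + 1) (w - v))) *
            ∑ t' ∈ Ioo t n, qE d lam ρ t t' n (Function.update (Function.update y t v) t' w) := by
            simp_rw [Finset.mul_sum]
            rw [lintegral_finsetSum]
            intro t' _
            exact Measurable.mul (by fun_prop) (measurable_qE_update _ _ _ _ _)
        _ ≤ ∫⁻ w, (κ * c (t - a) *
            (gE d (22 * (s - a) + 1) (w - y a) * gE d (22 * (t - s) + 1) (w - v))) *
            (β * c (n - t) * tE d (r - (t - a)) q (y n - w)) := by
            refine lintegral_mono fun w => ?_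
            gcongr
            have := ih (n - t) (by omega) t (by omega) (Function.update y t v) w rfl
            rw [en, et] at this
            rwa [show r - (t - a) = n - t by omega]
        _ = κ * β * (c (t - a) * c (n - t)) * ∫⁻ w, gE d (22 * (s - a) + 1) (w - y a) *
            gE d (22 * (t - s) + 1) (w - v) * tE d (r - (t - a)) q (y n - w) := by
            rw [← lintegral_const_mul]
            · refine lintegral_congr fun w => ?_
              ring
            · exact Measurable.mul (by fun_prop)
                ((measurable_tE _ _).comp (measurable_const.sub measurable_id))
        _ ≤ κ * β * (2 * c r) * (4 * ∑' B : ℕ, ∑' C : ℕ,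
          mE d (min (22 * (s - a) + 1) B) (min (22 * (t - s) + 1) C) *
          fE d r p q (22 * (s - a) + 1 + B) (22 * (t - s) + 1 + C)) := by
            gcongr
            exact lintegral_chain_le hd (by omega) (by omega) (by omega) (by omega) (by omega) _ _ _
        _ = _ := by ring
  refine (Finset.sum_le_sum hterm).trans ?_
  refine (sum_lines_le (fun X Y => L * ((8 * κ * A * c r) * fE d r p q X Y +
        (8 * κ * β * c r) * ∑' B : ℕ, ∑' C : ℕ, mE d (min X B) (min Y C) *
          fE d r p q (X + B) (Y + C))) a n).trans ?_
  simp_rw [ENNReal.tsum_mul_left, ENNReal.tsum_add, ENNReal.tsum_mul_left]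
  calc _ ≤ L * (8 * κ * A * c r * tE d r p q + 8 * κ * β * c r * (4 * zE d * tE d r p q)) := by
        gcongr
        · exact le_rfl
        · exact tsum_mE_le _
    _ = (L * (8 * κ * A) + L * (32 * κ * zE d) * β) * (c r * tE d r p q) := by ring
    _ ≤ β * (c r * tE d r p q) := by gcongr
    _ = _ := by ring

end DiagramSums

/-! ### Bound of the lace functions by triples of Gaussian lines -/

section LaceBound

variable {d : ℕ} {lam ρ : ℝ}

theorem lintegral_gE_conv_le (hd : d ≠ 0) {a : ℕ} (ha : 1 ≤ a) (b : ℕ) (x : Ed d) :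
    ∫⁻ v, gE d a v * gE d b (x - v) ≤ gE d (a + b) x := by
  rcases Nat.eq_zero_or_pos b with rfl | hb
  · simp [gE_zero hd]
  have ha' : (0 : ℝ) < a := by exact_mod_cast ha
  have hb' : (0 : ℝ) < b := by exact_mod_cast hb
  have h := lintegral_gauss_mul_gauss (d := d) (s := (a : ℝ) / 20) (t := (b : ℝ) / 20)
    (by positivity) (by positivity) 0 x
  simp only [sub_zero] at h
  unfold gE
  rw [h, ← add_div]
  push_cast
  exact le_rfl

theorem uE_eq_sq (x : Ed d) : uE d ρ x = uE d ρ x * uE d ρ x := by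
  unfold uE indBall
  split_ifs <;> simp

theorem uE_le_sq (hρ : ρ ≤ 1) (x : Ed d) : uE d ρ x ≤ kU d ^ 2 * (gE d 1 x * gE d 1 x) := by
  calc uE d ρ x = uE d ρ x * uE d ρ x := uE_eq_sq x
    _ ≤ (kU d * gE d 1 x) * (kU d * gE d 1 x) := by gcongr <;> exact uE_le hρ x
    _ = _ := by ring

theorem gE_le_tE {n a b c : ℕ} (hn : 1 ≤ n) (h : a + b + c = 22 * n + 2) (x : Ed d) :
    gE d a x * gE d b x * gE d c x ≤ 4 * tE d n x x := by
  calc gE d a x * gE d b x * gE d c x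
      ≤ (4 * wE n (a + b + c)) * (gE d a x * gE d b x * gE d c x) := by
        rw [h]
        exact le_mul_of_one_le_left zero_le (one_le_wE hn)
    _ = 4 * (wE n (a + b + c) * (gE d a x * gE d b x * gE d c x)) := by ring
    _ ≤ 4 * tE d n x x := by
        gcongr
        refine le_trans ?_ (ENNReal.le_tsum a)
        refine le_trans ?_ (ENNReal.le_tsum b)
        exact ENNReal.le_tsum (f := fun C => wE n (a + b + C) * (gE d a x * gE d b x * gE d C x)) c

theorem uE_mul_tE_le (hd : d ≠ 0) (hρ : ρ ≤ 1) (r : ℕ) (p w x : Ed d) :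
    uE d ρ w * tE d r p (x - w) ≤ uE d ρ w * (kS d ^ 2 * ∑' X : ℕ, ∑' Y : ℕ, ∑' C : ℕ,
      wE r (X + Y + C) * (gE d X p * gE d (Y + 1) x * gE d (C + 1) x)) := by
  by_cases h0 : uE d ρ w = 0
  · simp [h0]
  have hw : ‖w‖ ≤ 1 := (uE_ne_zero h0).trans hρ
  have key : ∀ l : ℕ, gE d l (x - w) ≤ kS d * gE d (l + 1) x := by
    intro l
    rcases Nat.eq_zero_or_pos l with rfl | hl
    · rw [gE_zero hd]; exact zero_le
    · exact gE_shift hl (by simpa using hw)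
  refine mul_le_mul_right ?_ _
  unfold tE fE
  simp_rw [← ENNReal.tsum_mul_left]
  refine ENNReal.tsum_le_tsum fun X => ENNReal.tsum_le_tsum fun Y => ENNReal.tsum_le_tsum fun C => ?_
  calc wE r (X + Y + C) * (gE d X p * gE d Y (x - w) * gE d C (x - w))
      ≤ wE r (X + Y + C) * (gE d X p * (kS d * gE d (Y + 1) x) * (kS d * gE d (C + 1) x)) := by
        gcongr <;> exact key _
    _ = _ := by ring

theorem tsum_shift_le {n : ℕ} (hn : 2 ≤ n) (x : Ed d) :
    ∑' X : ℕ, ∑' Y : ℕ, ∑' C : ℕ, wE (n - 1) (X + Y + C) *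
      (gE d (22 + X) x * gE d (Y + 1) x * gE d (C + 1) x) ≤ 4 * tE d n x x := by
  calc _ ≤ ∑' X : ℕ, ∑' Y : ℕ, ∑' C : ℕ, 4 * (wE n ((22 + X) + (Y + 1) + (C + 1)) *
      (gE d (22 + X) x * gE d (Y + 1) x * gE d (C + 1) x)) := by
        refine ENNReal.tsum_le_tsum fun X => ENNReal.tsum_le_tsum fun Y =>
          ENNReal.tsum_le_tsum fun C => ?_
        rw [← mul_assoc 4]
        refine mul_le_mul_left ?_ _
        have h := wE_step (r := n) (p := 1) (T := X + Y + C) le_rfl (by omega)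
        rwa [show 22 * 1 + 2 + (X + Y + C) = (22 + X) + (Y + 1) + (C + 1) by omega] at h
    _ ≤ _ := by
        simp_rw [ENNReal.tsum_mul_left]
        gcongr
        unfold tE fE
        refine le_trans (ENNReal.tsum_le_tsum fun X => ?_)
          (ENNReal.tsum_comp_le_tsum_of_injective (f := fun X => 22 + X)
            (fun _ _ e => by simpa using e) _)
        refine le_trans (ENNReal.tsum_le_tsum fun Y => ?_)
          (ENNReal.tsum_comp_le_tsum_of_injective (f := fun Y => Y + 1)
            (fun _ _ e => by simpa using e) _)
        exact (ENNReal.tsum_comp_le_tsum_of_injective (f := fun Y => Y + 1)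
            (fun _ _ e => by simpa using e) fun C => wE n ((22 + X) + (Y + 1) + C) *
      (gE d (22 + X) x * gE d (Y + 1) x * gE d C x))

theorem PE_jA_eq {n : ℕ} (hn : 2 ≤ n) (x : Ed d) :
    PE (jA d lam ρ n) n x =
      ∫⁻ v, qE d lam ρ 0 1 n (Function.update (Function.update 0 n x) 1 v) := by
  have e : jA d lam ρ n = fun z => rE d lam ρ 0 1 n z * phiE d 0 n z := by
    funext z
    rw [jA, Jsaw_eq_Rw hn, rE]
  unfold PE qE
  rw [e]
  conv_lhs => rw [← Finset.insert_erase (show 1 ∈ Ioo 0 n by simp; omega)]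
  rw [pint, lmarginal_insert _ (by fun_prop) (by simp)]

/-- The constant in the diagrammatic bound of the lace functions. -/
def kLace (d : ℕ) (A β : ℝ≥0∞) : ℝ≥0∞ := 8 * A ^ 2 * kU d ^ 2 * kS d + 8 * A * kU d * kS d ^ 2 * β

theorem PE_jA_le_tE_of_two_le (hd : d ≠ 0) (hl0 : 0 ≤ lam) (hl1 : lam ≤ 1) (hρ : ρ ≤ 1)
    {A β : ℝ≥0∞} (hA1 : 1 ≤ A) {n : ℕ} (hn : 2 ≤ n)
    (hA : ∀ m, 1 ≤ m → m < n → ∀ x, CE d lam ρ m x ≤ A * cE d lam ρ m * gE d (22 * m) x)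
    (hR : ∀ m ≤ n, ∀ k ≤ m, cE d lam ρ k * cE d lam ρ (m - k) ≤ 2 * cE d lam ρ m)
    (hβ : ENNReal.ofReal lam * (8 * kSeg d A * A) +
      ENNReal.ofReal lam * (32 * kSeg d A * zE d) * β ≤ β) (x : Ed d) :
    PE (jA d lam ρ n) n x ≤ ENNReal.ofReal lam * kLace d A β * cE d lam ρ n * tE d n x x := by
  rw [PE_jA_eq hn]
  set c := cE d lam ρ with hc
  set L := ENNReal.ofReal lam with hL
  set C := CE d lam ρ with hC
  set S : Ed d → ℝ≥0∞ := fun v => ∑' X : ℕ, ∑' Y : ℕ, ∑' Z : ℕ, wE (n - 1) (X + Y + Z) *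
    (gE d X (x - v) * gE d (Y + 1) x * gE d (Z + 1) x) with hS
  have hCm : ∀ m, Measurable (C m) := fun m => measurable_CE m
  have hSm : Measurable S := Measurable.tsum fun X => Measurable.tsum fun Y =>
    Measurable.tsum fun Z => by fun_prop
  have hc2 : c 1 * c (n - 1) ≤ 2 * c n := hR n le_rfl 1 (by omega)
  have h1 : ∀ v, qE d lam ρ 0 1 n (Function.update (Function.update 0 n x) 1 v) ≤
      L * (uE d ρ x * (C 1 v * C (n - 1) (x - v)) +
        (kU d * kS d ^ 2 * β * c (n - 1)) * (C 1 v * S v)) := by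
    intro v
    set y : ℕ → Ed d := Function.update (Function.update 0 n x) 1 v with hy
    have y0 : y 0 = 0 := by
      rw [hy, Function.update_of_ne (by omega), Function.update_of_ne (by omega)]; rfl
    have y1 : y 1 = v := by rw [hy, Function.update_self]
    have yn : y n = x := by rw [hy, Function.update_of_ne (by omega), Function.update_self]
    refine (qE_le hl0 hl1 (by omega) (by omega) y).trans ?_
    refine mul_le_mul_right ?_ L
    rw [Nat.Ico_zero_eq_range, Finset.sum_range_one]
    simp_rw [segE_start (show 0 < 1 by omega)]
    rw [y0, y1, yn, sub_zero]
    simp only [sub_zero]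
    refine add_le_add (le_of_eq (by simp only [hC]; ring)) ?_
    have hm : Measurable fun w => tE d (n - 1) (x - v) (x - w) :=
      (measurable_tE _ _).comp (measurable_const.sub measurable_id)
    calc ∑ t' ∈ Ioo 1 n, ∫⁻ w, uE d ρ w * C 1 v * qE d lam ρ 1 t' n (Function.update y t' w)
        = ∫⁻ w, uE d ρ w * C 1 v * ∑ t' ∈ Ioo 1 n, qE d lam ρ 1 t' n (Function.update y t' w) := by
          simp_rw [Finset.mul_sum]
          rw [lintegral_finsetSum]
          intro t' _
          exact Measurable.mul (by fun_prop) (measurable_qE_update _ _ _ _ _)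
      _ ≤ ∫⁻ w, uE d ρ w * C 1 v * (β * c (n - 1) * tE d (n - 1) (x - v) (x - w)) := by
          refine lintegral_mono fun w => ?_
          refine mul_le_mul_right ?_ _
          have := chain_le hd hl0 hl1 hρ hA1 (N := n - 1) (fun m h1 h2 => hA m h1 (by omega))
            (fun m hm => hR m (by omega)) hβ 1 n le_rfl y w
          rwa [yn, y1] at this
      _ ≤ ∫⁻ w, (C 1 v * (β * c (n - 1)) * (kS d ^ 2 * S v)) * uE d ρ w := by
          refine lintegral_mono fun w => ?_
          calc uE d ρ w * C 1 v * (β * c (n - 1) * tE d (n - 1) (x - v) (x - w))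
              = C 1 v * (β * c (n - 1)) * (uE d ρ w * tE d (n - 1) (x - v) (x - w)) := by ring
            _ ≤ C 1 v * (β * c (n - 1)) * (uE d ρ w * (kS d ^ 2 * S v)) :=
                mul_le_mul_right (uE_mul_tE_le hd hρ _ _ _ _) _
            _ = _ := by ring
      _ ≤ (C 1 v * (β * c (n - 1)) * (kS d ^ 2 * S v)) * kU d := by
          rw [lintegral_const_mul _ (by fun_prop)]
          refine mul_le_mul_right ?_ _
          have := lintegral_uE_le (d := d) hρ 0
          simp_rw [zero_sub] at this
          convert this using 3 with w
          simp [uE, indBall]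
      _ = _ := by ring
  refine (lintegral_mono h1).trans ?_
  rw [lintegral_const_mul _ (by fun_prop), lintegral_add_left (by fun_prop),
    lintegral_const_mul _ (by fun_prop), lintegral_const_mul _ (by fun_prop)]
  have hC1 : ∀ v, C 1 v ≤ A * c 1 * gE d 22 v := fun v => hA 1 le_rfl (by omega) v
  have hS2 : ∫⁻ v, C 1 v * S v ≤ A * c 1 * (4 * tE d n x x) := by
    calc ∫⁻ v, C 1 v * S v ≤ ∫⁻ v, (A * c 1) * (gE d 22 v * S v) := by
          refine lintegral_mono fun v => ?_
          rw [← mul_assoc]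
          exact mul_le_mul_left (hC1 v) _
      _ = (A * c 1) * ∫⁻ v, gE d 22 v * S v := lintegral_const_mul _ (by fun_prop)
      _ ≤ (A * c 1) * ∑' X : ℕ, ∑' Y : ℕ, ∑' Z : ℕ, wE (n - 1) (X + Y + Z) *
          (gE d (22 + X) x * gE d (Y + 1) x * gE d (Z + 1) x) := by
          refine mul_le_mul_right ?_ _
          simp_rw [hS, ← ENNReal.tsum_mul_left]
          rw [lintegral_tsum fun X => Measurable.aemeasurable (by fun_prop)]
          refine ENNReal.tsum_le_tsum fun X => ?_
          rw [lintegral_tsum fun X => Measurable.aemeasurable (by fun_prop)]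
          refine ENNReal.tsum_le_tsum fun Y => ?_
          rw [lintegral_tsum fun X => Measurable.aemeasurable (by fun_prop)]
          refine ENNReal.tsum_le_tsum fun Z => ?_
          calc ∫⁻ v, gE d 22 v * (wE (n - 1) (X + Y + Z) *
                (gE d X (x - v) * gE d (Y + 1) x * gE d (Z + 1) x))
              = (wE (n - 1) (X + Y + Z) * (gE d (Y + 1) x * gE d (Z + 1) x)) *
                ∫⁻ v, gE d 22 v * gE d X (x - v) := by
                rw [← lintegral_const_mul _ (by fun_prop)]
                exact lintegral_congr fun v => by ring
            _ ≤ (wE (n - 1) (X + Y + Z) * (gE d (Y + 1) x * gE d (Z + 1) x)) * gE d (22 + X) x :=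
                mul_le_mul_right (lintegral_gE_conv_le hd (by norm_num) X x) _
            _ = _ := by ring
      _ ≤ _ := mul_le_mul_right (tsum_shift_le hn x) _
  have hS1 : uE d ρ x * ∫⁻ v, C 1 v * C (n - 1) (x - v) ≤
      A ^ 2 * (c 1 * c (n - 1)) * kU d ^ 2 * (4 * tE d n x x) := by
    calc uE d ρ x * ∫⁻ v, C 1 v * C (n - 1) (x - v)
        ≤ (kU d ^ 2 * (gE d 1 x * gE d 1 x)) * ∫⁻ v, (A * c 1 * (A * c (n - 1))) *
          (gE d 22 v * gE d (22 * (n - 1)) (x - v)) := by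
          refine mul_le_mul' (uE_le_sq hρ x) (lintegral_mono fun v => ?_)
          refine (mul_le_mul' (hC1 v) (hA (n - 1) (by omega) (by omega) _)).trans (le_of_eq ?_)
          ring
      _ ≤ (kU d ^ 2 * (gE d 1 x * gE d 1 x)) * ((A * c 1 * (A * c (n - 1))) *
          gE d (22 + 22 * (n - 1)) x) := by
          rw [lintegral_const_mul _ (by fun_prop)]
          gcongr
          exact lintegral_gE_conv_le hd (by norm_num) _ x
      _ = A ^ 2 * (c 1 * c (n - 1)) * kU d ^ 2 * (gE d 1 x * gE d 1 x * gE d (22 + 22 * (n - 1)) x) := by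
          ring
      _ ≤ _ := by
          refine mul_le_mul_right ?_ _
          exact gE_le_tE (by omega) (by omega) x
  calc L * (uE d ρ x * (∫⁻ v, C 1 v * C (n - 1) (x - v)) +
        kU d * kS d ^ 2 * β * c (n - 1) * ∫⁻ v, C 1 v * S v)
      ≤ L * (A ^ 2 * (c 1 * c (n - 1)) * kU d ^ 2 * (4 * tE d n x x) +
        kU d * kS d ^ 2 * β * c (n - 1) * (A * c 1 * (4 * tE d n x x))) := by gcongr
    _ = L * (A ^ 2 * kU d ^ 2 * 1 * 4 + 4 * kU d * kS d ^ 2 * β * A) * (c 1 * c (n - 1)) *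
        tE d n x x := by ring
    _ ≤ L * (A ^ 2 * kU d ^ 2 * kS d * 4 + 4 * kU d * kS d ^ 2 * β * A) * (2 * c n) *
        tE d n x x := by
        gcongr
        exact one_le_kS
    _ = _ := by rw [kLace]; ring

theorem PE_jA_le_tE (hd : d ≠ 0) (hl0 : 0 ≤ lam) (hl1 : lam ≤ 1) (hρ : ρ ≤ 1)
    {A β : ℝ≥0∞} (hA1 : 1 ≤ A) {n : ℕ} (hn : 1 ≤ n) (hc1 : 1 ≤ 2 * cE d lam ρ 1)
    (hA : ∀ m, 1 ≤ m → m < n → ∀ x, CE d lam ρ m x ≤ A * cE d lam ρ m * gE d (22 * m) x)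
    (hR : ∀ m ≤ n, ∀ k ≤ m, cE d lam ρ k * cE d lam ρ (m - k) ≤ 2 * cE d lam ρ m)
    (hβ : ENNReal.ofReal lam * (8 * kSeg d A * A) +
      ENNReal.ofReal lam * (32 * kSeg d A * zE d) * β ≤ β) (x : Ed d) :
    PE (jA d lam ρ n) n x ≤ ENNReal.ofReal lam * kLace d A β * cE d lam ρ n * tE d n x x := by
  rcases hn.eq_or_lt with rfl | hn
  swap
  · exact PE_jA_le_tE_of_two_le hd hl0 hl1 hρ hA1 hn hA hR hβ x
  have e : PE (jA d lam ρ 1) 1 x = ENNReal.ofReal lam * uE d ρ x * gE d 20 x := by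
    unfold PE
    rw [show Ioo 0 1 = (∅ : Finset ℕ) from rfl, pint, lmarginal_empty, jA, Jsaw_one, edgeW, abs_neg,
      abs_of_nonneg (mul_nonneg hl0 (indBall_nonneg _)), ENNReal.ofReal_mul hl0, phiE, PhiProd, gE, uE]
    simp
  rw [e]
  have hg : gE d 20 x ≤ kS d * gE d 22 x := by
    unfold gE kS
    rw [← ENNReal.ofReal_mul (by positivity)]
    refine ENNReal.ofReal_le_ofReal ((gauss_le_gauss (d := d) (s := (20 : ℕ) / 20) (t := (22 : ℕ) / 20)
      (M := 2) (by norm_num) (by norm_num) (by norm_num) x).trans ?_)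
    have h1 : (1 : ℝ) ≤ Real.exp 10 := Real.one_le_exp (by norm_num)
    have h2 : (0 : ℝ) ≤ 2 ^ ((d : ℝ) / 2) * gauss d ((22 : ℕ) / 20) x :=
      mul_nonneg (by positivity) (gauss_nonneg (by norm_num) x)
    nlinarith
  calc ENNReal.ofReal lam * uE d ρ x * gE d 20 x
      ≤ ENNReal.ofReal lam * (kU d ^ 2 * (gE d 1 x * gE d 1 x)) * (kS d * gE d 22 x) := by
        gcongr
        exact uE_le_sq hρ x
    _ = ENNReal.ofReal lam * (1 ^ 2 * kU d ^ 2 * kS d) * 1 * (gE d 1 x * gE d 1 x * gE d 22 x) := by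
        ring
    _ ≤ ENNReal.ofReal lam * (A ^ 2 * kU d ^ 2 * kS d) * (2 * cE d lam ρ 1) * (4 * tE d 1 x x) := by
        refine mul_le_mul' (by gcongr) ?_
        exact gE_le_tE le_rfl (by norm_num) x
    _ = ENNReal.ofReal lam * (8 * A ^ 2 * kU d ^ 2 * kS d) * cE d lam ρ 1 * tE d 1 x x := by ring
    _ ≤ _ := by
        rw [kLace]
        gcongr
        exact le_self_add

end LaceBound

/-! ### From triples of lines to the dominating sequence -/

section TripleSums

variable {d : ℕ}

theorem zE_ne_top (hd : 5 ≤ d) : zE d ≠ ⊤ := by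
  have hd' : (5 : ℝ) ≤ d := by exact_mod_cast hd
  have hs : Summable fun i : ℕ => (i : ℝ) ^ (-(d : ℝ) / 4) :=
    Real.summable_nat_rpow.mpr (by linarith)
  set S : ℝ≥0∞ := ∑' i : ℕ, ENNReal.ofReal ((i : ℝ) ^ (-(d : ℝ) / 4)) with hS
  have hSt : S ≠ ⊤ := hs.tsum_ofReal_ne_top
  have hle : zE d ≤ ∑' i : ℕ, ∑' j : ℕ, ENNReal.ofReal (40 ^ ((d : ℝ) / 2)) *
      (ENNReal.ofReal ((i : ℝ) ^ (-(d : ℝ) / 4)) * ENNReal.ofReal ((j : ℝ) ^ (-(d : ℝ) / 4))) := by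
    refine ENNReal.tsum_le_tsum fun i => ENNReal.tsum_le_tsum fun j => ?_
    unfold mE
    split_ifs with h
    · exact zero_le
    push Not at h
    have hi : (1 : ℝ) ≤ i := by exact_mod_cast Nat.one_le_iff_ne_zero.mpr h.1
    have hj : (1 : ℝ) ≤ j := by exact_mod_cast Nat.one_le_iff_ne_zero.mpr h.2
    rw [← ENNReal.ofReal_mul (by positivity), ← ENNReal.ofReal_mul (by positivity)]
    refine ENNReal.ofReal_le_ofReal ?_
    rw [← Real.mul_rpow (by positivity) (by positivity), Real.div_rpow (by positivity) (by norm_num),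
      div_eq_mul_inv, ← Real.rpow_neg (by norm_num), mul_comm,
      show -(-(d : ℝ) / 2) = (d : ℝ) / 2 by ring]
    gcongr
    have e : ((i : ℝ) + j) ^ (-(d : ℝ) / 2) = (((i : ℝ) + j) ^ (2 : ℝ)) ^ (-(d : ℝ) / 4) := by
      rw [← Real.rpow_mul (by positivity)]; congr 1; ring
    rw [e]
    refine Real.rpow_le_rpow_of_nonpos (by positivity) ?_ (by linarith)
    rw [Real.rpow_two]; nlinarith
  refine ne_top_of_le_ne_top ?_ hle
  simp_rw [ENNReal.tsum_mul_left, ENNReal.tsum_mul_right]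
  exact ENNReal.mul_ne_top ENNReal.ofReal_ne_top (ENNReal.mul_ne_top hSt hSt)

theorem tsum_triple_le_ordered (F : ℕ → ℕ → ℕ → ℝ≥0∞) (h12 : ∀ a b c, F a b c = F b a c)
    (h23 : ∀ a b c, F a b c = F a c b) :
    ∑' a, ∑' b, ∑' c, F a b c ≤
      6 * ∑' a, ∑' b, ∑' c, if a ≤ b ∧ b ≤ c then F a b c else 0 := by
  set H : ℕ → ℕ → ℕ → ℝ≥0∞ := fun a b c => if a ≤ b ∧ b ≤ c then F a b c else 0 with hH
  have key : ∀ a b c, F a b c ≤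
      H a b c + H a c b + H b a c + H b c a + H c a b + H c b a := by
    intro a b c
    have e1 : F a c b = F a b c := (h23 _ _ _).symm
    have e2 : F b a c = F a b c := (h12 _ _ _).symm
    have e3 : F b c a = F a b c := by rw [h23, h12]
    have e4 : F c a b = F a b c := by rw [h12, h23]
    have e5 : F c b a = F a b c := by rw [h12, e3]
    have : ∃ n : ℕ, 1 ≤ n ∧ H a b c + H a c b + H b a c + H b c a + H c a b + H c b a = n * F a b c := by
      refine ⟨(if a ≤ b ∧ b ≤ c then 1 else 0) + (if a ≤ c ∧ c ≤ b then 1 else 0) +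
        (if b ≤ a ∧ a ≤ c then 1 else 0) + (if b ≤ c ∧ c ≤ a then 1 else 0) +
        (if c ≤ a ∧ a ≤ b then 1 else 0) + (if c ≤ b ∧ b ≤ a then 1 else 0), ?_, ?_⟩
      · split_ifs <;> omega
      · simp only [hH, e1, e2, e3, e4, e5]
        push_cast
        simp only [add_mul, ite_mul, one_mul, zero_mul]
    obtain ⟨n, hn, he⟩ := this
    rw [he]
    exact le_mul_of_one_le_left zero_le (by exact_mod_cast hn)
  refine (ENNReal.tsum_le_tsum fun a => ENNReal.tsum_le_tsum fun b =>
    ENNReal.tsum_le_tsum fun c => key a b c).trans (le_of_eq ?_)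
  simp_rw [ENNReal.tsum_add]
  have s23 : ∀ G : ℕ → ℕ → ℕ → ℝ≥0∞, ∑' a, ∑' b, ∑' c, G a c b = ∑' a, ∑' b, ∑' c, G a b c :=
    fun G => tsum_congr fun a => ENNReal.tsum_comm
  have s12 : ∀ G : ℕ → ℕ → ℕ → ℝ≥0∞, ∑' a, ∑' b, ∑' c, G b a c = ∑' a, ∑' b, ∑' c, G a b c :=
    fun G => ENNReal.tsum_comm
  have t1 := s23 H
  have t2 := s12 H
  have t3 : ∑' a, ∑' b, ∑' c, H b c a = ∑' a, ∑' b, ∑' c, H a b c :=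
    (s12 fun a b c => H a c b).trans (s23 H)
  have t4 : ∑' a, ∑' b, ∑' c, H c a b = ∑' a, ∑' b, ∑' c, H a b c :=
    (s23 fun a b c => H b a c).trans (s12 H)
  have t5 : ∑' a, ∑' b, ∑' c, H c b a = ∑' a, ∑' b, ∑' c, H a b c :=
    (s23 fun a b c => H b c a).trans t3
  rw [t1, t2, t3, t4, t5]
  ring

theorem tsum_wE_le (n k : ℕ) : ∑' Z : ℕ, wE n (k + Z) ≤ 2 := by
  refine (ENNReal.tsum_comp_le_tsum_of_injective (f := fun Z => k + Z)
    (fun _ _ e => by simpa using e) (wE n)).trans ?_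
  have h : ∑' T : ℕ, wE n T = ∑' i : ℕ, wE n (22 * n + i) := by
    rw [← Summable.sum_add_tsum_nat_add' (f := wE n) (k := 22 * n) ENNReal.summable,
      Finset.sum_eq_zero, zero_add]
    · simp_rw [add_comm]
    · intro i hi
      rw [wE, if_neg]
      have := Finset.mem_range.mp hi
      omega
  rw [h]
  calc ∑' i : ℕ, wE n (22 * n + i) ≤ ∑' i : ℕ, (2⁻¹ : ℝ≥0∞) ^ i := by
        refine ENNReal.tsum_le_tsum fun i => ?_
        unfold wE
        split_ifs
        · rw [Nat.add_sub_cancel_left]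
        · exact zero_le
    _ = 2 := by
        rw [ENNReal.tsum_geometric, ENNReal.one_sub_inv_two, inv_inv]

theorem tsum_tail_rpow_le (hd : 5 ≤ d) {X : ℕ} (hX : 1 ≤ X) :
    ∑' Y : ℕ, (if X ≤ Y then ENNReal.ofReal ((Y : ℝ) ^ (-(d : ℝ) / 2)) else 0) ≤
      ENNReal.ofReal (2 * (X : ℝ) ^ (1 - (d : ℝ) / 2)) := by
  have hd' : (5 : ℝ) ≤ d := by exact_mod_cast hd
  have hX' : (1 : ℝ) ≤ X := by exact_mod_cast hX
  refine ENNReal.tsum_le_of_sum_range_le fun N => ?_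
  rw [← Finset.sum_filter, ← ENNReal.ofReal_sum_of_nonneg (fun _ _ => by positivity)]
  refine ENNReal.ofReal_le_ofReal ?_
  have e : (Finset.range N).filter (fun Y => X ≤ Y) = Ioo (X - 1) N := by
    ext Y; simp; omega
  rw [e]
  calc ∑ Y ∈ Ioo (X - 1) N, (Y : ℝ) ^ (-(d : ℝ) / 2)
      ≤ ∑ Y ∈ Ioo (X - 1) N, (X : ℝ) ^ (2 - (d : ℝ) / 2) * ((Y : ℝ) ^ 2)⁻¹ := by
        refine Finset.sum_le_sum fun Y hY => ?_
        have hXY : (X : ℝ) ≤ Y := by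
          have := (Finset.mem_Ioo.mp hY).1
          exact_mod_cast (by omega : X ≤ Y)
        have hY0 : (0 : ℝ) < Y := by linarith
        rw [show -(d : ℝ) / 2 = (2 - (d : ℝ) / 2) + (-2) by ring, Real.rpow_add hY0,
          Real.rpow_neg hY0.le, Real.rpow_two]
        gcongr ?_ * _
        exact Real.rpow_le_rpow_of_nonpos (by linarith) hXY (by linarith)
    _ = (X : ℝ) ^ (2 - (d : ℝ) / 2) * ∑ Y ∈ Ioo (X - 1) N, ((Y : ℝ) ^ 2)⁻¹ := by
        rw [Finset.mul_sum]
    _ ≤ (X : ℝ) ^ (2 - (d : ℝ) / 2) * (2 / X) := by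
        gcongr
        refine (sum_Ioo_inv_sq_le (X - 1) N).trans (le_of_eq ?_)
        rw [Nat.cast_sub hX]; simp
    _ = _ := by
        rw [show 2 - (d : ℝ) / 2 = (1 - (d : ℝ) / 2) + 1 by ring, Real.rpow_add (by linarith),
          Real.rpow_one]
        field_simp

theorem sum_blocks_le (h f : ℕ → ℝ≥0∞)
    (hf : ∀ k X, 8 * k < X → X ≤ 8 * (k + 1) → h X ≤ f (k + 1)) (n : ℕ) :
    ∑ X ∈ Icc 1 (8 * n), h X ≤ 8 * ∑ k ∈ Icc 1 n, f k := by
  induction n with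
  | zero => simp
  | succ n ih =>
    rw [show 8 * (n + 1) = 8 * n + 7 + 1 by ring, Finset.sum_Icc_succ_top (b := n) (by omega), mul_add]
    iterate 8 rw [Finset.sum_Icc_succ_top (by omega)]
    have e := fun X h1 h2 => hf n X h1 h2
    simp only [add_assoc]
    refine add_le_add ih ?_
    rw [show (8 : ℝ≥0∞) * f (n + 1) = f (n + 1) + (f (n + 1) + (f (n + 1) + (f (n + 1) +
      (f (n + 1) + (f (n + 1) + (f (n + 1) + f (n + 1))))))) by ring]
    gcongr <;> exact e _ (by omega) (by omega)

/-- The constant in the passage from triples of lines to the dominating sequence. -/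
def kTriple (d : ℕ) : ℝ := 192 * (8 : ℝ) ^ ((d : ℝ) / 2) * 20 ^ ((d : ℝ) / 2) * 20 ^ ((d : ℝ) / 2)

theorem tE_le (hd : 5 ≤ d) {n : ℕ} (hn : 1 ≤ n) (x : Ed d) :
    tE d n x x ≤ ENNReal.ofReal (kTriple d * GammaSAW d 1 n x) := by
  have hd' : (5 : ℝ) ≤ d := by exact_mod_cast hd
  have hd0 : d ≠ 0 := by omega
  have hn' : (1 : ℝ) ≤ n := by exact_mod_cast hn
  have hgE : ∀ l : ℕ, 1 ≤ l → gE d l x ≤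
      ENNReal.ofReal (20 ^ ((d : ℝ) / 2)) * ENNReal.ofReal ((l : ℝ) ^ (-(d : ℝ) / 2)) := by
    intro l hl
    have hl' : (1 : ℝ) ≤ l := by exact_mod_cast hl
    unfold gE
    rw [← ENNReal.ofReal_mul (by positivity)]
    refine ENNReal.ofReal_le_ofReal ((gauss_le_rpow (by positivity) x).trans (le_of_eq ?_))
    rw [Real.div_rpow (by positivity) (by norm_num), div_eq_mul_inv, ← Real.rpow_neg (by norm_num),
      mul_comm, show -(-(d : ℝ) / 2) = (d : ℝ) / 2 by ring]
  set k20 := ENNReal.ofReal ((20 : ℝ) ^ ((d : ℝ) / 2)) with hk20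
  set nn := ENNReal.ofReal ((n : ℝ) ^ (-(d : ℝ) / 2)) with hnn
  unfold tE fE
  refine (tsum_triple_le_ordered (fun a b c => wE n (a + b + c) * (gE d a x * gE d b x * gE d c x))
    (fun a b c => by rw [add_comm a b]; ring)
    (fun a b c => by rw [add_right_comm a b c]; ring)).trans ?_
  have h1 : ∀ a b : ℕ, (∑' c : ℕ, if a ≤ b ∧ b ≤ c then
      wE n (a + b + c) * (gE d a x * gE d b x * gE d c x) else 0) ≤
      2 * k20 * k20 * nn * (if a ∈ Icc 1 (8 * n) then gE d a x else 0) *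
        (if a ≤ b then ENNReal.ofReal ((b : ℝ) ^ (-(d : ℝ) / 2)) else 0) := by
    intro a b
    have h2 : ∀ c : ℕ, (if a ≤ b ∧ b ≤ c then
        wE n (a + b + c) * (gE d a x * gE d b x * gE d c x) else 0) ≤
        wE n (a + b + c) * (k20 * k20 * nn * (if a ∈ Icc 1 (8 * n) then gE d a x else 0) *
        (if a ≤ b then ENNReal.ofReal ((b : ℝ) ^ (-(d : ℝ) / 2)) else 0)) := by
      intro c
      split_ifs with h hI h3 h4
      · obtain ⟨ha1, ha2⟩ := Finset.mem_Icc.mp hI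
        by_cases hw : 22 * n ≤ a + b + c ∧ a + b + c ≤ 24 * n
        swap
        · rw [wE, if_neg hw, zero_mul]; exact zero_le
        have hc : n ≤ c := by omega
        have hc' : (n : ℝ) ≤ c := by exact_mod_cast hc
        have hgc : gE d c x ≤ k20 * nn := by
          refine (hgE c (by omega)).trans (mul_le_mul_right (ENNReal.ofReal_le_ofReal ?_) _)
          exact Real.rpow_le_rpow_of_nonpos (by linarith) hc' (by linarith)
        refine mul_le_mul_right ?_ _
        calc gE d a x * gE d b x * gE d c x
            ≤ gE d a x * (k20 * ENNReal.ofReal ((b : ℝ) ^ (-(d : ℝ) / 2))) * (k20 * nn) := by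
              gcongr
              exact hgE b (by omega)
          _ = _ := by ring
      · exact absurd h.1 h3
      · rcases Nat.eq_zero_or_pos a with rfl | ha
        · simp [gE_zero hd0]
        · rw [wE, if_neg, zero_mul]
          · exact zero_le
          · intro hw
            exact hI (Finset.mem_Icc.mpr ⟨ha, by omega⟩)
      · exact absurd h.1 h4
      all_goals exact zero_le
    refine (ENNReal.tsum_le_tsum h2).trans ?_
    rw [ENNReal.tsum_mul_right]
    refine (mul_le_mul_left (tsum_wE_le n (a + b)) _).trans (le_of_eq ?_)
    ring
  calc 6 * ∑' a : ℕ, ∑' b : ℕ, ∑' c : ℕ, (if a ≤ b ∧ b ≤ c then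
      wE n (a + b + c) * (gE d a x * gE d b x * gE d c x) else 0)
      ≤ 6 * ∑' a : ℕ, ∑' b : ℕ, 2 * k20 * k20 * nn * (if a ∈ Icc 1 (8 * n) then gE d a x else 0) *
        (if a ≤ b then ENNReal.ofReal ((b : ℝ) ^ (-(d : ℝ) / 2)) else 0) := by
        gcongr with a b
        exact h1 a b
    _ ≤ 6 * ∑' a : ℕ, if a ∈ Icc 1 (8 * n) then 2 * k20 * k20 * nn *
        (gE d a x * ENNReal.ofReal (2 * (a : ℝ) ^ (1 - (d : ℝ) / 2))) else 0 := by
        refine mul_le_mul_right (ENNReal.tsum_le_tsum fun a => ?_) _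
        rw [ENNReal.tsum_mul_left]
        split_ifs with ha
        · rw [mul_assoc]
          gcongr
          exact tsum_tail_rpow_le hd (Finset.mem_Icc.mp ha).1
        · simp
    _ = 12 * k20 * k20 * nn * ∑ a ∈ Icc 1 (8 * n),
        gE d a x * ENNReal.ofReal (2 * (a : ℝ) ^ (1 - (d : ℝ) / 2)) := by
        rw [tsum_eq_sum (s := Icc 1 (8 * n)) (fun a ha => if_neg ha), Finset.sum_ite_mem,
          Finset.inter_self, ← Finset.mul_sum]
        ring
    _ ≤ 12 * k20 * k20 * nn * (8 * ∑ k ∈ Icc 1 n, ENNReal.ofReal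
        ((8 : ℝ) ^ ((d : ℝ) / 2) * (2 * ((k : ℝ) ^ (1 - (d : ℝ) / 2) * gauss d (2 * k / 5) x)))) := by
        refine mul_le_mul_right (sum_blocks_le _ _ (fun k X hX1 hX2 => ?_) n) _
        have hX1' : (k : ℝ) + 1 ≤ X := by exact_mod_cast (by omega : k + 1 ≤ X)
        have hX2' : (X : ℝ) ≤ 8 * (k + 1) := by exact_mod_cast hX2
        have hk0 : (0 : ℝ) ≤ k := by positivity
        have hg := gauss_nonneg (d := d) (t := (X : ℝ) / 20) (by positivity) x
        unfold gE
        rw [← ENNReal.ofReal_mul hg]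
        refine ENNReal.ofReal_le_ofReal ?_
        push_cast
        have e1 : gauss d ((X : ℝ) / 20) x ≤ 8 ^ ((d : ℝ) / 2) * gauss d (2 * (k + 1) / 5) x :=
          gauss_le_gauss (by linarith) (by linarith) (by linarith) x
        have e2 : (X : ℝ) ^ (1 - (d : ℝ) / 2) ≤ ((k : ℝ) + 1) ^ (1 - (d : ℝ) / 2) :=
          Real.rpow_le_rpow_of_nonpos (by linarith) hX1' (by linarith)
        calc gauss d ((X : ℝ) / 20) x * (2 * (X : ℝ) ^ (1 - (d : ℝ) / 2))
            ≤ (8 ^ ((d : ℝ) / 2) * gauss d (2 * (k + 1) / 5) x) *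
              (2 * ((k : ℝ) + 1) ^ (1 - (d : ℝ) / 2)) := by
              gcongr
              exact hg.trans e1
          _ = _ := by ring
    _ = _ := by
        have g0 : ∀ k : ℕ, 0 ≤ gauss d (2 * k / 5) x := fun k => gauss_nonneg (by positivity) x
        rw [← ENNReal.ofReal_sum_of_nonneg (fun k _ => mul_nonneg (by positivity)
          (mul_nonneg (by norm_num) (mul_nonneg (by positivity) (g0 k))))]
        rw [show (12 : ℝ≥0∞) = ENNReal.ofReal 12 by simp, show (8 : ℝ≥0∞) = ENNReal.ofReal 8 by simp,
          hk20, hnn, ← ENNReal.ofReal_mul (by norm_num), ← ENNReal.ofReal_mul (by positivity),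
          ← ENNReal.ofReal_mul (by positivity), ← ENNReal.ofReal_mul (by norm_num),
          ← ENNReal.ofReal_mul (by positivity)]
        congr 1
        simp_rw [← Finset.mul_sum]
        rw [GammaSAW, kTriple]
        ring

end TripleSums

/-! ### Almost supermultiplicativity of the total mass -/

section Ratio

variable {d : ℕ} {lam ρ : ℝ}

theorem pint_Ioc_split {a m b : ℕ} (ham : a ≤ m) (hmb : m ≤ b) {f g : (ℕ → Ed d) → ℝ≥0∞}
    (hf : DependsOn f (Set.Iic m)) (hfm : Measurable f) (hgm : Measurable g) (y : ℕ → Ed d) :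
    pint (Ioc a b) (fun y => f y * g y) y =
      pint (Ioc a m) (fun z => f z * pint (Ioc m b) g z) y := by
  rw [← Finset.Ioc_union_Ioc_eq_Ioc ham hmb, pint, lmarginal_union _ _ (by fun_prop)
    (Finset.disjoint_left.mpr fun i => by simp only [Finset.mem_Ioc]; omega)]
  congr 1
  funext z
  exact pint_mul_left hf (Set.disjoint_left.mpr fun i h1 h2 => by
    simp only [Finset.coe_Ioc, Set.mem_Ioc, Set.mem_Iic] at h1 h2; omega) hgm z

theorem pint_Ioc_mul_eq {a m b : ℕ} (ham : a ≤ m) (hmb : m ≤ b) {f g : (ℕ → Ed d) → ℝ≥0∞}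
    (hf : DependsOn f (Set.Iic m)) (hfm : Measurable f) (hgm : Measurable g) {c : ℝ≥0∞}
    (hg : ∀ z, pint (Ioc m b) g z = c) (y : ℕ → Ed d) :
    pint (Ioc a b) (fun y => f y * g y) y = c * pint (Ioc a m) f y := by
  rw [pint_Ioc_split ham hmb hf hfm hgm]
  simp_rw [hg, mul_comm _ c]
  exact pint_const_mul c hfm y

theorem pint_Ioc_mul_le {a m b : ℕ} (ham : a ≤ m) (hmb : m ≤ b) {f g : (ℕ → Ed d) → ℝ≥0∞}
    (hf : DependsOn f (Set.Iic m)) (hfm : Measurable f) (hgm : Measurable g) {c : ℝ≥0∞}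
    (hg : ∀ z, pint (Ioc m b) g z ≤ c) (y : ℕ → Ed d) :
    pint (Ioc a b) (fun y => f y * g y) y ≤ c * pint (Ioc a m) f y := by
  rw [pint_Ioc_split ham hmb hf hfm hgm, ← pint_const_mul c hfm y]
  refine lmarginal_mono (fun z => ?_) y
  simp only
  rw [mul_comm c]
  exact mul_le_mul_right (hg z) _

theorem kE_mul_le (hl0 : 0 ≤ lam) (hl1 : lam ≤ 1) {k n : ℕ} (hkn : k ≤ n) (y : ℕ → Ed d) :
    kE d lam ρ 0 k y * kE d lam ρ k n y ≤ kE d lam ρ 0 n y + ∑ p ∈ Ico 0 k ×ˢ Ioc k n,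
      ENNReal.ofReal lam * (uE d ρ (y p.2 - y p.1) * (kE d lam ρ 0 k y * kE d lam ρ k n y)) := by
  set S := Ico 0 k ×ˢ Ioc k n with hS
  set a := Ksaw d lam ρ 0 k y * Ksaw d lam ρ k n y with ha
  have ha0 : 0 ≤ a := mul_nonneg (Ksaw_nonneg hl1 _ _ _) (Ksaw_nonneg hl1 _ _ _)
  have h := one_sub_prod_le_sum S (fun p => lam * indBall d ρ (y p.2 - y p.1))
    (fun p _ => mul_nonneg hl0 (indBall_nonneg _))
    (fun p _ => by linarith [edge_factor_nonneg (ρ := ρ) hl1 (y p.2 - y p.1)])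
  have h2 : a ≤ Ksaw d lam ρ 0 n y + ∑ p ∈ S, lam * (indBall d ρ (y p.2 - y p.1) * a) := by
    rw [Ksaw_factor (Nat.zero_le k) hkn]
    simp_rw [← mul_assoc lam, ← Finset.sum_mul]
    have := mul_le_mul_of_nonneg_left h ha0
    nlinarith
  have e : kE d lam ρ 0 k y * kE d lam ρ k n y = ENNReal.ofReal a := by
    rw [kE, kE, ← ENNReal.ofReal_mul (Ksaw_nonneg hl1 _ _ _)]
  rw [e, kE]
  refine (ENNReal.ofReal_le_ofReal h2).trans (le_of_eq ?_)
  rw [ENNReal.ofReal_add (Ksaw_nonneg hl1 _ _ _) (Finset.sum_nonneg fun p _ =>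
    mul_nonneg hl0 (mul_nonneg (indBall_nonneg _) ha0)),
    ENNReal.ofReal_sum_of_nonneg fun p _ => mul_nonneg hl0 (mul_nonneg (indBall_nonneg _) ha0)]
  congr 1
  refine Finset.sum_congr rfl fun p _ => ?_
  rw [ENNReal.ofReal_mul hl0, ENNReal.ofReal_mul (indBall_nonneg _), uE]

/-- A loop of a walk passing through an intermediate time. -/
theorem pint_loop_le (hρ : ρ ≤ 1) {A : ℝ≥0∞} {i k j : ℕ} (hik : i < k) (hkj : k < j)
    (hA1 : ∀ x, CE d lam ρ (k - i) x ≤ A * cE d lam ρ (k - i) * gE d (22 * (k - i)) x)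
    (hA2 : ∀ x, CE d lam ρ (j - k) x ≤ A * cE d lam ρ (j - k) * gE d (22 * (j - k)) x)
    (hd : d ≠ 0) (y : ℕ → Ed d) :
    pint (Ioc i j) (fun z => uE d ρ (z j - z i) *
      ((kE d lam ρ i k z * phiE d i k z) * (kE d lam ρ k j z * phiE d k j z))) y ≤
    A ^ 2 * kU d * mE d (k - i) (j - k) * (cE d lam ρ (k - i) * cE d lam ρ (j - k)) := by
  set c := cE d lam ρ with hc
  rw [show Ioc i j = insert j (Ioo i j) by
    ext l; simp only [Finset.mem_insert, Finset.mem_Ioc, Finset.mem_Ioo]; omega, pint,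
    lmarginal_insert _ (by fun_prop) (by simp)]
  have h1 : ∀ w, pint (Ioo i j) (fun z => uE d ρ (z j - z i) *
      ((kE d lam ρ i k z * phiE d i k z) * (kE d lam ρ k j z * phiE d k j z)))
      (Function.update y j w) ≤
      (A ^ 2 * mE d (k - i) (j - k) * (c (k - i) * c (j - k))) * uE d ρ (w - y i) := by
    intro w
    rw [pint_mul_left (S := {i, j}) (fun u v h => by simp only [h i (by simp), h j (by simp)])
      (by simp) (by fun_prop), pint_split hik hkj
      (dependsOn_mul (dependsOn_kE _ _) (dependsOn_phiE _ _))
      (dependsOn_mul (dependsOn_kE _ _) (dependsOn_phiE _ _)) (by fun_prop) (by fun_prop)]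
    simp_rw [pint_kphi hik, pint_kphi hkj, Function.update_self]
    rw [Function.update_of_ne (by omega : i ≠ j)]
    simp_rw [Function.update_of_ne (by omega : i ≠ k), Function.update_of_ne (by omega : j ≠ k),
      Function.update_of_ne (by omega : i ≠ j), Function.update_self]
    rw [mul_comm]
    refine mul_le_mul_left ?_ _
    calc ∫⁻ v, CE d lam ρ (k - i) (v - y i) * CE d lam ρ (j - k) (w - v)
        ≤ ∫⁻ v, (A ^ 2 * (c (k - i) * c (j - k))) *
          (gE d (22 * (k - i)) (v - y i) * gE d (22 * (j - k)) (w - v)) := by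
          refine lintegral_mono fun v => (mul_le_mul' (hA1 _) (hA2 _)).trans (le_of_eq ?_)
          ring
      _ = (A ^ 2 * (c (k - i) * c (j - k))) *
          ∫⁻ v, (gE d (22 * (k - i)) (v - y i) * gE d (22 * (j - k)) (w - v)) :=
          lintegral_const_mul _ (by fun_prop)
      _ = (A ^ 2 * (c (k - i) * c (j - k))) *
          ∫⁻ v, (gE d (22 * (k - i)) v * gE d (22 * (j - k)) ((w - y i) - v)) := by
          congr 1
          rw [← lintegral_sub_right_eq_self (fun v => gE d (22 * (k - i)) v *
            gE d (22 * (j - k)) ((w - y i) - v)) (y i)]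
          refine lintegral_congr fun v => ?_
          rw [sub_sub_sub_cancel_right]
      _ ≤ (A ^ 2 * (c (k - i) * c (j - k))) * mE d (k - i) (j - k) := by
          refine mul_le_mul_right ((lintegral_gE_conv_le hd (by omega) _ _).trans ?_) _
          rw [mE, if_neg (by omega), gE]
          have h1 : (1 : ℝ) ≤ (k - i : ℕ) := by exact_mod_cast (by omega : 1 ≤ k - i)
          have h2 : (1 : ℝ) ≤ (j - k : ℕ) := by exact_mod_cast (by omega : 1 ≤ j - k)
          refine ENNReal.ofReal_le_ofReal ((gauss_le_rpow (by push_cast; positivity) _).trans ?_)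
          refine Real.rpow_le_rpow_of_nonpos (by positivity) ?_ ?_
          · push_cast; linarith
          · have : (0 : ℝ) ≤ d := by positivity
            linarith
      _ = _ := by ring
  refine (lintegral_mono h1).trans ?_
  rw [lintegral_const_mul _ (by fun_prop)]
  have h2 : ∫⁻ w, uE d ρ (w - y i) ≤ kU d := by
    refine le_trans (le_of_eq (lintegral_congr fun w => ?_)) (lintegral_uE_le (d := d) hρ (y i))
    simp only [uE, indBall, norm_sub_rev]
  calc _ ≤ (A ^ 2 * mE d (k - i) (j - k) * (c (k - i) * c (j - k))) * kU d := mul_le_mul_right h2 _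
    _ = _ := by ring

theorem pint_crossing_le (hl0 : 0 ≤ lam) (hl1 : lam ≤ 1) (hρ : ρ ≤ 1) (hd : d ≠ 0) {A : ℝ≥0∞}
    {i k j n : ℕ} (hik : i < k) (hkj : k < j) (hjn : j ≤ n)
    (hA1 : ∀ x, CE d lam ρ (k - i) x ≤ A * cE d lam ρ (k - i) * gE d (22 * (k - i)) x)
    (hA2 : ∀ x, CE d lam ρ (j - k) x ≤ A * cE d lam ρ (j - k) * gE d (22 * (j - k)) x)
    (y : ℕ → Ed d) :
    pint (Ioc 0 n) (fun z => uE d ρ (z j - z i) *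
      ((kE d lam ρ 0 k z * kE d lam ρ k n z) * phiE d 0 n z)) y ≤
    A ^ 2 * kU d * mE d (k - i) (j - k) * ((cE d lam ρ i * cE d lam ρ (k - i)) *
      (cE d lam ρ (j - k) * cE d lam ρ (n - j))) := by
  have dep : ∀ a b m : ℕ, b ≤ m → DependsOn (fun z => kE d lam ρ a b z * phiE d a b z) (Set.Iic m) := by
    intro a b m hbm
    refine DependsOn.mono (fun l hl => ?_) (dependsOn_mul (dependsOn_kE a b) (dependsOn_phiE a b))
    simp only [Set.mem_Icc, Set.mem_Iic] at hl ⊢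
    omega
  have h1 : ∀ z, uE d ρ (z j - z i) * ((kE d lam ρ 0 k z * kE d lam ρ k n z) * phiE d 0 n z) ≤
      ((kE d lam ρ 0 i z * phiE d 0 i z) * (uE d ρ (z j - z i) *
      ((kE d lam ρ i k z * phiE d i k z) * (kE d lam ρ k j z * phiE d k j z)))) *
      (kE d lam ρ j n z * phiE d j n z) := by
    intro z
    rw [phiE_mul (by omega : 0 ≤ j) hjn, phiE_mul (by omega : 0 ≤ k) (by omega : k ≤ j),
      phiE_mul (by omega : 0 ≤ i) (by omega : i ≤ k)]
    calc _ ≤ uE d ρ (z j - z i) * (((kE d lam ρ 0 i z * kE d lam ρ i k z) *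
          (kE d lam ρ k j z * kE d lam ρ j n z)) *
          (phiE d 0 i z * phiE d i k z * phiE d k j z * phiE d j n z)) := by
          gcongr
          · exact kE_le_mul hl0 hl1 (by omega) (by omega) z
          · exact kE_le_mul hl0 hl1 (by omega) (by omega) z
      _ = _ := by ring
  refine (lmarginal_mono h1 y).trans ?_
  refine (pint_Ioc_mul_le (by omega) hjn (c := cE d lam ρ (n - j)) (dependsOn_mul (dep 0 i j (by omega))
    (dependsOn_mul (fun u v h => by simp only [h j (by simp), h i (by simp; omega)])
    (dependsOn_mul (dep i k j (by omega)) (dep k j j le_rfl)))) (by fun_prop) (by fun_prop)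
    (fun z => (pint_kphi_Ioc hjn z).le) y).trans ?_
  refine (mul_le_mul_right (pint_Ioc_mul_le (by omega) (by omega : i ≤ j) (dep 0 i i le_rfl) (by fun_prop)
    (by fun_prop) (fun z => pint_loop_le hρ hik hkj hA1 hA2 hd z) y) _).trans (le_of_eq ?_)
  rw [pint_kphi_Ioc (Nat.zero_le i), Nat.sub_zero]
  ring

theorem sum_crossing_le (k n : ℕ) :
    ∑ p ∈ Ico 0 k ×ˢ Ioc k n, mE d (k - p.1) (p.2 - k) ≤ zE d := by
  rw [zE, ← ENNReal.tsum_prod (f := fun i j => mE d i j)]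
  have hinj : Set.InjOn (fun p : ℕ × ℕ => (k - p.1, p.2 - k)) (Ico 0 k ×ˢ Ioc k n : Finset (ℕ × ℕ)) := by
    rintro ⟨a, b⟩ h1 ⟨a', b'⟩ h2 e
    simp only [Finset.coe_product, Set.mem_prod, Finset.coe_Ico, Set.mem_Ico, Finset.coe_Ioc,
      Set.mem_Ioc] at h1 h2
    simp only [Prod.mk.injEq] at e ⊢
    omega
  refine le_trans (le_of_eq ?_) (ENNReal.sum_le_tsum (f := fun q : ℕ × ℕ => mE d q.1 q.2)
    ((Ico 0 k ×ˢ Ioc k n).image fun p => (k - p.1, p.2 - k)))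
  rw [Finset.sum_image hinj]

/-- Almost supermultiplicativity of the total mass. -/
theorem cE_mul_le (hl0 : 0 ≤ lam) (hl1 : lam ≤ 1) (hρ : ρ ≤ 1) (hd : d ≠ 0) {A : ℝ≥0∞} {n : ℕ}
    (hA : ∀ m, 1 ≤ m → m < n → ∀ x, CE d lam ρ m x ≤ A * cE d lam ρ m * gE d (22 * m) x)
    (hR : ∀ m < n, ∀ k ≤ m, cE d lam ρ k * cE d lam ρ (m - k) ≤ 2 * cE d lam ρ m)
    (hlam : ENNReal.ofReal lam * (4 * A ^ 2 * kU d * zE d) ≤ 2⁻¹) {k : ℕ} (hkn : k ≤ n) :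
    cE d lam ρ k * cE d lam ρ (n - k) ≤ 2 * cE d lam ρ n := by
  have h12 : ∀ a : ℝ≥0∞, a ≤ 2 * a := fun a => le_mul_of_one_le_left zero_le (by norm_num)
  rcases Nat.eq_zero_or_pos k with rfl | hk
  · rw [cE_zero, one_mul, Nat.sub_zero]; exact h12 _
  rcases hkn.eq_or_lt with rfl | hkn
  · rw [Nat.sub_self, cE_zero, mul_one]; exact h12 _
  set c := cE d lam ρ with hc
  set L := ENNReal.ofReal lam with hL
  have hfin : c k * c (n - k) ≠ ⊤ := ENNReal.mul_ne_top
    (ne_top_of_le_ne_top ENNReal.one_ne_top (cE_le_one hl0 hl1 _))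
    (ne_top_of_le_ne_top ENNReal.one_ne_top (cE_le_one hl0 hl1 _))
  have e1 : c k * c (n - k) = pint (Ioc 0 n)
      (fun z => (kE d lam ρ 0 k z * kE d lam ρ k n z) * phiE d 0 n z) 0 := by
    have e : (fun z : ℕ → Ed d => (kE d lam ρ 0 k z * kE d lam ρ k n z) * phiE d 0 n z) =
        fun z => (kE d lam ρ 0 k z * phiE d 0 k z) * (kE d lam ρ k n z * phiE d k n z) := by
      ext z; rw [phiE_mul (Nat.zero_le k) hkn.le]; ring
    rw [e, pint_Ioc_mul_eq (Nat.zero_le k) hkn.le ?_ (by fun_prop) (by fun_prop)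
      (fun z => pint_kphi_Ioc hkn.le z), pint_kphi_Ioc (Nat.zero_le k), Nat.sub_zero, mul_comm]
    refine DependsOn.mono (fun l hl => ?_) (dependsOn_mul (dependsOn_kE 0 k) (dependsOn_phiE 0 k))
    simp only [Set.mem_Icc, Set.mem_Iic] at hl ⊢
    omega
  have e2 : c k * c (n - k) ≤ c n + L * (4 * A ^ 2 * kU d * zE d) * (c k * c (n - k)) := by
    calc c k * c (n - k) ≤ pint (Ioc 0 n) (fun z => kE d lam ρ 0 n z * phiE d 0 n z +
          ∑ p ∈ Ico 0 k ×ˢ Ioc k n, L * (uE d ρ (z p.2 - z p.1) *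
            ((kE d lam ρ 0 k z * kE d lam ρ k n z) * phiE d 0 n z))) 0 := by
          rw [e1]
          refine lmarginal_mono (fun z => ?_) _
          refine (mul_le_mul_left (kE_mul_le hl0 hl1 hkn.le z) _).trans (le_of_eq ?_)
          rw [add_mul, Finset.sum_mul]
          congr 1
          exact Finset.sum_congr rfl fun p _ => by ring
      _ = c n + ∑ p ∈ Ico 0 k ×ˢ Ioc k n, L * pint (Ioc 0 n) (fun z => uE d ρ (z p.2 - z p.1) *
            ((kE d lam ρ 0 k z * kE d lam ρ k n z) * phiE d 0 n z)) 0 := by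
          rw [pint_add (by fun_prop), pint_kphi_Ioc (Nat.zero_le n), Nat.sub_zero,
            pint_sum _ _ (fun p _ => by fun_prop)]
          congr 1
          exact Finset.sum_congr rfl fun p _ => pint_const_mul _ (by fun_prop) _
      _ ≤ c n + ∑ p ∈ Ico 0 k ×ˢ Ioc k n, L * (A ^ 2 * kU d * mE d (k - p.1) (p.2 - k) *
            ((2 * c k) * (2 * c (n - k)))) := by
          gcongr with p hp
          simp only [Finset.mem_product, Finset.mem_Ico, Finset.mem_Ioc] at hp
          refine (pint_crossing_le hl0 hl1 hρ hd hp.1.2 hp.2.1 hp.2.2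
            (hA _ (by omega) (by omega)) (hA _ (by omega) (by omega)) 0).trans ?_
          refine mul_le_mul_right (mul_le_mul' ?_ ?_) _
          · exact hR k hkn p.1 hp.1.2.le
          · have := hR (n - k) (by omega) (p.2 - k) (by omega)
            rwa [show n - k - (p.2 - k) = n - p.2 by omega] at this
      _ = c n + L * (A ^ 2 * kU d * (∑ p ∈ Ico 0 k ×ˢ Ioc k n, mE d (k - p.1) (p.2 - k)) *
            ((2 * c k) * (2 * c (n - k)))) := by
          simp_rw [Finset.mul_sum, Finset.sum_mul, Finset.mul_sum]
      _ ≤ c n + L * (A ^ 2 * kU d * zE d * ((2 * c k) * (2 * c (n - k)))) := by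
          gcongr
          exact sum_crossing_le k n
      _ = _ := by ring
  have e3 : c k * c (n - k) ≤ c n + 2⁻¹ * (c k * c (n - k)) :=
    e2.trans (add_le_add le_rfl (mul_le_mul_left hlam _))
  have e4 : c k * c (n - k) = 2⁻¹ * (c k * c (n - k)) + 2⁻¹ * (c k * c (n - k)) := by
    rw [← add_mul, ENNReal.inv_two_add_inv_two, one_mul]
  have e5 : 2⁻¹ * (c k * c (n - k)) ≤ c n := by
    have hf2 : 2⁻¹ * (c k * c (n - k)) ≠ ⊤ := ENNReal.mul_ne_top (by norm_num) hfin
    refine (ENNReal.add_le_add_iff_right hf2).mp ?_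
    rw [← e4]
    exact e3
  calc c k * c (n - k) = 2 * (2⁻¹ * (c k * c (n - k))) := by
        rw [← mul_assoc, ENNReal.mul_inv_cancel (by norm_num) (by norm_num), one_mul]
    _ ≤ _ := mul_le_mul_right e5 _

end Ratio

section TimeDeriv

variable {d : ℕ}

/-- The time derivative `∂_t φ_t`. -/
def gaussDt (d : ℕ) (t : ℝ) (x : Ed d) : ℝ :=
  gauss d t x * (‖x‖ ^ 2 / (2 * t ^ 2) - d / (2 * t))

/-- The second time derivative `∂_t² φ_t`. -/
def gaussDtt (d : ℕ) (t : ℝ) (x : Ed d) : ℝ :=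
  gauss d t x * ((‖x‖ ^ 2 / (2 * t ^ 2) - d / (2 * t)) ^ 2 - ‖x‖ ^ 2 / t ^ 3 + d / (2 * t ^ 2))

theorem hasDerivAt_gauss {t : ℝ} (ht : 0 < t) (x : Ed d) :
    HasDerivAt (fun r => gauss d r x) (gaussDt d t x) t := by
  have hp : 0 < 2 * Real.pi * t := by positivity
  have h1 : HasDerivAt (fun r : ℝ => 2 * Real.pi * r) (2 * Real.pi) t := by
    simpa using (hasDerivAt_id t).const_mul (2 * Real.pi)
  have h2 := h1.rpow_const (p := -(d : ℝ) / 2) (Or.inl hp.ne')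
  have h3 : HasDerivAt (fun r : ℝ => -‖x‖ ^ 2 / (2 * r)) (‖x‖ ^ 2 / (2 * t ^ 2)) t := by
    have := ((hasDerivAt_id t).const_mul 2).fun_inv (by simp; positivity)
    refine (this.const_mul (-‖x‖ ^ 2)).congr_deriv ?_
    simp only [id]; field_simp
  refine (h2.fun_mul h3.exp).congr_deriv ?_
  unfold gaussDt gauss
  rw [Real.rpow_sub_one hp.ne']
  field_simp
  ring

theorem hasDerivAt_gaussDt {t : ℝ} (ht : 0 < t) (x : Ed d) :
    HasDerivAt (fun r => gaussDt d r x) (gaussDtt d t x) t := by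
  have h3 : HasDerivAt (fun r : ℝ => ‖x‖ ^ 2 / (2 * r ^ 2)) (-‖x‖ ^ 2 / t ^ 3) t := by
    have := ((hasDerivAt_pow 2 t).const_mul 2).fun_inv (by positivity)
    refine (this.const_mul (‖x‖ ^ 2)).congr_deriv ?_
    simp only [Nat.cast_ofNat]; field_simp; norm_num
  have h4 : HasDerivAt (fun r : ℝ => (d : ℝ) / (2 * r)) (-d / (2 * t ^ 2)) t := by
    have := ((hasDerivAt_id t).const_mul 2).fun_inv (by simp; positivity)
    refine (this.const_mul (d : ℝ)).congr_deriv ?_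
    simp only [id]; field_simp
  refine ((hasDerivAt_gauss ht x).fun_mul (h3.fun_sub h4)).congr_deriv ?_
  unfold gaussDtt gaussDt
  ring

/-- The constant in the comparison of nearby Gaussians with polynomial factors. -/
def kM (d : ℕ) : ℝ := (6 / 5) ^ ((d : ℝ) / 2) * 27225

theorem kM_pos (d : ℕ) : 0 < kM d := by unfold kM; positivity

theorem one_add_sq_mul_gauss_le {N r : ℝ} (hN : 0 < N) (h1 : 94 / 100 * N ≤ r)
    (h2 : r ≤ 105 / 100 * N) (x : Ed d) :
    (1 + ‖x‖ ^ 2 / N) ^ 2 * (gauss d r x * Real.exp (‖x‖ ^ 2 / (100 * r))) ≤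
      kM d * gauss d (11 / 10 * N) x := by
  have hr : 0 < r := by linarith
  set u := ‖x‖ ^ 2 / N with hu
  have hu0 : 0 ≤ u := by positivity
  have hx : ‖x‖ ^ 2 = u * N := by rw [hu]; field_simp
  unfold gauss kM
  have e1 : (2 * Real.pi * r) ^ (-(d : ℝ) / 2) ≤
      (6 / 5) ^ ((d : ℝ) / 2) * (2 * Real.pi * (11 / 10 * N)) ^ (-(d : ℝ) / 2) := by
    rw [show (6 / 5 : ℝ) ^ ((d : ℝ) / 2) = ((6 / 5 : ℝ)⁻¹) ^ (-(d : ℝ) / 2) by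
      rw [Real.inv_rpow (by norm_num), ← Real.rpow_neg (by norm_num)]; congr 1; ring,
      ← Real.mul_rpow (by norm_num) (by positivity)]
    refine Real.rpow_le_rpow_of_nonpos (by positivity) ?_ ?_
    · have := Real.pi_pos
      nlinarith
    · have : (0 : ℝ) ≤ d := by positivity
      linarith
  have e2 : Real.exp (-‖x‖ ^ 2 / (2 * r)) * Real.exp (‖x‖ ^ 2 / (100 * r)) ≤
      Real.exp (-(7 / 15) * u) := by
    rw [← Real.exp_add, Real.exp_le_exp, hx]
    have : -(u * N) / (2 * r) + u * N / (100 * r) = -(49 / 100) * u * (N / r) := by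
      field_simp; ring
    rw [this]
    have h3 : 1 / (105 / 100) ≤ N / r := by
      rw [div_le_div_iff₀ (by norm_num) hr]; linarith
    nlinarith
  have e3 : (1 + u) ^ 2 * Real.exp (-(7 / 15) * u) ≤
      27225 * Real.exp (-‖x‖ ^ 2 / (2 * (11 / 10 * N))) := by
    have h3 : -‖x‖ ^ 2 / (2 * (11 / 10 * N)) = -(7 / 15) * u + 2 / 165 * u := by
      rw [hx]; field_simp; ring
    rw [h3, Real.exp_add]
    have h4 := Real.quadratic_le_exp_of_nonneg (x := 2 / 165 * u) (by positivity)
    have h5 : (1 + u) ^ 2 ≤ 27225 * Real.exp (2 / 165 * u) := by nlinarith [sq_nonneg (u - 1)]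
    nlinarith [Real.exp_pos (-(7 / 15) * u)]
  calc _ = (2 * Real.pi * r) ^ (-(d : ℝ) / 2) * ((1 + u) ^ 2 *
        (Real.exp (-‖x‖ ^ 2 / (2 * r)) * Real.exp (‖x‖ ^ 2 / (100 * r)))) := by ring
    _ ≤ ((6 / 5) ^ ((d : ℝ) / 2) * (2 * Real.pi * (11 / 10 * N)) ^ (-(d : ℝ) / 2)) *
        (27225 * Real.exp (-‖x‖ ^ 2 / (2 * (11 / 10 * N)))) := by
        refine mul_le_mul e1 (le_trans ?_ e3) (by positivity) (by positivity)
        gcongr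
    _ = _ := by ring

theorem one_add_sq_mul_gauss_le' {N r : ℝ} (hN : 0 < N) (h1 : 94 / 100 * N ≤ r)
    (h2 : r ≤ 105 / 100 * N) (x : Ed d) :
    (1 + ‖x‖ ^ 2 / N) ^ 2 * gauss d r x ≤ kM d * gauss d (11 / 10 * N) x := by
  have hr : 0 < r := by linarith
  refine le_trans ?_ (one_add_sq_mul_gauss_le hN h1 h2 x)
  gcongr
  exact le_mul_of_one_le_right (gauss_nonneg hr.le x) (Real.one_le_exp (by positivity))

theorem gauss_le_kM {N r : ℝ} (hN : 0 < N) (h1 : 94 / 100 * N ≤ r)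
    (h2 : r ≤ 105 / 100 * N) (x : Ed d) : gauss d r x ≤ kM d * gauss d (11 / 10 * N) x := by
  have hr : 0 < r := by linarith
  refine le_trans ?_ (one_add_sq_mul_gauss_le' hN h1 h2 x)
  refine le_mul_of_one_le_left (gauss_nonneg hr.le x) ?_
  have : 0 ≤ ‖x‖ ^ 2 / N := by positivity
  nlinarith

theorem abs_gaussDt_factor_le {N r : ℝ} (hN : 0 < N) (h1 : 94 / 100 * N ≤ r) (x : Ed d) :
    |‖x‖ ^ 2 / (2 * r ^ 2) - d / (2 * r)| ≤ (d + 1) / N * (1 + ‖x‖ ^ 2 / N) := by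
  have hr : 0 < r := by linarith
  set u := ‖x‖ ^ 2 / N with hu
  have hu0 : 0 ≤ u := by positivity
  have hx : ‖x‖ ^ 2 = u * N := by rw [hu]; field_simp
  have a1 : ‖x‖ ^ 2 / (2 * r ^ 2) ≤ u / N := by
    rw [hx, div_le_div_iff₀ (by positivity) hN]
    have : N * N ≤ 2 * r ^ 2 := by nlinarith
    nlinarith
  have a2 : (d : ℝ) / (2 * r) ≤ d / N := by
    gcongr; linarith
  have a3 : (0 : ℝ) ≤ d / (2 * r) := by positivity
  have a4 : 0 ≤ ‖x‖ ^ 2 / (2 * r ^ 2) := by positivity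
  have a5 : (d + 1) / N * (1 + u) = d / N + u / N + 1 / N + d / N * u := by
    field_simp; ring
  have a6 : 0 ≤ 1 / N := by positivity
  have a7 : 0 ≤ (d : ℝ) / N * u := by positivity
  rw [a5, abs_le]
  constructor <;> linarith [a3.trans a2, a4.trans a1]

theorem abs_gaussDt_le {N r : ℝ} (hN : 0 < N) (h1 : 94 / 100 * N ≤ r)
    (h2 : r ≤ 105 / 100 * N) (x : Ed d) :
    |gaussDt d r x| ≤ (d + 1) * kM d / N * gauss d (11 / 10 * N) x := by
  have hr : 0 < r := by linarith
  have hu0 : 0 ≤ ‖x‖ ^ 2 / N := by positivity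
  rw [gaussDt, abs_mul, abs_of_nonneg (gauss_nonneg hr.le x)]
  calc _ ≤ gauss d r x * ((d + 1) / N * (1 + ‖x‖ ^ 2 / N) ^ 2) := by
        refine mul_le_mul_of_nonneg_left ((abs_gaussDt_factor_le hN h1 x).trans ?_)
          (gauss_nonneg hr.le x)
        refine mul_le_mul_of_nonneg_left ?_ (by positivity)
        nlinarith
    _ = (d + 1) / N * ((1 + ‖x‖ ^ 2 / N) ^ 2 * gauss d r x) := by ring
    _ ≤ (d + 1) / N * (kM d * gauss d (11 / 10 * N) x) := by
        refine mul_le_mul_of_nonneg_left (one_add_sq_mul_gauss_le' hN h1 h2 x) (by positivity)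
    _ = _ := by ring

theorem abs_gaussDtt_le {N r : ℝ} (hN : 0 < N) (h1 : 94 / 100 * N ≤ r)
    (h2 : r ≤ 105 / 100 * N) (x : Ed d) :
    |gaussDtt d r x| ≤ 3 * (d + 1) ^ 2 * kM d / N ^ 2 * gauss d (11 / 10 * N) x := by
  have hr : 0 < r := by linarith
  set u := ‖x‖ ^ 2 / N with hu
  have hu0 : 0 ≤ u := by positivity
  have hx : ‖x‖ ^ 2 = u * N := by rw [hu]; field_simp
  have b1 : (‖x‖ ^ 2 / (2 * r ^ 2) - d / (2 * r)) ^ 2 ≤ (d + 1) ^ 2 / N ^ 2 * (1 + u) ^ 2 := by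
    rw [← sq_abs]
    refine (pow_le_pow_left₀ (abs_nonneg _) (abs_gaussDt_factor_le hN h1 x) 2).trans (le_of_eq ?_)
    rw [mul_pow, div_pow]
  have b2 : ‖x‖ ^ 2 / r ^ 3 ≤ 2 * u / N ^ 2 := by
    rw [hx, div_le_div_iff₀ (by positivity) (by positivity)]
    have : (94 / 100 * N) ^ 3 ≤ r ^ 3 := by gcongr
    have h3 : N * N ^ 2 ≤ 2 * r ^ 3 := by nlinarith [pow_pos hN 3]
    nlinarith
  have b3 : (d : ℝ) / (2 * r ^ 2) ≤ d / N ^ 2 := by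
    gcongr
    nlinarith
  have b4 : 0 ≤ ‖x‖ ^ 2 / r ^ 3 := by positivity
  have b5 : 0 ≤ (d : ℝ) / (2 * r ^ 2) := by positivity
  have hd0 : (0 : ℝ) ≤ d := by positivity
  have b6 : 2 * u / N ^ 2 + d / N ^ 2 ≤ 2 * ((d + 1) ^ 2 / N ^ 2 * (1 + u) ^ 2) := by
    rw [show 2 * (((d : ℝ) + 1) ^ 2 / N ^ 2 * (1 + u) ^ 2) =
      (2 * (((d : ℝ) + 1) ^ 2 * (1 + u) ^ 2)) / N ^ 2 by ring, ← add_div]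
    refine div_le_div_of_nonneg_right ?_ (by positivity)
    nlinarith [mul_nonneg hd0 hu0, mul_nonneg hd0 (sq_nonneg u), mul_nonneg (sq_nonneg (d:ℝ)) hu0,
      mul_nonneg (sq_nonneg (d:ℝ)) (sq_nonneg u), sq_nonneg u, sq_nonneg (d : ℝ)]
  rw [gaussDtt, abs_mul, abs_of_nonneg (gauss_nonneg hr.le x)]
  calc _ ≤ gauss d r x * (3 * ((d + 1) ^ 2 / N ^ 2 * (1 + u) ^ 2)) := by
        refine mul_le_mul_of_nonneg_left ?_ (gauss_nonneg hr.le x)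
        rw [abs_le]
        have := sq_nonneg (‖x‖ ^ 2 / (2 * r ^ 2) - d / (2 * r))
        constructor <;> linarith
    _ = 3 * ((d + 1) ^ 2 / N ^ 2) * ((1 + u) ^ 2 * gauss d r x) := by ring
    _ ≤ 3 * ((d + 1) ^ 2 / N ^ 2) * (kM d * gauss d (11 / 10 * N) x) := by
        refine mul_le_mul_of_nonneg_left (one_add_sq_mul_gauss_le' hN h1 h2 x) (by positivity)
    _ = _ := by ring

theorem abs_gaussDt_sub_le {N s t : ℝ} (hN : 0 < N) (hs1 : 94 / 100 * N ≤ s)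
    (hs2 : s ≤ 105 / 100 * N) (ht1 : 94 / 100 * N ≤ t) (ht2 : t ≤ 105 / 100 * N) (x : Ed d) :
    |gaussDt d t x - gaussDt d s x| ≤
      3 * (d + 1) ^ 2 * kM d / N ^ 2 * gauss d (11 / 10 * N) x * |t - s| := by
  have h := (convex_Icc (94 / 100 * N) (105 / 100 * N)).norm_image_sub_le_of_norm_hasDerivWithin_le
    (f := fun r => gaussDt d r x) (f' := fun r => gaussDtt d r x)
    (C := 3 * (d + 1) ^ 2 * kM d / N ^ 2 * gauss d (11 / 10 * N) x)
    (fun r hr => (hasDerivAt_gaussDt (by linarith [hr.1]) x).hasDerivWithinAt)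
    (fun r hr => abs_gaussDtt_le hN hr.1 hr.2 x) ⟨hs1, hs2⟩ ⟨ht1, ht2⟩
  simpa using h

theorem abs_gauss_sub_le {N s t : ℝ} (hN : 0 < N) (hs1 : 94 / 100 * N ≤ s)
    (hs2 : s ≤ 105 / 100 * N) (ht1 : 94 / 100 * N ≤ t) (ht2 : t ≤ 105 / 100 * N) (x : Ed d) :
    |gauss d t x - gauss d s x - (t - s) * gaussDt d s x| ≤
      3 * (d + 1) ^ 2 * kM d / N ^ 2 * gauss d (11 / 10 * N) x * (t - s) ^ 2 := by
  set L := 3 * (d + 1) ^ 2 * kM d / N ^ 2 * gauss d (11 / 10 * N) x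
  have hL : 0 ≤ L := by
    have := kM_pos d
    have := gauss_nonneg (d := d) (t := 11 / 10 * N) (by positivity) x
    positivity
  have hmem : ∀ r ∈ Set.uIcc s t, 94 / 100 * N ≤ r ∧ r ≤ 105 / 100 * N := fun r hr =>
    ⟨(le_inf hs1 ht1).trans hr.1, hr.2.trans (sup_le hs2 ht2)⟩
  have h := (convex_uIcc s t).norm_image_sub_le_of_norm_hasDerivWithin_le
    (f := fun r => gauss d r x - (r - s) * gaussDt d s x)
    (f' := fun r => gaussDt d r x - gaussDt d s x) (C := L * |t - s|)
    (fun r hr => by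
      have h1 := hasDerivAt_gauss (d := d) (t := r) (by linarith [(hmem r hr).1]) x
      have h2 := ((hasDerivAt_id r).sub_const s).mul_const (gaussDt d s x)
      simpa using (h1.fun_sub h2).hasDerivWithinAt)
    (fun r hr => by
      refine (abs_gaussDt_sub_le hN hs1 hs2 (hmem r hr).1 (hmem r hr).2 x).trans ?_
      refine mul_le_mul_of_nonneg_left ?_ hL
      exact Set.abs_sub_left_of_mem_uIcc hr)
    Set.left_mem_uIcc Set.right_mem_uIcc
  simp only [sub_self, zero_mul, sub_zero, Real.norm_eq_abs] at h
  calc _ = |gauss d t x - (t - s) * gaussDt d s x - gauss d s x| := by congr 1; ring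
    _ ≤ _ := h
    _ = _ := by rw [mul_assoc, abs_mul_abs_self, sq]

end TimeDeriv

section Taylor

variable {d : ℕ}

/-- Isotropic functions with Gaussian-type moment bounds at spatial scale `√k`. -/
structure IsTame (d : ℕ) (k B : ℝ) (f : Ed d → ℝ) : Prop where
  meas : Measurable f
  iso : ∀ (T : Ed d ≃ₗᵢ[ℝ] Ed d) (x : Ed d), f (T x) = f x
  weight : ∃ W : Ed d → ℝ, Integrable W ∧ ∫ y, W y ≤ 1 ∧
    ∀ y, (1 + ‖y‖ ^ 2 / k) ^ 2 * Real.exp (5 * ‖y‖ ^ 2 / (8 * k)) * |f y| ≤ B * W y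

/-- The mass `∫ f`. -/
def mom0 (d : ℕ) (f : Ed d → ℝ) : ℝ := ∫ y, f y

/-- The variance `d⁻¹ ∫ |y|² f`. -/
def mom2 (d : ℕ) (f : Ed d → ℝ) : ℝ := (∫ y, ‖y‖ ^ 2 * f y) / d

namespace IsTame

variable {k B : ℝ} {f : Ed d → ℝ}

theorem integrable_mul (h : IsTame d k B f) {g : Ed d → ℝ} (hg : Measurable g) {M : ℝ}
    (hM : ∀ y, |g y| ≤ M * ((1 + ‖y‖ ^ 2 / k) ^ 2 * Real.exp (5 * ‖y‖ ^ 2 / (8 * k)))) :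
    Integrable fun y => g y * f y := by
  obtain ⟨W, hW, -, hb⟩ := h.weight
  have hM0 : 0 ≤ M := by
    have := (abs_nonneg _).trans (hM 0)
    simpa using this
  refine (hW.const_mul (M * B)).mono' (hg.mul h.meas).aestronglyMeasurable
    (Eventually.of_forall fun y => ?_)
  rw [Real.norm_eq_abs, abs_mul]
  calc _ ≤ M * ((1 + ‖y‖ ^ 2 / k) ^ 2 * Real.exp (5 * ‖y‖ ^ 2 / (8 * k))) * |f y| :=
        mul_le_mul_of_nonneg_right (hM y) (abs_nonneg _)
    _ = M * ((1 + ‖y‖ ^ 2 / k) ^ 2 * Real.exp (5 * ‖y‖ ^ 2 / (8 * k)) * |f y|) := by ring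
    _ ≤ M * (B * W y) := mul_le_mul_of_nonneg_left (hb y) hM0
    _ = _ := by ring

theorem abs_integral_le (h : IsTame d k B f) (hB : 0 ≤ B) {g : Ed d → ℝ} {M : ℝ}
    (hM : ∀ y, |g y| ≤ M * ((1 + ‖y‖ ^ 2 / k) ^ 2 * Real.exp (5 * ‖y‖ ^ 2 / (8 * k)))) :
    |∫ y, g y * f y| ≤ M * B := by
  obtain ⟨W, hW, hW1, hb⟩ := h.weight
  have hM0 : 0 ≤ M := by
    have := (abs_nonneg _).trans (hM 0)
    simpa using this
  have h1 : ‖∫ y, g y * f y‖ ≤ ∫ y, M * B * W y := by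
    refine norm_integral_le_of_norm_le (hW.const_mul (M * B)) (Eventually.of_forall fun y => ?_)
    rw [Real.norm_eq_abs, abs_mul]
    calc _ ≤ M * ((1 + ‖y‖ ^ 2 / k) ^ 2 * Real.exp (5 * ‖y‖ ^ 2 / (8 * k))) * |f y| :=
          mul_le_mul_of_nonneg_right (hM y) (abs_nonneg _)
      _ = M * ((1 + ‖y‖ ^ 2 / k) ^ 2 * Real.exp (5 * ‖y‖ ^ 2 / (8 * k)) * |f y|) := by ring
      _ ≤ M * (B * W y) := mul_le_mul_of_nonneg_left (hb y) hM0
      _ = _ := by ring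
  rw [integral_const_mul] at h1
  exact h1.trans (mul_le_of_le_one_right (by positivity) hW1)

theorem one_le_weight (hk : 0 < k) (y : Ed d) :
    1 ≤ (1 + ‖y‖ ^ 2 / k) ^ 2 * Real.exp (5 * ‖y‖ ^ 2 / (8 * k)) := by
  have h1 : 0 ≤ ‖y‖ ^ 2 / k := by positivity
  have h2 : 1 ≤ Real.exp (5 * ‖y‖ ^ 2 / (8 * k)) := Real.one_le_exp (by positivity)
  have h3 : 1 ≤ (1 + ‖y‖ ^ 2 / k) ^ 2 := by nlinarith
  exact one_le_mul_of_one_le_of_one_le h3 h2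

theorem sq_le_weight (hk : 0 < k) (y : Ed d) :
    ‖y‖ ^ 2 ≤ k * ((1 + ‖y‖ ^ 2 / k) ^ 2 * Real.exp (5 * ‖y‖ ^ 2 / (8 * k))) := by
  have h1 : 0 ≤ ‖y‖ ^ 2 / k := by positivity
  have h2 : 1 ≤ Real.exp (5 * ‖y‖ ^ 2 / (8 * k)) := Real.one_le_exp (by positivity)
  have h3 : ‖y‖ ^ 2 = k * (‖y‖ ^ 2 / k) := by field_simp
  have h4 : ‖y‖ ^ 2 / k ≤ (1 + ‖y‖ ^ 2 / k) ^ 2 := by nlinarith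
  calc ‖y‖ ^ 2 = k * (‖y‖ ^ 2 / k * 1) := by rw [mul_one]; exact h3
    _ ≤ _ := by gcongr

theorem integrable (h : IsTame d k B f) (hk : 0 < k) : Integrable f := by
  have := h.integrable_mul (g := fun _ => 1) measurable_const (M := 1)
    (fun y => by simpa using one_le_weight hk y)
  simpa using this

theorem abs_mom0_le (h : IsTame d k B f) (hk : 0 < k) (hB : 0 ≤ B) : |mom0 d f| ≤ B := by
  have := h.abs_integral_le hB (g := fun _ => 1) (M := 1)
    (fun y => by simpa using one_le_weight hk y)
  simpa [mom0] using this

theorem integrable_sq (h : IsTame d k B f) (hk : 0 < k) :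
    Integrable fun y => ‖y‖ ^ 2 * f y :=
  h.integrable_mul (g := fun y => ‖y‖ ^ 2) (by fun_prop)
    (fun y => by rw [abs_of_nonneg (by positivity)]; exact sq_le_weight hk y)

theorem abs_mom2_le (h : IsTame d k B f) (hk : 0 < k) (hB : 0 ≤ B) : |mom2 d f| ≤ k * B := by
  have := h.abs_integral_le hB (g := fun y => ‖y‖ ^ 2)
    (fun y => by rw [abs_of_nonneg (by positivity)]; exact sq_le_weight hk y)
  rw [mom2, abs_div]
  rcases Nat.eq_zero_or_pos d with hd | hd
  · subst hd; simp; positivity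
  · refine (div_le_self (abs_nonneg _) ?_).trans this
    rw [abs_of_nonneg (by positivity)]
    exact_mod_cast hd

theorem abs_inner_sq_le (hk : 0 < k) (x y : Ed d) :
    |(inner ℝ x y) ^ 2| ≤ ‖x‖ ^ 2 * k *
      ((1 + ‖y‖ ^ 2 / k) ^ 2 * Real.exp (5 * ‖y‖ ^ 2 / (8 * k))) := by
  rw [abs_pow, mul_assoc]
  calc |inner ℝ x y| ^ 2 ≤ (‖x‖ * ‖y‖) ^ 2 :=
        pow_le_pow_left₀ (abs_nonneg _) (abs_real_inner_le_norm x y) 2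
    _ = ‖x‖ ^ 2 * ‖y‖ ^ 2 := by ring
    _ ≤ _ := mul_le_mul_of_nonneg_left (sq_le_weight hk y) (by positivity)

theorem integrable_inner_sq (h : IsTame d k B f) (hk : 0 < k) (x : Ed d) :
    Integrable fun y => (inner ℝ x y) ^ 2 * f y :=
  h.integrable_mul (g := fun y => (inner ℝ x y) ^ 2) (by fun_prop) (abs_inner_sq_le hk x)

theorem integral_inner_sq_eq_of_norm_eq (h : IsTame d k B f) {x x' : Ed d} (hx : ‖x‖ = ‖x'‖) :
    ∫ y, (inner ℝ x y) ^ 2 * f y = ∫ y, (inner ℝ x' y) ^ 2 * f y := by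
  obtain ⟨T, hT⟩ : ∃ T : Ed d ≃ₗᵢ[ℝ] Ed d, T x' = x :=
    ⟨_, Submodule.reflection_sub hx.symm⟩
  rw [← (T.measurePreserving).integral_comp T.toHomeomorph.measurableEmbedding
    (fun y => (inner ℝ x y) ^ 2 * f y)]
  refine integral_congr_ae (Eventually.of_forall fun y => ?_)
  simp only
  rw [h.iso, ← hT, T.inner_map_map]

theorem integral_inner_sq (h : IsTame d k B f) (hk : 0 < k) (hd : d ≠ 0) (x : Ed d) :
    ∫ y, (inner ℝ x y) ^ 2 * f y = ‖x‖ ^ 2 * mom2 d f := by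
  have h1 : ∀ i : Fin d, ∫ y, (inner ℝ x y) ^ 2 * f y =
      ∫ y, ‖x‖ ^ 2 * ((inner ℝ (EuclideanSpace.single i (1 : ℝ)) y) ^ 2 * f y) := by
    intro i
    rw [h.integral_inner_sq_eq_of_norm_eq (x' := ‖x‖ • EuclideanSpace.single i (1 : ℝ))
      (by simp [norm_smul])]
    refine integral_congr_ae (Eventually.of_forall fun y => ?_)
    simp only [inner_smul_left, conj_trivial]
    ring
  have h2 : (d : ℝ) * ∫ y, (inner ℝ x y) ^ 2 * f y = ‖x‖ ^ 2 * ∫ y, ‖y‖ ^ 2 * f y := by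
    calc _ = ∑ i : Fin d, ∫ y, (inner ℝ x y) ^ 2 * f y := by simp
      _ = ∑ i : Fin d, ‖x‖ ^ 2 *
          ∫ y, ((inner ℝ (EuclideanSpace.single i (1 : ℝ)) y) ^ 2 * f y) := by
          refine Finset.sum_congr rfl fun i _ => ?_
          rw [h1 i, integral_const_mul]
      _ = ‖x‖ ^ 2 * ∫ y, ∑ i : Fin d,
          ((inner ℝ (EuclideanSpace.single i (1 : ℝ)) y) ^ 2 * f y) := by
          rw [← Finset.mul_sum, integral_finsetSum _ fun i _ => h.integrable_inner_sq hk _]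
      _ = _ := by
          congr 1
          refine integral_congr_ae (Eventually.of_forall fun y => ?_)
          simp only
          rw [← Finset.sum_mul, EuclideanSpace.norm_sq_eq]
          simp [EuclideanSpace.inner_single_left]
  have hd' : (d : ℝ) ≠ 0 := by exact_mod_cast hd
  rw [mom2]
  field_simp
  linarith

end IsTame

theorem sinh_le_mul_cosh {v : ℝ} (hv : 0 ≤ v) : Real.sinh v ≤ v * Real.cosh v := by
  have hder : ∀ w : ℝ, HasDerivAt (fun u => u * Real.cosh u - Real.sinh u) (w * Real.sinh w) w := by
    intro w
    refine (((hasDerivAt_id w).fun_mul (Real.hasDerivAt_cosh w)).fun_sub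
      (Real.hasDerivAt_sinh w)).congr_deriv ?_
    simp
  have hmono : MonotoneOn (fun u => u * Real.cosh u - Real.sinh u) (Set.Ici 0) := by
    refine monotoneOn_of_deriv_nonneg (convex_Ici 0)
      (fun w _ => (hder w).continuousAt.continuousWithinAt)
      (fun w _ => (hder w).differentiableAt.differentiableWithinAt) fun w hw => ?_
    rw [(hder w).deriv]
    rw [interior_Ici, Set.mem_Ioi] at hw
    exact mul_nonneg hw.le (Real.sinh_nonneg_iff.mpr hw.le)
  have := hmono (Set.mem_Ici.mpr le_rfl) (Set.mem_Ici.mpr hv) hv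
  simp only [zero_mul, Real.sinh_zero, sub_zero] at this
  linarith

theorem cosh_sub_le (a : ℝ) : 0 ≤ Real.cosh a - 1 - a ^ 2 / 2 ∧
    Real.cosh a - 1 - a ^ 2 / 2 ≤ a ^ 4 / 2 * Real.exp |a| := by
  wlog ha : 0 ≤ a generalizing a
  · have := this (-a) (by linarith)
    rwa [Real.cosh_neg, abs_neg, neg_sq, show (-a) ^ 4 = a ^ 4 by ring] at this
  have hv : 0 ≤ a / 2 := by positivity
  have h1 : Real.cosh a = 1 + 2 * Real.sinh (a / 2) ^ 2 := by
    have := Real.cosh_two_mul (a / 2)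
    rw [mul_div_cancel₀ a two_ne_zero] at this
    rw [this, Real.cosh_sq]; ring
  have h2 : a / 2 ≤ Real.sinh (a / 2) := Real.self_le_sinh_iff.mpr hv
  have h3 := sinh_le_mul_cosh hv
  have h4 : 0 ≤ Real.sinh (a / 2) := hv.trans h2
  have h5 : Real.cosh (a / 2) ^ 2 ≤ Real.exp |a| := by
    rw [abs_of_nonneg ha, show a = a / 2 + a / 2 by ring, Real.exp_add, sq]
    have : Real.cosh ((a / 2 + a / 2) / 2) ≤ Real.exp (a / 2) := by
      rw [show (a / 2 + a / 2) / 2 = a / 2 by ring]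
      have := Real.exp_sub_cosh (a / 2)
      linarith
    have h0 := Real.cosh_pos ((a / 2 + a / 2) / 2)
    gcongr
  have h6 := Real.cosh_sq (a / 2)
  have h7 : Real.sinh (a / 2) ^ 2 ≤ (a / 2) ^ 2 * Real.cosh (a / 2) ^ 2 := by
    rw [← mul_pow]; exact pow_le_pow_left₀ h4 h3 2
  have h8 : (a / 2) ^ 2 * ((a / 2) ^ 2 * Real.cosh (a / 2) ^ 2) ≤
      (a / 2) ^ 2 * ((a / 2) ^ 2 * Real.exp |a|) := by gcongr
  have h9 : (a / 2) ^ 2 * Real.sinh (a / 2) ^ 2 ≤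
      (a / 2) ^ 2 * ((a / 2) ^ 2 * Real.cosh (a / 2) ^ 2) := by gcongr
  rw [h1]
  constructor
  · nlinarith
  · have : 0 ≤ a ^ 4 * Real.exp |a| := by positivity
    nlinarith

theorem abs_exp_cosh_taylor_le (a b : ℝ) (hb : 0 ≤ b) :
    |Real.exp (-b) * Real.cosh a - 1 - a ^ 2 / 2 + b| ≤ (a ^ 4 + b ^ 2) * Real.exp |a| := by
  have e1 : 1 - b ≤ Real.exp (-b) := by linarith [Real.add_one_le_exp (-b)]
  have e2 : Real.exp (-b) ≤ 1 := Real.exp_le_one_iff.mpr (by linarith)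
  have e3 : Real.exp (-b) ≤ 1 - b + b ^ 2 := by
    rcases le_total b 1 with h | h
    · have := Real.abs_exp_sub_one_sub_id_le (x := -b) (by rw [abs_neg, abs_of_nonneg hb]; exact h)
      have := (abs_le.mp this).2
      nlinarith
    · nlinarith
  have c2 : 1 ≤ Real.exp |a| := Real.one_le_exp (abs_nonneg a)
  have c3 : 0 < Real.exp (-b) := Real.exp_pos _
  set R := Real.cosh a - 1 - a ^ 2 / 2
  have hR0 : 0 ≤ R := (cosh_sub_le a).1
  have hR1 : R ≤ a ^ 4 / 2 * Real.exp |a| := (cosh_sub_le a).2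
  have hid : Real.exp (-b) * Real.cosh a - 1 - a ^ 2 / 2 + b =
      (Real.exp (-b) - 1 + b) - a ^ 2 / 2 * (1 - Real.exp (-b)) + Real.exp (-b) * R := by
    simp only [R]; ring
  have q1 : a ^ 2 / 2 * (1 - Real.exp (-b)) ≤ (a ^ 4 + b ^ 2) / 4 := by
    have : a ^ 2 / 2 * (1 - Real.exp (-b)) ≤ a ^ 2 / 2 * b :=
      mul_le_mul_of_nonneg_left (by linarith) (by positivity)
    nlinarith [sq_nonneg (a ^ 2 - b)]
  have q2 : 0 ≤ a ^ 2 / 2 * (1 - Real.exp (-b)) := mul_nonneg (by positivity) (by linarith)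
  have q3 : Real.exp (-b) * R ≤ a ^ 4 / 2 * Real.exp |a| :=
    (mul_le_of_le_one_left hR0 e2).trans hR1
  have q4 : 0 ≤ Real.exp (-b) * R := by positivity
  have q5 : b ^ 2 ≤ b ^ 2 * Real.exp |a| := le_mul_of_one_le_right (sq_nonneg b) c2
  have q6 : a ^ 4 ≤ a ^ 4 * Real.exp |a| := le_mul_of_one_le_right (by positivity) c2
  rw [hid, abs_le]
  constructor <;> nlinarith

end Taylor

section Taylor

variable {d : ℕ} {k B : ℝ} {f : Ed d → ℝ}

theorem gauss_sub_eq {t : ℝ} (ht : 0 < t) (x y : Ed d) :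
    gauss d t (x - y) = gauss d t x * Real.exp (inner ℝ x y / t - ‖y‖ ^ 2 / (2 * t)) := by
  unfold gauss
  rw [mul_assoc ((2 * Real.pi * t) ^ (-(d : ℝ) / 2)), ← Real.exp_add, norm_sub_sq_real]
  congr 2
  field_simp
  ring

theorem exp_abs_inner_le {t : ℝ} (ht : 0 < t) (hk : 0 < k) (hkt : 40 * k ≤ t) (x y : Ed d) :
    Real.exp |inner ℝ x y / t| ≤
      Real.exp (‖x‖ ^ 2 / (100 * t)) * Real.exp (5 * ‖y‖ ^ 2 / (8 * k)) := by
  rw [← Real.exp_add, Real.exp_le_exp, abs_div, abs_of_pos ht]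
  have h1 : |inner ℝ x y| / t ≤ ‖x‖ * ‖y‖ / t := by
    gcongr; exact abs_real_inner_le_norm x y
  have h2 : ‖x‖ * ‖y‖ / t ≤ ‖x‖ ^ 2 / (100 * t) + 25 * ‖y‖ ^ 2 / t := by
    have : ‖x‖ ^ 2 / (100 * t) + 25 * ‖y‖ ^ 2 / t = (‖x‖ ^ 2 / 100 + 25 * ‖y‖ ^ 2) / t := by
      field_simp
    rw [this]
    gcongr
    nlinarith [sq_nonneg (‖x‖ / 10 - 5 * ‖y‖)]
  have h3 : 25 * ‖y‖ ^ 2 / t ≤ 5 * ‖y‖ ^ 2 / (8 * k) := by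
    rw [div_le_div_iff₀ ht (by positivity)]
    nlinarith [mul_le_mul_of_nonneg_left hkt (sq_nonneg ‖y‖)]
  linarith

theorem taylor_weight_le {t : ℝ} (ht : 0 < t) (hk : 0 < k) (hkt : 40 * k ≤ t) (x y : Ed d) :
    |Real.exp (-(‖y‖ ^ 2 / (2 * t))) * Real.cosh (inner ℝ x y / t) - 1 -
        (inner ℝ x y / t) ^ 2 / 2 + ‖y‖ ^ 2 / (2 * t)| ≤
      (k / t) ^ 2 * (1 + ‖x‖ ^ 2 / t) ^ 2 * Real.exp (‖x‖ ^ 2 / (100 * t)) *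
        ((1 + ‖y‖ ^ 2 / k) ^ 2 * Real.exp (5 * ‖y‖ ^ 2 / (8 * k))) := by
  refine (abs_exp_cosh_taylor_le _ _ (by positivity)).trans ?_
  have h1 : (inner ℝ x y / t) ^ 4 + (‖y‖ ^ 2 / (2 * t)) ^ 2 ≤
      (k / t) ^ 2 * (1 + ‖x‖ ^ 2 / t) ^ 2 * (1 + ‖y‖ ^ 2 / k) ^ 2 := by
    have e1 : (inner ℝ x y / t) ^ 4 ≤ (‖x‖ * ‖y‖ / t) ^ 4 := by
      rw [← Even.pow_abs (by decide : Even 4), abs_div, abs_of_pos ht]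
      gcongr
      exact abs_real_inner_le_norm x y
    have e2 : (‖x‖ * ‖y‖ / t) ^ 4 = (k / t) ^ 2 * (‖x‖ ^ 2 / t) ^ 2 * (‖y‖ ^ 2 / k) ^ 2 := by
      field_simp
    have e3 : (‖y‖ ^ 2 / (2 * t)) ^ 2 ≤ (k / t) ^ 2 * 1 * (‖y‖ ^ 2 / k) ^ 2 := by
      have : (k / t) ^ 2 * 1 * (‖y‖ ^ 2 / k) ^ 2 = 4 * (‖y‖ ^ 2 / (2 * t)) ^ 2 := by
        field_simp; norm_num
      rw [this]
      nlinarith [sq_nonneg (‖y‖ ^ 2 / (2 * t))]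
    have p : 0 ≤ ‖x‖ ^ 2 / t := by positivity
    have q : 0 ≤ ‖y‖ ^ 2 / k := by positivity
    calc _ ≤ (k / t) ^ 2 * (‖x‖ ^ 2 / t) ^ 2 * (‖y‖ ^ 2 / k) ^ 2 +
          (k / t) ^ 2 * 1 * (‖y‖ ^ 2 / k) ^ 2 := add_le_add (e1.trans e2.le) e3
      _ = (k / t) ^ 2 * (1 + (‖x‖ ^ 2 / t) ^ 2) * (‖y‖ ^ 2 / k) ^ 2 := by ring
      _ ≤ _ := by
        gcongr
        · nlinarith
        · linarith
  calc _ ≤ ((k / t) ^ 2 * (1 + ‖x‖ ^ 2 / t) ^ 2 * (1 + ‖y‖ ^ 2 / k) ^ 2) *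
        (Real.exp (‖x‖ ^ 2 / (100 * t)) * Real.exp (5 * ‖y‖ ^ 2 / (8 * k))) :=
        mul_le_mul h1 (exp_abs_inner_le ht hk hkt x y) (Real.exp_pos _).le (by positivity)
    _ = _ := by ring

theorem IsTame.convl_gauss_eq (h : IsTame d k B f) (hd : d ≠ 0) {t : ℝ} (ht : 0 < t) (hk : 0 < k)
    (hkt : 40 * k ≤ t) (x : Ed d) :
    convl d f (gauss d t) x - mom0 d f * gauss d t x - mom2 d f * gaussDt d t x =
      gauss d t x * ∫ y, (Real.exp (-(‖y‖ ^ 2 / (2 * t))) * Real.cosh (inner ℝ x y / t) - 1 -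
        (inner ℝ x y / t) ^ 2 / 2 + ‖y‖ ^ 2 / (2 * t)) * f y := by
  have hpm : ∀ σ : ℝ, |σ| = 1 → Integrable fun y =>
      Real.exp (σ * (inner ℝ x y / t) - ‖y‖ ^ 2 / (2 * t)) * f y := by
    intro σ hσ
    refine h.integrable_mul (by fun_prop) (M := Real.exp (‖x‖ ^ 2 / (100 * t))) fun y => ?_
    rw [abs_of_pos (Real.exp_pos _)]
    calc _ ≤ Real.exp |inner ℝ x y / t| := by
          rw [Real.exp_le_exp]
          have h1 : 0 ≤ ‖y‖ ^ 2 / (2 * t) := by positivity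
          have h2 := le_abs_self (σ * (inner ℝ x y / t))
          rw [abs_mul, hσ, one_mul] at h2
          linarith
      _ ≤ _ := exp_abs_inner_le ht hk hkt x y
      _ ≤ _ := by
          gcongr
          refine le_mul_of_one_le_left (Real.exp_pos _).le ?_
          have : 0 ≤ ‖y‖ ^ 2 / k := by positivity
          nlinarith
  have hp := hpm 1 (by simp)
  have hm := hpm (-1) (by simp)
  have e1 : convl d f (gauss d t) x =
      gauss d t x * ∫ y, Real.exp (1 * (inner ℝ x y / t) - ‖y‖ ^ 2 / (2 * t)) * f y := by
    rw [convl, ← integral_const_mul]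
    refine integral_congr_ae (Eventually.of_forall fun y => ?_)
    simp only
    rw [gauss_sub_eq ht, one_mul]; ring
  have e2 : ∫ y, Real.exp (1 * (inner ℝ x y / t) - ‖y‖ ^ 2 / (2 * t)) * f y =
      ∫ y, Real.exp ((-1) * (inner ℝ x y / t) - ‖y‖ ^ 2 / (2 * t)) * f y := by
    rw [← integral_neg_eq_self]
    refine integral_congr_ae (Eventually.of_forall fun y => ?_)
    simp only
    rw [inner_neg_right, norm_neg, show f (-y) = f y from h.iso (LinearIsometryEquiv.neg ℝ) y]
    congr 2; ring
  have e3 : ∫ y, Real.exp (1 * (inner ℝ x y / t) - ‖y‖ ^ 2 / (2 * t)) * f y =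
      ∫ y, Real.exp (-(‖y‖ ^ 2 / (2 * t))) * Real.cosh (inner ℝ x y / t) * f y := by
    have : ∀ y : Ed d, Real.exp (-(‖y‖ ^ 2 / (2 * t))) * Real.cosh (inner ℝ x y / t) * f y =
        (Real.exp (1 * (inner ℝ x y / t) - ‖y‖ ^ 2 / (2 * t)) * f y +
          Real.exp ((-1) * (inner ℝ x y / t) - ‖y‖ ^ 2 / (2 * t)) * f y) / 2 := by
      intro y
      rw [Real.cosh_eq, sub_eq_add_neg, Real.exp_add, sub_eq_add_neg, Real.exp_add, one_mul,
        neg_one_mul]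
      ring
    simp_rw [this]
    rw [integral_div, integral_add hp hm, ← e2]
    ring
  have hc : Integrable fun y =>
      Real.exp (-(‖y‖ ^ 2 / (2 * t))) * Real.cosh (inner ℝ x y / t) * f y := by
    refine ((hp.add hm).div_const 2).congr (Eventually.of_forall fun y => ?_)
    simp only [Pi.add_apply]
    rw [Real.cosh_eq, sub_eq_add_neg, Real.exp_add, sub_eq_add_neg, Real.exp_add, one_mul,
      neg_one_mul]
    ring
  have i0 := h.integrable hk
  have i2 := h.integrable_sq hk
  have ii := h.integrable_inner_sq hk x
  have e4 : ∫ y, (Real.exp (-(‖y‖ ^ 2 / (2 * t))) * Real.cosh (inner ℝ x y / t) - 1 -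
        (inner ℝ x y / t) ^ 2 / 2 + ‖y‖ ^ 2 / (2 * t)) * f y =
      (∫ y, Real.exp (-(‖y‖ ^ 2 / (2 * t))) * Real.cosh (inner ℝ x y / t) * f y) - mom0 d f -
        1 / (2 * t ^ 2) * (‖x‖ ^ 2 * mom2 d f) + 1 / (2 * t) * (d * mom2 d f) := by
    have hd' : (d : ℝ) ≠ 0 := by exact_mod_cast hd
    have hm2 : (d : ℝ) * mom2 d f = ∫ y, ‖y‖ ^ 2 * f y := by rw [mom2]; field_simp
    have i3 : Integrable fun y => Real.exp (-(‖y‖ ^ 2 / (2 * t))) * Real.cosh (inner ℝ x y / t) *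
        f y - f y := hc.sub i0
    have i4 : Integrable fun y => Real.exp (-(‖y‖ ^ 2 / (2 * t))) * Real.cosh (inner ℝ x y / t) *
        f y - f y - 1 / (2 * t ^ 2) * ((inner ℝ x y) ^ 2 * f y) := i3.sub (ii.const_mul _)
    rw [← h.integral_inner_sq hk hd, hm2, mom0, ← integral_const_mul, ← integral_const_mul,
      ← integral_sub hc i0, ← integral_sub i3 (ii.const_mul _),
      ← integral_add i4 (i2.const_mul _)]
    refine integral_congr_ae (Eventually.of_forall fun y => ?_)
    simp only
    field_simp
  rw [e4, ← e3, e1, gaussDt]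
  generalize (∫ y, Real.exp (1 * (inner ℝ x y / t) - ‖y‖ ^ 2 / (2 * t)) * f y) = I
  field_simp
  ring

theorem IsTame.abs_convl_gauss_sub_le (h : IsTame d k B f) (hd : d ≠ 0) (hB : 0 ≤ B) {N t : ℝ}
    (hN : 0 < N) (ht1 : 94 / 100 * N ≤ t) (ht2 : t ≤ 105 / 100 * N) (hk : 0 < k)
    (hkt : 40 * k ≤ t) (x : Ed d) :
    |convl d f (gauss d t) x - mom0 d f * gauss d t x - mom2 d f * gaussDt d t x| ≤
      8 * kM d * B * (k / N) ^ 2 * gauss d (11 / 10 * N) x := by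
  have ht : 0 < t := by linarith
  rw [h.convl_gauss_eq hd ht hk hkt, abs_mul, abs_of_nonneg (gauss_nonneg ht.le x)]
  have h1 := h.abs_integral_le hB (fun y => taylor_weight_le ht hk hkt x y)
  have h2 : (k / t) ^ 2 ≤ 2 * (k / N) ^ 2 := by
    rw [div_pow, div_pow, ← mul_div_assoc, div_le_div_iff₀ (by positivity) (by positivity)]
    have : N ^ 2 ≤ 2 * t ^ 2 := by nlinarith
    nlinarith [mul_le_mul_of_nonneg_left this (sq_nonneg k)]
  have h3 : (1 + ‖x‖ ^ 2 / t) ^ 2 ≤ 4 * (1 + ‖x‖ ^ 2 / N) ^ 2 := by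
    have e : ‖x‖ ^ 2 / t ≤ 2 * (‖x‖ ^ 2 / N) := by
      rw [← mul_div_assoc, div_le_div_iff₀ ht hN]
      nlinarith [sq_nonneg ‖x‖]
    have e' : 0 ≤ ‖x‖ ^ 2 / t := by positivity
    nlinarith
  calc _ ≤ gauss d t x * ((k / t) ^ 2 * (1 + ‖x‖ ^ 2 / t) ^ 2 *
        Real.exp (‖x‖ ^ 2 / (100 * t)) * B) := mul_le_mul_of_nonneg_left h1 (gauss_nonneg ht.le x)
    _ ≤ gauss d t x * ((2 * (k / N) ^ 2) * (4 * (1 + ‖x‖ ^ 2 / N) ^ 2) *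
        Real.exp (‖x‖ ^ 2 / (100 * t)) * B) := by
        have := gauss_nonneg ht.le x
        gcongr
    _ = 8 * B * (k / N) ^ 2 * ((1 + ‖x‖ ^ 2 / N) ^ 2 *
        (gauss d t x * Real.exp (‖x‖ ^ 2 / (100 * t)))) := by ring
    _ ≤ 8 * B * (k / N) ^ 2 * (kM d * gauss d (11 / 10 * N) x) := by
        exact mul_le_mul_of_nonneg_left (one_add_sq_mul_gauss_le hN ht1 ht2 x) (by positivity)
    _ = _ := by ring

/-- The constant in the second-order expansion. -/
def kT (d : ℕ) : ℝ := (8 + 18 * (d + 1) ^ 2) * kM d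

theorem IsTame.taylor (h : IsTame d k B f) (hd : d ≠ 0) (hB : 0 ≤ B) {N s t : ℝ}
    (hN : 0 < N) (hs1 : 94 / 100 * N ≤ s) (hs2 : s ≤ 105 / 100 * N) (ht1 : 94 / 100 * N ≤ t)
    (ht2 : t ≤ 105 / 100 * N) (hk : 0 < k) (hkt : 40 * k ≤ t) (hst : |t - s| ≤ 2 * k) (x : Ed d) :
    |convl d f (gauss d t) x - mom0 d f * gauss d s x -
        (mom0 d f * (t - s) + mom2 d f) * gaussDt d s x| ≤
      kT d * B * (k / N) ^ 2 * gauss d (11 / 10 * N) x := by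
  have h0 := h.abs_mom0_le hk hB
  have h2 := h.abs_mom2_le hk hB
  have hkM := kM_pos d
  set G := gauss d (11 / 10 * N) x
  have hG : 0 ≤ G := gauss_nonneg (by positivity) x
  have b1 : _ ≤ 8 * kM d * B * (k / N) ^ 2 * G :=
    h.abs_convl_gauss_sub_le hd hB hN ht1 ht2 hk hkt x
  have b2 : |mom0 d f * (gauss d t x - gauss d s x - (t - s) * gaussDt d s x)| ≤
      B * (3 * (d + 1) ^ 2 * kM d / N ^ 2 * G * (2 * k) ^ 2) := by
    rw [abs_mul]
    refine mul_le_mul h0 ((abs_gauss_sub_le hN hs1 hs2 ht1 ht2 x).trans ?_) (abs_nonneg _) hB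
    refine mul_le_mul_of_nonneg_left ?_ (by positivity)
    rw [← sq_abs]
    exact pow_le_pow_left₀ (abs_nonneg _) hst 2
  have b3 : |mom2 d f * (gaussDt d t x - gaussDt d s x)| ≤
      (k * B) * (3 * (d + 1) ^ 2 * kM d / N ^ 2 * G * (2 * k)) := by
    rw [abs_mul]
    refine mul_le_mul h2 ((abs_gaussDt_sub_le hN hs1 hs2 ht1 ht2 x).trans ?_) (abs_nonneg _)
      (by positivity)
    exact mul_le_mul_of_nonneg_left hst (by positivity)
  have e : convl d f (gauss d t) x - mom0 d f * gauss d s x -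
        (mom0 d f * (t - s) + mom2 d f) * gaussDt d s x =
      (convl d f (gauss d t) x - mom0 d f * gauss d t x - mom2 d f * gaussDt d t x) +
      mom0 d f * (gauss d t x - gauss d s x - (t - s) * gaussDt d s x) +
      mom2 d f * (gaussDt d t x - gaussDt d s x) := by ring
  rw [e]
  refine (abs_add_three _ _ _).trans ((add_le_add (add_le_add b1 b2) b3).trans (le_of_eq ?_))
  rw [kT]
  field_simp
  ring

end Taylor

section LaceTerm

variable {d : ℕ}

/-- `ζ(3/2)`. -/
def zetaHalf : ℝ := ∑' l : ℕ, (l : ℝ) ^ (-(3 / 2) : ℝ)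

theorem summable_zetaHalf : Summable fun l : ℕ => (l : ℝ) ^ (-(3 / 2) : ℝ) :=
  Real.summable_nat_rpow.mpr (by norm_num)

theorem sum_le_zetaHalf (S : Finset ℕ) : ∑ l ∈ S, (l : ℝ) ^ (-(3 / 2) : ℝ) ≤ zetaHalf :=
  summable_zetaHalf.sum_le_tsum S fun l _ => by positivity

theorem one_le_zetaHalf : 1 ≤ zetaHalf := by
  simpa using sum_le_zetaHalf {1}

theorem rpow_one_sub_le (hd : 5 ≤ d) {l : ℕ} (hl : 1 ≤ l) :
    (l : ℝ) ^ (1 - (d : ℝ) / 2) ≤ (l : ℝ) ^ (-(3 / 2) : ℝ) := by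
  have h1 : (1 : ℝ) ≤ l := by exact_mod_cast hl
  have h2 : (5 : ℝ) ≤ d := by exact_mod_cast hd
  exact Real.rpow_le_rpow_of_exponent_le h1 (by linarith)

theorem sum_rpow_le_zetaHalf (hd : 5 ≤ d) (k : ℕ) :
    ∑ l ∈ Icc 1 k, (l : ℝ) ^ (1 - (d : ℝ) / 2) ≤ zetaHalf :=
  (Finset.sum_le_sum fun _ hl => rpow_one_sub_le hd (Finset.mem_Icc.mp hl).1).trans
    (sum_le_zetaHalf _)

theorem weight_mul_gauss_le {k l : ℝ} (hl : 0 < l) (hlk : l ≤ k) (y : Ed d) :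
    (1 + ‖y‖ ^ 2 / k) ^ 2 * Real.exp (5 * ‖y‖ ^ 2 / (8 * k)) * gauss d (2 * l / 5) y ≤
      50 * 4 ^ ((d : ℝ) / 2) * gauss d (8 * l / 5) y := by
  have hk : 0 < k := hl.trans_le hlk
  set v := ‖y‖ ^ 2 / l with hv
  have hv0 : 0 ≤ v := by positivity
  have hy : ‖y‖ ^ 2 = v * l := by rw [hv]; field_simp
  have h1 : ‖y‖ ^ 2 / k ≤ v := by rw [hv]; gcongr
  have h2 : 5 * ‖y‖ ^ 2 / (8 * k) ≤ 5 / 8 * v := by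
    have : 5 * ‖y‖ ^ 2 / (8 * k) = 5 / 8 * (‖y‖ ^ 2 / k) := by field_simp
    rw [this]; gcongr
  have h3 : (1 + v) ^ 2 * Real.exp (5 / 8 * v) * Real.exp (-‖y‖ ^ 2 / (2 * (2 * l / 5))) ≤
      50 * Real.exp (-‖y‖ ^ 2 / (2 * (8 * l / 5))) := by
    have e1 : -‖y‖ ^ 2 / (2 * (2 * l / 5)) = -(5 / 4) * v := by rw [hy]; field_simp; norm_num
    have e2 : -‖y‖ ^ 2 / (2 * (8 * l / 5)) = (5 / 16) * v + (-(5 / 8) * v) := by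
      rw [hy]; field_simp; ring
    rw [e1, e2, mul_assoc, ← Real.exp_add, Real.exp_add (5 / 16 * v), ← mul_assoc,
      show 5 / 8 * v + -(5 / 4) * v = -(5 / 8) * v by ring]
    refine mul_le_mul_of_nonneg_right ?_ (Real.exp_pos _).le
    have := Real.quadratic_le_exp_of_nonneg (x := 5 / 16 * v) (by positivity)
    nlinarith [sq_nonneg (v - 1)]
  have h4 : (2 * Real.pi * (2 * l / 5)) ^ (-(d : ℝ) / 2) =
      4 ^ ((d : ℝ) / 2) * (2 * Real.pi * (8 * l / 5)) ^ (-(d : ℝ) / 2) := by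
    rw [show (4 : ℝ) ^ ((d : ℝ) / 2) = ((4 : ℝ)⁻¹) ^ (-(d : ℝ) / 2) by
      rw [Real.inv_rpow (by norm_num), ← Real.rpow_neg (by norm_num)]; congr 1; ring,
      ← Real.mul_rpow (by norm_num) (by positivity)]
    congr 1; ring
  unfold gauss
  rw [h4]
  calc _ ≤ (1 + v) ^ 2 * Real.exp (5 / 8 * v) * (4 ^ ((d : ℝ) / 2) *
        (2 * Real.pi * (8 * l / 5)) ^ (-(d : ℝ) / 2) *
          Real.exp (-‖y‖ ^ 2 / (2 * (2 * l / 5)))) := by gcongr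
    _ = (4 ^ ((d : ℝ) / 2) * (2 * Real.pi * (8 * l / 5)) ^ (-(d : ℝ) / 2)) *
        ((1 + v) ^ 2 * Real.exp (5 / 8 * v) * Real.exp (-‖y‖ ^ 2 / (2 * (2 * l / 5)))) := by ring
    _ ≤ (4 ^ ((d : ℝ) / 2) * (2 * Real.pi * (8 * l / 5)) ^ (-(d : ℝ) / 2)) *
        (50 * Real.exp (-‖y‖ ^ 2 / (2 * (8 * l / 5)))) := by gcongr
    _ = _ := by ring

/-- The constant in the moment bounds. -/
def kB (d : ℕ) : ℝ := 50 * 4 ^ ((d : ℝ) / 2) * zetaHalf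

theorem kB_pos (d : ℕ) : 0 < kB d := by
  have := one_le_zetaHalf
  unfold kB; positivity

theorem isTame_of_abs_le (hd : 5 ≤ d) {k : ℕ} (hk : 1 ≤ k) {q : ℝ} (hq : 0 ≤ q) {f : Ed d → ℝ}
    (hf : Measurable f) (hiso : ∀ (T : Ed d ≃ₗᵢ[ℝ] Ed d) (x : Ed d), f (T x) = f x)
    (hb : ∀ x, |f x| ≤ q * GammaSAW d 1 k x) :
    IsTame d k (kB d * q * ((k : ℝ) ^ (-(1 / 2) : ℝ) / k ^ 2)) f := by
  have hk1 : (1 : ℝ) ≤ k := by exact_mod_cast hk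
  have hk0 : (0 : ℝ) < k := by linarith
  have hd5 : (5 : ℝ) ≤ d := by exact_mod_cast hd
  have hz := one_le_zetaHalf
  refine ⟨hf, hiso, fun y => zetaHalf⁻¹ * ∑ l ∈ Icc 1 k, (l : ℝ) ^ (1 - (d : ℝ) / 2) *
    gauss d (8 * l / 5) y, ?_, ?_, fun y => ?_⟩
  · refine Integrable.const_mul (integrable_finsetSum _ fun l hl => ?_) _
    have : (0 : ℝ) < l := by exact_mod_cast (Finset.mem_Icc.mp hl).1
    exact (integrable_gauss (by positivity)).const_mul _
  · rw [integral_const_mul, integral_finsetSum _ fun l hl => ?_]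
    · rw [inv_mul_le_iff₀ (by linarith), mul_one]
      refine le_trans (le_of_eq (Finset.sum_congr rfl fun l hl => ?_)) (sum_rpow_le_zetaHalf hd k)
      have : (0 : ℝ) < l := by exact_mod_cast (Finset.mem_Icc.mp hl).1
      rw [integral_const_mul, integral_gauss (by positivity), mul_one]
    · have : (0 : ℝ) < l := by exact_mod_cast (Finset.mem_Icc.mp hl).1
      exact (integrable_gauss (by positivity)).const_mul _
  · have hkd : (k : ℝ) ^ (-(d : ℝ) / 2) ≤ (k : ℝ) ^ (-(1 / 2) : ℝ) / k ^ 2 := by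
      rw [← Real.rpow_natCast, ← Real.rpow_sub hk0]
      exact Real.rpow_le_rpow_of_exponent_le hk1 (by push_cast; linarith)
    set w := (1 + ‖y‖ ^ 2 / k) ^ 2 * Real.exp (5 * ‖y‖ ^ 2 / (8 * k)) with hw
    have hw0 : 0 ≤ w := by positivity
    have hS : 0 ≤ ∑ l ∈ Icc 1 k, (l : ℝ) ^ (1 - (d : ℝ) / 2) * gauss d (8 * l / 5) y :=
      Finset.sum_nonneg fun l _ => mul_nonneg (by positivity) (gauss_nonneg (by positivity) y)
    calc w * |f y| ≤ w * (q * GammaSAW d 1 k y) := mul_le_mul_of_nonneg_left (hb y) hw0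
      _ = q * (k : ℝ) ^ (-(d : ℝ) / 2) * ∑ l ∈ Icc 1 k, (l : ℝ) ^ (1 - (d : ℝ) / 2) *
          (w * gauss d (2 * l / 5) y) := by
          rw [GammaSAW, one_mul, Finset.mul_sum, Finset.mul_sum, Finset.mul_sum, Finset.mul_sum]
          exact Finset.sum_congr rfl fun l _ => by ring
      _ ≤ q * (k : ℝ) ^ (-(d : ℝ) / 2) * ∑ l ∈ Icc 1 k, (l : ℝ) ^ (1 - (d : ℝ) / 2) *
          (50 * 4 ^ ((d : ℝ) / 2) * gauss d (8 * l / 5) y) := by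
          refine mul_le_mul_of_nonneg_left (Finset.sum_le_sum fun l hl => ?_) (by positivity)
          have h0 : (0 : ℝ) < l := by exact_mod_cast (Finset.mem_Icc.mp hl).1
          have h1 : (l : ℝ) ≤ k := by exact_mod_cast (Finset.mem_Icc.mp hl).2
          exact mul_le_mul_of_nonneg_left (weight_mul_gauss_le h0 h1 y) (by positivity)
      _ = q * (k : ℝ) ^ (-(d : ℝ) / 2) * (50 * 4 ^ ((d : ℝ) / 2)) *
          ∑ l ∈ Icc 1 k, (l : ℝ) ^ (1 - (d : ℝ) / 2) * gauss d (8 * l / 5) y := by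
          rw [Finset.mul_sum, Finset.mul_sum]
          exact Finset.sum_congr rfl fun l _ => by ring
      _ ≤ q * ((k : ℝ) ^ (-(1 / 2) : ℝ) / k ^ 2) * (50 * 4 ^ ((d : ℝ) / 2)) *
          ∑ l ∈ Icc 1 k, (l : ℝ) ^ (1 - (d : ℝ) / 2) * gauss d (8 * l / 5) y := by gcongr
      _ = _ := by
          rw [kB]
          field_simp

/-- The convolution of `Γ_k` with a Gaussian, up to the factor `k^{-d/2}`. -/
def gammaShift (d k : ℕ) (t : ℝ) (x : Ed d) : ℝ :=
  ∑ l ∈ Icc 1 k, (l : ℝ) ^ (1 - (d : ℝ) / 2) * gauss d (2 * l / 5 + t) x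

theorem gammaShift_nonneg {k : ℕ} {t : ℝ} (ht : 0 ≤ t) (x : Ed d) : 0 ≤ gammaShift d k t x :=
  Finset.sum_nonneg fun l _ => mul_nonneg (by positivity) (gauss_nonneg (by positivity) x)

theorem abs_convl_gauss_le {k : ℕ} {q t : ℝ} (ht : 0 < t) {f : Ed d → ℝ}
    (hb : ∀ x, |f x| ≤ q * GammaSAW d 1 k x) (x : Ed d) :
    |convl d f (gauss d t) x| ≤ q * (k : ℝ) ^ (-(d : ℝ) / 2) * gammaShift d k t x := by
  have hpos : ∀ l ∈ Icc 1 k, (0 : ℝ) < 2 * l / 5 := fun l hl => by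
    have : (0 : ℝ) < l := by exact_mod_cast (Finset.mem_Icc.mp hl).1
    positivity
  have h_int : ∀ l ∈ Icc 1 k, Integrable fun y =>
      q * (k : ℝ) ^ (-(d : ℝ) / 2) * ((l : ℝ) ^ (1 - (d : ℝ) / 2) *
        (gauss d (2 * l / 5) (y - 0) * gauss d t (x - y))) := by
    intro l hl
    refine Integrable.const_mul (Integrable.const_mul ?_ _) _
    by_contra hn
    have := integral_gauss_mul_gauss (d := d) (hpos l hl) ht 0 x
    rw [integral_undef hn] at this
    exact absurd this (gauss_pos (by linarith [hpos l hl]) _).ne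
  calc |convl d f (gauss d t) x| ≤ ∫ y, ∑ l ∈ Icc 1 k,
        q * (k : ℝ) ^ (-(d : ℝ) / 2) * ((l : ℝ) ^ (1 - (d : ℝ) / 2) *
          (gauss d (2 * l / 5) (y - 0) * gauss d t (x - y))) := by
        rw [convl, ← Real.norm_eq_abs]
        refine norm_integral_le_of_norm_le (integrable_finsetSum _ h_int)
          (Eventually.of_forall fun y => ?_)
        rw [Real.norm_eq_abs, abs_mul, abs_of_nonneg (gauss_nonneg ht.le (x - y))]
        refine (mul_le_mul_of_nonneg_right (hb y) (gauss_nonneg ht.le _)).trans (le_of_eq ?_)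
        rw [GammaSAW, one_mul, Finset.mul_sum, Finset.mul_sum, Finset.sum_mul]
        exact Finset.sum_congr rfl fun l _ => by rw [sub_zero]; ring
    _ = _ := by
        rw [integral_finsetSum _ h_int, gammaShift, Finset.mul_sum]
        refine Finset.sum_congr rfl fun l hl => ?_
        rw [integral_const_mul, integral_const_mul, integral_gauss_mul_gauss (hpos l hl) ht,
          sub_zero]

/-- The constant in the bound on a single term of the residual. -/
def kP (d : ℕ) : ℝ :=
  kT d * kB d + 100 ^ ((d : ℝ) / 2) + 10000 * (kB d * kM d) + 300 * (kB d * ((d + 1) * kM d))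

theorem kT_pos (d : ℕ) : 0 < kT d := by
  have := kM_pos d
  unfold kT; positivity

theorem kP_pos (d : ℕ) : 0 < kP d := by
  have := kM_pos d
  have := kB_pos d
  have := kT_pos d
  unfold kP; positivity

/-- `Π_k ∗ φ_t`, with `φ_0 = δ`. -/
def convG (d : ℕ) (f : Ed d → ℝ) (i : ℕ) (t : ℝ) (x : Ed d) : ℝ :=
  if i = 0 then f x else convl d f (gauss d t) x

theorem abs_laceTerm_le (hd : 5 ≤ d) {j k : ℕ} (hk : 1 ≤ k) (hkj : k ≤ j) {q s t : ℝ} (hq : 0 ≤ q)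
    {f : Ed d → ℝ} (hf : Measurable f)
    (hiso : ∀ (T : Ed d ≃ₗᵢ[ℝ] Ed d) (x : Ed d), f (T x) = f x)
    (hb : ∀ x, |f x| ≤ q * GammaSAW d 1 k x)
    (hs1 : 95 / 100 * (j : ℝ) ≤ s) (hs2 : s ≤ 105 / 100 * (j : ℝ))
    (ht1 : 95 / 100 * ((j - k : ℕ) : ℝ) ≤ t) (ht2 : t ≤ 105 / 100 * ((j - k : ℕ) : ℝ))
    (hst : |t - s| ≤ 2 * k) (x : Ed d) :
    |convG d f (j - k) t x - mom0 d f * gauss d s x -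
        (mom0 d f * (t - s) + mom2 d f) * gaussDt d s x| ≤
      kP d * q * ((k : ℝ) ^ (-(1 / 2) : ℝ) / j ^ 2 * gauss d (11 / 10 * j) x +
        (j : ℝ) ^ (-(d : ℝ) / 2) * gammaShift d k t x) := by
  have hk1 : (1 : ℝ) ≤ k := by exact_mod_cast hk
  have hk0 : (0 : ℝ) < k := by linarith
  have hkj' : (k : ℝ) ≤ j := by exact_mod_cast hkj
  have hj0 : (0 : ℝ) < j := by linarith
  have hjk : ((j - k : ℕ) : ℝ) = j - k := Nat.cast_sub hkj
  have htn : 0 ≤ t := le_trans (by positivity) ht1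
  have hkM := kM_pos d
  have hkB := kB_pos d
  have hkT := kT_pos d
  have hG : 0 ≤ gauss d (11 / 10 * j) x := gauss_nonneg (by positivity) x
  have hS := gammaShift_nonneg (d := d) (k := k) htn x
  have tame := isTame_of_abs_le hd hk hq hf hiso hb
  set P := (k : ℝ) ^ (-(1 / 2) : ℝ) with hP
  have hP0 : 0 < P := by positivity
  set B := kB d * q * (P / k ^ 2) with hB
  have hB0 : 0 ≤ B := by positivity
  have hQ0 : 0 ≤ q * (P / j ^ 2 * gauss d (11 / 10 * j) x) := by positivity
  have hR0 : 0 ≤ q * ((j : ℝ) ^ (-(d : ℝ) / 2) * gammaShift d k t x) := by positivity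
  by_cases hc : 100 * k ≤ j
  · have hc' : 100 * (k : ℝ) ≤ j := by exact_mod_cast hc
    have hjk0 : j - k ≠ 0 := by omega
    rw [hjk] at ht1 ht2
    rw [convG, if_neg hjk0]
    refine (tame.taylor (by omega) hB0 hj0 (by linarith) hs2 (by linarith) (by linarith) hk0
      (by linarith) hst x).trans ?_
    have e : kT d * B * (k / j) ^ 2 * gauss d (11 / 10 * j) x =
        kT d * kB d * (q * (P / j ^ 2 * gauss d (11 / 10 * j) x)) := by
      rw [hB]; field_simp
    rw [e, kP]
    have := mul_nonneg (by positivity : 0 ≤ (100 : ℝ) ^ ((d : ℝ) / 2) + 10000 * (kB d * kM d) +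
      300 * (kB d * ((d + 1) * kM d))) hQ0
    have h2 := mul_nonneg (kP_pos d).le hR0
    rw [kP] at h2
    nlinarith
  · have hc' : (j : ℝ) ≤ 100 * k := by exact_mod_cast (by omega : j ≤ 100 * k)
    have c1 : |convG d f (j - k) t x| ≤
        100 ^ ((d : ℝ) / 2) * (q * ((j : ℝ) ^ (-(d : ℝ) / 2) * gammaShift d k t x)) := by
      have h1 : |convG d f (j - k) t x| ≤ q * (k : ℝ) ^ (-(d : ℝ) / 2) * gammaShift d k t x := by
        rw [convG]
        split_ifs with h0
        · have : t = 0 := by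
            rw [h0] at ht2
            simp at ht2
            linarith
          refine (hb x).trans (le_of_eq ?_)
          rw [GammaSAW, gammaShift, this, one_mul, mul_assoc]
          simp only [add_zero]
        · refine abs_convl_gauss_le ?_ hb x
          have : (1 : ℝ) ≤ (j - k : ℕ) := by exact_mod_cast (by omega : 1 ≤ j - k)
          linarith
      refine h1.trans ?_
      have h2 : (k : ℝ) ^ (-(d : ℝ) / 2) ≤ 100 ^ ((d : ℝ) / 2) * (j : ℝ) ^ (-(d : ℝ) / 2) := by
        rw [show (100 : ℝ) ^ ((d : ℝ) / 2) = ((100 : ℝ)⁻¹) ^ (-(d : ℝ) / 2) by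
          rw [Real.inv_rpow (by norm_num), ← Real.rpow_neg (by norm_num)]; congr 1; ring,
          ← Real.mul_rpow (by norm_num) (by positivity)]
        refine Real.rpow_le_rpow_of_nonpos (by positivity) (by linarith) ?_
        have : (0 : ℝ) ≤ d := by positivity
        linarith
      calc _ ≤ q * (100 ^ ((d : ℝ) / 2) * (j : ℝ) ^ (-(d : ℝ) / 2)) * gammaShift d k t x := by
            gcongr
        _ = _ := by ring
    have i1 : 1 / (k : ℝ) ≤ 100 / j := by
      rw [div_le_div_iff₀ hk0 hj0]; linarith
    have c2 : |mom0 d f * gauss d s x| ≤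
        10000 * (kB d * kM d) * (q * (P / j ^ 2 * gauss d (11 / 10 * j) x)) := by
      rw [abs_mul]
      have hs0 : 0 ≤ s := le_trans (by positivity) hs1
      have h1 := gauss_le_kM hj0 (by linarith) hs2 x
      rw [← abs_of_nonneg (gauss_nonneg hs0 x)] at h1
      refine (mul_le_mul (tame.abs_mom0_le hk0 hB0) h1 (abs_nonneg _) hB0).trans ?_
      have h2 : P / k ^ 2 ≤ P * (100 / j) ^ 2 := by
        rw [div_eq_mul_one_div, ← one_div_pow]
        gcongr
      calc _ ≤ kB d * q * (P * (100 / j) ^ 2) * (kM d * gauss d (11 / 10 * j) x) := by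
            rw [hB]; gcongr
        _ = _ := by field_simp; ring
    have c3 : |(mom0 d f * (t - s) + mom2 d f) * gaussDt d s x| ≤
        300 * (kB d * ((d + 1) * kM d)) * (q * (P / j ^ 2 * gauss d (11 / 10 * j) x)) := by
      rw [abs_mul]
      have h1 := abs_gaussDt_le hj0 (by linarith) hs2 x
      have h2 : |mom0 d f * (t - s) + mom2 d f| ≤ 3 * k * B := by
        refine (abs_add_le _ _).trans ?_
        rw [abs_mul]
        have := mul_le_mul (tame.abs_mom0_le hk0 hB0) hst (abs_nonneg _) hB0
        have := tame.abs_mom2_le hk0 hB0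
        linarith
      refine (mul_le_mul h2 h1 (abs_nonneg _) (by positivity)).trans ?_
      have h3 : 3 * k * B = 3 * kB d * q * P * (1 / k) := by rw [hB]; field_simp
      rw [h3]
      calc _ ≤ 3 * kB d * q * P * (100 / j) * ((d + 1) * kM d / j * gauss d (11 / 10 * j) x) := by
            gcongr
        _ = _ := by field_simp; ring
    have hTB : 0 ≤ kT d * kB d := by positivity
    calc _ ≤ |convG d f (j - k) t x| + |mom0 d f * gauss d s x| +
          |(mom0 d f * (t - s) + mom2 d f) * gaussDt d s x| := by
          refine (abs_sub _ _).trans (add_le_add (abs_sub _ _) le_rfl)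
      _ ≤ _ := by
          refine (add_le_add (add_le_add c1 c2) c3).trans ?_
          set X := q * (P / j ^ 2 * gauss d (11 / 10 * j) x)
          set Y := q * ((j : ℝ) ^ (-(d : ℝ) / 2) * gammaShift d k t x)
          have e : kP d * q * (P / j ^ 2 * gauss d (11 / 10 * j) x +
            (j : ℝ) ^ (-(d : ℝ) / 2) * gammaShift d k t x) = kP d * X + kP d * Y := by
            simp only [X, Y]; ring
          rw [e, kP]
          have a1 : 0 ≤ (100 : ℝ) ^ ((d : ℝ) / 2) * X := by positivity
          have a2 : 0 ≤ kT d * kB d * X := by positivity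
          have a3 : 0 ≤ kT d * kB d * Y := by positivity
          have a4 : 0 ≤ 10000 * (kB d * kM d) * Y := by positivity
          have a5 : 0 ≤ 300 * (kB d * ((d + 1) * kM d)) * Y := by positivity
          linarith

end LaceTerm

section VarianceSequence

variable {a b c : ℕ → ℝ} {n : ℕ} {β : ℝ}

/-- The solution of `c_j s_j = c_{j-1} (s_{j-1} + 1) + ∑_{k ≤ j} (a_k s_{j-k} + b_k) c_{j-k}`,
`s_0 = 0`. -/
def varSeq (a b c : ℕ → ℝ) : ℕ → ℝ
  | 0 => 0
  | j + 1 => (c j * (varSeq a b c j + 1) + ∑ k ∈ (Icc 1 (j + 1)).attach,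
      (a k * varSeq a b c (j + 1 - k) + b k) * c (j + 1 - k)) / c (j + 1)
termination_by j => j
decreasing_by
  · omega
  · have := Finset.mem_Icc.mp k.2
    omega

theorem varSeq_zero : varSeq a b c 0 = 0 := by rw [varSeq]

theorem mul_varSeq {j : ℕ} (hj : 1 ≤ j) (hc : c j ≠ 0) :
    c j * varSeq a b c j = c (j - 1) * (varSeq a b c (j - 1) + 1) +
      ∑ k ∈ Icc 1 j, (a k * varSeq a b c (j - k) + b k) * c (j - k) := by
  obtain ⟨i, rfl⟩ := Nat.exists_eq_add_of_le' hj
  rw [varSeq, mul_div_cancel₀ _ hc,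
    Finset.sum_attach (Icc 1 (i + 1)) fun k => (a k * varSeq a b c (i + 1 - k) + b k) * c (i + 1 - k)]
  simp

theorem abs_varSeq_step_le (hc : ∀ m ≤ n, 0 < c m)
    (hR : ∀ m ≤ n, ∀ k ≤ m, c k * c (m - k) ≤ 2 * c m)
    (hrec : ∀ m, 1 ≤ m → m ≤ n → c m = c (m - 1) + ∑ k ∈ Icc 1 m, a k * c (m - k))
    (hβ0 : 0 ≤ β) (ha : ∀ k, 1 ≤ k → k ≤ n → |a k| * k ≤ β * c k * (k : ℝ) ^ (-(3 / 2) : ℝ))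
    (hb : ∀ k, 1 ≤ k → k ≤ n → |b k| ≤ β * c k * (k : ℝ) ^ (-(3 / 2) : ℝ))
    (hβ : 6 * β * zetaHalf ≤ 1 / 20) {j : ℕ} (hj : 1 ≤ j) (hjn : j ≤ n) :
    |varSeq a b c j - varSeq a b c (j - 1) - 1| ≤ 6 * β * zetaHalf := by
  induction j using Nat.strong_induction_on with
  | _ j ih =>
    set s := varSeq a b c with hs
    have hcj := hc j hjn
    have hlip : ∀ k, 1 ≤ k → k ≤ j → |s (j - k) - s (j - 1) - 1| ≤ 2 * k := by
      have : ∀ k, 1 ≤ k → k ≤ j → |s (j - k) - s (j - 1)| ≤ 2 * ((k : ℝ) - 1) := by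
        intro k hk
        induction k, hk using Nat.le_induction with
        | base => intro _; simp
        | succ k hk ihk =>
          intro hkj
          have h1 := ihk (by omega)
          have h2 := ih (j - k) (by omega) (by omega) (by omega)
          have e : j - (k + 1) = j - k - 1 := by omega
          rw [e]
          rw [abs_le] at h1 h2 ⊢
          push_cast
          constructor <;> linarith
      intro k hk hkj
      have := this k hk hkj
      rw [abs_le] at this ⊢
      constructor <;> linarith
    have e : c j * (s j - s (j - 1) - 1) =
        ∑ k ∈ Icc 1 j, (a k * (s (j - k) - s (j - 1) - 1) + b k) * c (j - k) := by
      have h1 := mul_varSeq (a := a) (b := b) hj hcj.ne'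
      have h2 := hrec j hj hjn
      have h3 : ∑ k ∈ Icc 1 j, (a k * (s (j - k) - s (j - 1) - 1) + b k) * c (j - k) =
          ∑ k ∈ Icc 1 j, (a k * s (j - k) + b k) * c (j - k) -
            (s (j - 1) + 1) * ∑ k ∈ Icc 1 j, a k * c (j - k) := by
        rw [Finset.mul_sum, ← Finset.sum_sub_distrib]
        exact Finset.sum_congr rfl fun k _ => by ring
      rw [h3]
      rw [← hs] at h1
      linear_combination h1 - (s (j - 1) + 1) * h2
    have hbd : |c j * (s j - s (j - 1) - 1)| ≤ c j * (6 * β * zetaHalf) := by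
      rw [e]
      calc _ ≤ ∑ k ∈ Icc 1 j, 6 * β * c j * (k : ℝ) ^ (-(3 / 2) : ℝ) := by
            refine (Finset.abs_sum_le_sum_abs _ _).trans (Finset.sum_le_sum fun k hk => ?_)
            obtain ⟨hk1, hkj⟩ := Finset.mem_Icc.mp hk
            have c1 := hc k (hkj.trans hjn)
            have c2 := hc (j - k) (by omega)
            rw [abs_mul, abs_of_pos c2]
            have h1 : |a k * (s (j - k) - s (j - 1) - 1) + b k| ≤
                3 * (β * c k * (k : ℝ) ^ (-(3 / 2) : ℝ)) := by
              refine (abs_add_le _ _).trans ?_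
              rw [abs_mul]
              have := mul_le_mul_of_nonneg_left (hlip k hk1 hkj) (abs_nonneg (a k))
              have := ha k hk1 (hkj.trans hjn)
              have := hb k hk1 (hkj.trans hjn)
              linarith
            calc _ ≤ 3 * (β * c k * (k : ℝ) ^ (-(3 / 2) : ℝ)) * c (j - k) :=
                  mul_le_mul_of_nonneg_right h1 c2.le
              _ = 3 * β * (k : ℝ) ^ (-(3 / 2) : ℝ) * (c k * c (j - k)) := by ring
              _ ≤ 3 * β * (k : ℝ) ^ (-(3 / 2) : ℝ) * (2 * c j) :=
                  mul_le_mul_of_nonneg_left (hR j hjn k hkj) (by positivity)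
              _ = _ := by ring
        _ = 6 * β * c j * ∑ k ∈ Icc 1 j, (k : ℝ) ^ (-(3 / 2) : ℝ) := by rw [Finset.mul_sum]
        _ ≤ 6 * β * c j * zetaHalf :=
            mul_le_mul_of_nonneg_left (sum_le_zetaHalf _) (by positivity)
        _ = _ := by ring
    rw [abs_mul, abs_of_pos hcj] at hbd
    exact le_of_mul_le_mul_left hbd hcj

theorem abs_sub_sub_le_of_step {s : ℕ → ℝ} {δ : ℝ} {n : ℕ}
    (h : ∀ j, 1 ≤ j → j ≤ n → |s j - s (j - 1) - 1| ≤ δ) {j : ℕ} (hj : j ≤ n) {k : ℕ}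
    (hk : k ≤ j) : |s j - s (j - k) - k| ≤ δ * k := by
  induction k with
  | zero => simp
  | succ k ih =>
    have h1 := ih (by omega)
    have h2 := h (j - k) (by omega) (by omega)
    rw [show j - (k + 1) = j - k - 1 by omega]
    rw [abs_le] at h1 h2 ⊢
    push_cast
    constructor <;> linarith

end VarianceSequence

section Duhamel

variable {d : ℕ} {f g h : Ed d → ℝ}

/-- Bounded measurable integrable functions. -/
structure IsBddInt (d : ℕ) (f : Ed d → ℝ) : Prop where
  meas : Measurable f
  int : Integrable f
  bdd : ∃ M, ∀ x, |f x| ≤ M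

theorem IsBddInt.of_abs_le (hg : IsBddInt d g) (hf : Measurable f) (h : ∀ x, |f x| ≤ g x) :
    IsBddInt d f := by
  refine ⟨hf, hg.int.mono' hf.aestronglyMeasurable (Eventually.of_forall h), ?_⟩
  obtain ⟨M, hM⟩ := hg.bdd
  exact ⟨M, fun x => (h x).trans ((le_abs_self _).trans (hM x))⟩

theorem isBddInt_gauss {t : ℝ} (ht : 0 < t) : IsBddInt d (gauss d t) := by
  refine ⟨measurable_gauss t, integrable_gauss ht, t ^ (-(d : ℝ) / 2), fun x => ?_⟩
  rw [abs_of_pos (gauss_pos ht x)]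
  exact gauss_le_rpow ht x

theorem IsBddInt.add (hf : IsBddInt d f) (hg : IsBddInt d g) : IsBddInt d fun x => f x + g x := by
  obtain ⟨M, hM⟩ := hf.bdd
  obtain ⟨N, hN⟩ := hg.bdd
  exact ⟨hf.meas.add hg.meas, hf.int.add hg.int, M + N,
    fun x => (abs_add_le _ _).trans (add_le_add (hM x) (hN x))⟩

theorem IsBddInt.const_mul (hf : IsBddInt d f) (a : ℝ) : IsBddInt d fun x => a * f x := by
  obtain ⟨M, hM⟩ := hf.bdd
  refine ⟨hf.meas.const_mul a, hf.int.const_mul a, |a| * M, fun x => ?_⟩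
  rw [abs_mul]
  exact mul_le_mul_of_nonneg_left (hM x) (abs_nonneg a)

theorem IsBddInt.sub (hf : IsBddInt d f) (hg : IsBddInt d g) : IsBddInt d fun x => f x - g x := by
  simpa [sub_eq_add_neg] using hf.add (hg.const_mul (-1))

theorem IsBddInt.sum {ι : Type*} {S : Finset ι} {F : ι → Ed d → ℝ} (h : ∀ i ∈ S, IsBddInt d (F i)) :
    IsBddInt d fun x => ∑ i ∈ S, F i x := by
  induction S using Finset.induction_on with
  | empty => exact ⟨by simp, by simp, 0, by simp⟩
  | insert i S hi ih =>
    simp_rw [Finset.sum_insert hi]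
    exact (h i (by simp)).add (ih fun j hj => h j (by simp [hj]))

theorem IsBddInt.abs (hf : IsBddInt d f) : IsBddInt d fun x => |f x| := by
  obtain ⟨M, hM⟩ := hf.bdd
  exact ⟨hf.meas.abs, hf.int.abs, M, fun x => by rw [abs_abs]; exact hM x⟩

theorem IsBddInt.integrable_mul (hf : IsBddInt d f) (hg : IsBddInt d g) (x : Ed d) :
    Integrable fun y => f y * g (x - y) := by
  obtain ⟨M, hM⟩ := hg.bdd
  exact hf.int.mul_bdd (c := M) (hg.meas.comp (measurable_const.sub measurable_id)).aestronglyMeasurable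
    (Eventually.of_forall fun y => hM _)

theorem convl_eq_convolution (f g : Ed d → ℝ) :
    convl d f g = MeasureTheory.convolution f g (ContinuousLinearMap.mul ℝ ℝ) volume := rfl

theorem IsBddInt.convl (hf : IsBddInt d f) (hg : IsBddInt d g) : IsBddInt d (convl d f g) := by
  obtain ⟨M, hM⟩ := hg.bdd
  refine ⟨?_, ?_, (∫ y, |f y|) * M, fun x => ?_⟩
  · refine (StronglyMeasurable.integral_prod_right
      (f := fun x y => f y * g (x - y)) ?_).measurable
    exact ((hf.meas.comp measurable_snd).mul
      (hg.meas.comp (measurable_fst.sub measurable_snd))).stronglyMeasurable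
  · rw [convl_eq_convolution]
    exact hf.int.integrable_convolution _ hg.int
  · rw [_root_.convl, ← Real.norm_eq_abs, ← integral_mul_const]
    refine norm_integral_le_of_norm_le (hf.int.abs.mul_const M) (Eventually.of_forall fun y => ?_)
    rw [Real.norm_eq_abs, abs_mul]
    exact mul_le_mul_of_nonneg_left (hM _) (abs_nonneg _)

theorem integral_convl (hf : IsBddInt d f) (hg : IsBddInt d g) :
    ∫ x, convl d f g x = (∫ x, f x) * ∫ x, g x := by
  rw [convl_eq_convolution, integral_convolution _ hf.int hg.int]
  rfl

theorem convl_comm (f g : Ed d → ℝ) : convl d f g = convl d g f := by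
  funext x
  rw [convl, convl, ← integral_sub_left_eq_self _ volume x]
  exact integral_congr_ae (Eventually.of_forall fun y => by simp only [sub_sub_cancel]; ring)

theorem convl_assoc (hf : IsBddInt d f) (hg : IsBddInt d g) (hh : IsBddInt d h) :
    convl d (convl d f g) h = convl d f (convl d g h) := by
  funext x
  simp only [convl_eq_convolution]
  refine convolution_assoc _ _ _ _ (fun a b c => by simp [mul_assoc]) hf.int.aestronglyMeasurable
    hg.int.aestronglyMeasurable hh.int.aestronglyMeasurable
    (Eventually.of_forall fun y => hf.integrable_mul hg y)
    (Eventually.of_forall fun y => hg.abs.integrable_mul hh.abs y) ?_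
  exact hf.abs.integrable_mul (hg.abs.convl hh.abs) x

theorem convl_left_comm (hf : IsBddInt d f) (hg : IsBddInt d g) (hh : IsBddInt d h) :
    convl d f (convl d g h) = convl d g (convl d f h) := by
  rw [← convl_assoc hf hg hh, convl_comm f g, convl_assoc hg hf hh]

theorem convl_sum {ι : Type*} {S : Finset ι} {F : ι → Ed d → ℝ} (hf : IsBddInt d f)
    (h : ∀ i ∈ S, IsBddInt d (F i)) (x : Ed d) :
    convl d f (fun y => ∑ i ∈ S, F i y) x = ∑ i ∈ S, convl d f (F i) x := by
  simp only [convl, Finset.mul_sum]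
  exact integral_finsetSum _ fun i hi => hf.integrable_mul (h i hi) x

theorem convl_const_mul (f g : Ed d → ℝ) (a : ℝ) (x : Ed d) :
    convl d f (fun y => a * g y) x = a * convl d f g x := by
  simp only [convl, ← integral_const_mul]
  exact integral_congr_ae (Eventually.of_forall fun y => by simp only; ring)

theorem convl_sub (hf : IsBddInt d f) (hg : IsBddInt d g) (hh : IsBddInt d h) (x : Ed d) :
    convl d f (fun y => g y - h y) x = convl d f g x - convl d f h x := by
  simp only [convl, mul_sub]
  exact integral_sub (hf.integrable_mul hg x) (hf.integrable_mul hh x)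

theorem convl_gauss {s t : ℝ} (hs : 0 < s) (ht : 0 < t) (x : Ed d) :
    convl d (gauss d s) (gauss d t) x = gauss d (s + t) x := by
  have := integral_gauss_mul_gauss hs ht 0 x
  simpa [convl] using this

/-- `f ∗ g`, where `g` is read as the unit mass at the origin when `i = 0`. -/
def convZ (d : ℕ) (f : Ed d → ℝ) (i : ℕ) (g : Ed d → ℝ) : Ed d → ℝ :=
  if i = 0 then f else convl d f g

theorem convZ_zero : convZ d f 0 g = f := if_pos rfl

theorem convZ_pos {i : ℕ} (hi : i ≠ 0) : convZ d f i g = convl d f g := if_neg hi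

theorem convG_eq_convZ (f : Ed d → ℝ) (i : ℕ) (t : ℝ) (x : Ed d) :
    convG d f i t x = convZ d f i (gauss d t) x := by
  unfold convG convZ
  split_ifs <;> rfl

theorem IsBddInt.convZ (hf : IsBddInt d f) {i : ℕ} (hg : i ≠ 0 → IsBddInt d g) :
    IsBddInt d (convZ d f i g) := by
  unfold _root_.convZ
  split_ifs with hi
  · exact hf
  · exact hf.convl (hg hi)

variable {n : ℕ} {Q C E F : ℕ → Ed d → ℝ}

theorem convZ_renewal (hQ : ∀ k, 1 ≤ k → k ≤ n → IsBddInt d (Q k))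
    (hC : ∀ k, 1 ≤ k → k ≤ n → IsBddInt d (C k))
    (hrec : ∀ m, 1 ≤ m → m ≤ n → ∀ x,
      C m x = ∑ k ∈ Icc 1 m, convZ d (Q k) (m - k) (C (m - k)) x)
    (hf : IsBddInt d f) {i : ℕ} (hi : 1 ≤ i) (hin : i ≤ n) (x : Ed d) :
    convZ d f i (C i) x =
      ∑ k ∈ Icc 1 i, convl d (Q k) (convZ d f (i - k) (C (i - k))) x := by
  rw [convZ_pos (by omega), show C i = fun y => ∑ k ∈ Icc 1 i, convZ d (Q k) (i - k) (C (i - k)) y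
    from funext (hrec i hi hin), convl_sum hf]
  · refine Finset.sum_congr rfl fun k hk => ?_
    obtain ⟨hk1, hki⟩ := Finset.mem_Icc.mp hk
    rcases Nat.eq_zero_or_pos (i - k) with h0 | h0
    · rw [h0, convZ_zero, convZ_zero, convl_comm]
    · rw [convZ_pos h0.ne', convZ_pos h0.ne',
        convl_left_comm hf (hQ k hk1 (by omega)) (hC _ h0 (by omega))]
  · intro k hk
    obtain ⟨hk1, hki⟩ := Finset.mem_Icc.mp hk
    exact (hQ k hk1 (by omega)).convZ fun h0 => hC _ (by omega) (by omega)

theorem duhamel (hQ : ∀ k, 1 ≤ k → k ≤ n → IsBddInt d (Q k))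
    (hC : ∀ k, 1 ≤ k → k ≤ n → IsBddInt d (C k))
    (hE : ∀ k, 1 ≤ k → k ≤ n → IsBddInt d (E k))
    (hrec : ∀ m, 1 ≤ m → m ≤ n → ∀ x,
      C m x = ∑ k ∈ Icc 1 m, convZ d (Q k) (m - k) (C (m - k)) x)
    (hF : ∀ m, 1 ≤ m → m ≤ n → ∀ x,
      F m x = (∑ k ∈ Icc 1 (m - 1), convl d (Q k) (F (m - k)) x) - E m x)
    {m : ℕ} (hm : 1 ≤ m) (hmn : m ≤ n) (x : Ed d) :
    F m x = -1 * ∑ j ∈ Icc 1 m, convZ d (E j) (m - j) (C (m - j)) x := by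
  induction m using Nat.strong_induction_on generalizing x with
  | _ m ih =>
    have hT : ∀ j i, 1 ≤ j → j ≤ n → i ≤ n → IsBddInt d (convZ d (E j) i (C i)) :=
      fun j i h1 h2 h3 => (hE j h1 h2).convZ fun h0 => hC _ (by omega) h3
    have h1 : ∀ k ∈ Icc 1 (m - 1), convl d (Q k) (F (m - k)) x =
        ∑ j ∈ Icc 1 (m - k),
          -1 * convl d (Q k) (convZ d (E j) (m - k - j) (C (m - k - j))) x := by
      intro k hk
      obtain ⟨hk1, hkm⟩ := Finset.mem_Icc.mp hk
      rw [funext (ih (m - k) (by omega) (by omega) (by omega)), convl_const_mul,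
        convl_sum (hQ k hk1 (by omega)), Finset.mul_sum]
      intro j hj
      obtain ⟨hj1, hj2⟩ := Finset.mem_Icc.mp hj
      exact hT j _ hj1 (by omega) (by omega)
    rw [hF m hm hmn, Finset.sum_congr rfl h1, Finset.sum_comm' (t' := Icc 1 (m - 1))
      (s' := fun j => Icc 1 (m - j)) (by simp only [Finset.mem_Icc]; omega)]
    have h2 : ∀ j ∈ Icc 1 (m - 1), ∑ k ∈ Icc 1 (m - j),
        -1 * convl d (Q k) (convZ d (E j) (m - k - j) (C (m - k - j))) x =
          -1 * convZ d (E j) (m - j) (C (m - j)) x := by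
      intro j hj
      obtain ⟨hj1, hj2⟩ := Finset.mem_Icc.mp hj
      rw [convZ_renewal hQ hC hrec (hE j hj1 (by omega)) (by omega) (by omega), Finset.mul_sum]
      exact Finset.sum_congr rfl fun k _ => by rw [Nat.sub_right_comm]
    rw [Finset.sum_congr rfl h2, ← Finset.mul_sum, show Icc 1 m = insert m (Icc 1 (m - 1)) by
      ext; simp only [Finset.mem_Icc, Finset.mem_insert]; omega, Finset.sum_insert (by simp; omega),
      Nat.sub_self, convZ_zero]
    ring

end Duhamel

section Renewal

variable {d n : ℕ} {κ : ℝ} {C P : ℕ → Ed d → ℝ} {c : ℕ → ℝ}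

/-- The step distribution `φ 1_{k = 1} + Π_k` of the renewal equation. -/
def renewalStep (d : ℕ) (P : ℕ → Ed d → ℝ) (k : ℕ) (x : Ed d) : ℝ :=
  P k x + if k = 1 then gauss d 1 x else 0

/-- A solution up to time `n` of the renewal equation with perturbation `P`. -/
structure RenewalData (d n : ℕ) (κ : ℝ) (C P : ℕ → Ed d → ℝ) (c : ℕ → ℝ) : Prop where
  kappa_nonneg : 0 ≤ κ
  c_zero : c 0 = 1
  c_pos : ∀ m ≤ n, 0 < c m
  c_one : 1 ≤ 2 * c 1
  ratio : ∀ m ≤ n, ∀ k ≤ m, c k * c (m - k) ≤ 2 * c m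
  P_meas : ∀ k, Measurable (P k)
  P_iso : ∀ k (T : Ed d ≃ₗᵢ[ℝ] Ed d) x, P k (T x) = P k x
  P_le : ∀ k, 1 ≤ k → k ≤ n → ∀ x, |P k x| ≤ κ * c k * GammaSAW d 1 k x
  C_meas : ∀ k, Measurable (C k)
  C_nonneg : ∀ k x, 0 ≤ C k x
  C_le : ∀ k, 1 ≤ k → k ≤ n → ∀ x, C k x ≤ gauss d k x
  C_int : ∀ k, 1 ≤ k → k ≤ n → ∫ x, C k x = c k
  C_rec : ∀ m, 1 ≤ m → m ≤ n → ∀ x,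
    C m x = ∑ k ∈ Icc 1 m, convZ d (renewalStep d P k) (m - k) (C (m - k)) x

theorem isBddInt_GammaSAW {k : ℕ} : IsBddInt d (GammaSAW d 1 k) := by
  have : IsBddInt d fun x => ∑ l ∈ Icc 1 k, (l : ℝ) ^ (1 - (d : ℝ) / 2) * gauss d (2 * l / 5) x := by
    refine IsBddInt.sum fun l hl => IsBddInt.const_mul (isBddInt_gauss ?_) _
    have : (0 : ℝ) < l := by exact_mod_cast (Finset.mem_Icc.mp hl).1
    positivity
  exact this.const_mul _

theorem convZ_renewalStep {g : Ed d → ℝ} {k i : ℕ} (hP : IsBddInt d (P k))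
    (hg : i ≠ 0 → IsBddInt d g) (x : Ed d) :
    convZ d (renewalStep d P k) i g x =
      convZ d (P k) i g x + if k = 1 then convZ d (gauss d 1) i g x else 0 := by
  rcases eq_or_ne i 0 with rfl | hi
  · simp only [convZ_zero, renewalStep]
  · simp only [convZ_pos hi]
    by_cases hk : k = 1
    · simp only [convl, renewalStep, hk, if_true, add_mul]
      exact integral_add (by rw [← hk]; exact hP.integrable_mul (hg hi) x)
        ((isBddInt_gauss one_pos).integrable_mul (hg hi) x)
    · simp [convl, renewalStep, hk]

theorem sum_rpow_neg_half_le (j : ℕ) :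
    ∑ k ∈ Icc 1 j, (k : ℝ) ^ (-(1 / 2) : ℝ) ≤ 2 * (j : ℝ) ^ (1 / 2 : ℝ) := by
  induction j with
  | zero => simp
  | succ j ih =>
    rw [Finset.sum_Icc_succ_top (by omega)]
    rw [Real.rpow_neg (by positivity)]
    rw [← Real.sqrt_eq_rpow] at ih ⊢
    have h1 : 0 < √((j + 1 : ℕ) : ℝ) := Real.sqrt_pos.mpr (by positivity)
    have h2 := Real.sq_sqrt (by positivity : (0 : ℝ) ≤ ((j + 1 : ℕ) : ℝ))
    have h3 := Real.sq_sqrt (by positivity : (0 : ℝ) ≤ (j : ℝ))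
    have h4 := Real.sqrt_nonneg (j : ℝ)
    have h5 : (√((j + 1 : ℕ) : ℝ))⁻¹ ≤ 2 * √((j + 1 : ℕ) : ℝ) - 2 * √(j : ℝ) := by
      rw [inv_le_iff_one_le_mul₀ h1]
      push_cast at *
      nlinarith [sq_nonneg (√((j : ℝ) + 1) - √(j : ℝ))]
    linarith

namespace RenewalData

theorem isBddInt_P (h : RenewalData d n κ C P c) {k : ℕ} (hk : 1 ≤ k) (hkn : k ≤ n) :
    IsBddInt d (P k) :=
  (isBddInt_GammaSAW.const_mul _).of_abs_le (h.P_meas k) (h.P_le k hk hkn)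

theorem isBddInt_step (h : RenewalData d n κ C P c) {k : ℕ} (hk : 1 ≤ k) (hkn : k ≤ n) :
    IsBddInt d (renewalStep d P k) := by
  unfold renewalStep
  split_ifs
  · exact (h.isBddInt_P hk hkn).add (isBddInt_gauss one_pos)
  · simpa using h.isBddInt_P hk hkn

theorem isBddInt_C (h : RenewalData d n κ C P c) {k : ℕ} (hk : 1 ≤ k) (hkn : k ≤ n) :
    IsBddInt d (C k) := by
  have hk0 : (0 : ℝ) < k := by exact_mod_cast hk
  refine (isBddInt_gauss hk0).of_abs_le (h.C_meas k) fun x => ?_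
  rw [abs_of_nonneg (h.C_nonneg k x)]
  exact h.C_le k hk hkn x

theorem c_rec (h : RenewalData d n κ C P c) {m : ℕ} (hm : 1 ≤ m) (hmn : m ≤ n) :
    c m = c (m - 1) + ∑ k ∈ Icc 1 m, mom0 d (P k) * c (m - k) := by
  have hC : ∀ k ∈ Icc 1 m, m - k ≠ 0 → IsBddInt d (C (m - k)) := fun k hk h0 =>
    h.isBddInt_C (by omega) (by omega)
  have e : ∀ k ∈ Icc 1 m, ∫ x, convZ d (renewalStep d P k) (m - k) (C (m - k)) x =
      mom0 d (P k) * c (m - k) + if k = 1 then c (m - k) else 0 := by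
    intro k hk
    obtain ⟨hk1, hkm⟩ := Finset.mem_Icc.mp hk
    have e1 : ∫ x, renewalStep d P k x = mom0 d (P k) + if k = 1 then 1 else 0 := by
      unfold renewalStep mom0
      split_ifs
      · rw [integral_add (h.isBddInt_P hk1 (by omega)).int (isBddInt_gauss one_pos).int,
          integral_gauss one_pos]
      · simp
    have e2 : ∫ x, convZ d (renewalStep d P k) (m - k) (C (m - k)) x =
        (∫ x, renewalStep d P k x) * c (m - k) := by
      rcases eq_or_ne (m - k) 0 with h0 | h0
      · rw [h0, convZ_zero, h.c_zero, mul_one]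
      · rw [convZ_pos h0, integral_convl (h.isBddInt_step hk1 (by omega)) (hC k hk h0),
          h.C_int _ (by omega) (by omega)]
    rw [e2, e1]
    split_ifs <;> ring
  rw [← h.C_int m hm hmn, integral_congr_ae (Eventually.of_forall (h.C_rec m hm hmn)),
    integral_finsetSum, Finset.sum_congr rfl e, Finset.sum_add_distrib, Finset.sum_ite_eq']
  · rw [if_pos (by simp; omega)]
    ring
  · intro k hk
    obtain ⟨hk1, hkm⟩ := Finset.mem_Icc.mp hk
    exact ((h.isBddInt_step hk1 (by omega)).convZ (hC k hk)).int

end RenewalData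

/-- The variance of the Gaussian approximation. -/
def renewalVar (d : ℕ) (P : ℕ → Ed d → ℝ) (c : ℕ → ℝ) : ℕ → ℝ :=
  varSeq (fun k => mom0 d (P k)) (fun k => mom2 d (P k)) c

namespace RenewalData

theorem isTame (h : RenewalData d n κ C P c) (hd : 5 ≤ d) {k : ℕ} (hk : 1 ≤ k) (hkn : k ≤ n) :
    IsTame d k (kB d * (κ * c k) * ((k : ℝ) ^ (-(1 / 2) : ℝ) / k ^ 2)) (P k) :=
  isTame_of_abs_le hd hk (mul_nonneg h.kappa_nonneg (h.c_pos k hkn).le) (h.P_meas k) (h.P_iso k)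
    (h.P_le k hk hkn)

theorem abs_renewalVar_step_le (h : RenewalData d n κ C P c) (hd : 5 ≤ d)
    (hκ : 120 * (κ * kB d * zetaHalf) ≤ 1) {j : ℕ} (hj : 1 ≤ j) (hjn : j ≤ n) :
    |renewalVar d P c j - renewalVar d P c (j - 1) - 1| ≤ 6 * (κ * kB d) * zetaHalf := by
  have hB := kB_pos d
  have hκ0 := h.kappa_nonneg
  have hp : ∀ k : ℕ, 1 ≤ k → (k : ℝ) ^ (-(1 / 2) : ℝ) = (k : ℝ) ^ (-(3 / 2) : ℝ) * k := by
    intro k hk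
    have hk0 : (0 : ℝ) < k := by exact_mod_cast hk
    rw [← Real.rpow_add_one hk0.ne']
    norm_num
  refine abs_varSeq_step_le h.c_pos h.ratio (fun m hm hmn => h.c_rec hm hmn) (by positivity)
    (fun k hk hkn => ?_) (fun k hk hkn => ?_) (by linarith) hj hjn
  all_goals
    have hk0 : (0 : ℝ) < k := by exact_mod_cast hk
    have hc := h.c_pos k hkn
    have tame := h.isTame hd hk hkn
  · have := tame.abs_mom0_le hk0 (by positivity)
    calc _ ≤ kB d * (κ * c k) * ((k : ℝ) ^ (-(1 / 2) : ℝ) / k ^ 2) * k :=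
          mul_le_mul_of_nonneg_right this hk0.le
      _ = _ := by rw [hp k hk]; field_simp
  · have := tame.abs_mom2_le hk0 (by positivity)
    refine this.trans (le_of_eq ?_)
    rw [hp k hk]
    field_simp

theorem renewalVar_sub (h : RenewalData d n κ C P c) (hd : 5 ≤ d)
    (hκ : 120 * (κ * kB d * zetaHalf) ≤ 1) {j k : ℕ} (hjn : j ≤ n) (hk : k ≤ j) :
    |renewalVar d P c j - renewalVar d P c (j - k) - k| ≤ 1 / 20 * k := by
  refine abs_sub_sub_le_of_step (fun i hi hin => (h.abs_renewalVar_step_le hd hκ hi hin).trans ?_)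
    hjn hk
  linarith

theorem renewalVar_mem (h : RenewalData d n κ C P c) (hd : 5 ≤ d)
    (hκ : 120 * (κ * kB d * zetaHalf) ≤ 1) {j : ℕ} (hjn : j ≤ n) :
    95 / 100 * (j : ℝ) ≤ renewalVar d P c j ∧ renewalVar d P c j ≤ 105 / 100 * (j : ℝ) := by
  have := h.renewalVar_sub hd hκ hjn le_rfl
  rw [Nat.sub_self, show renewalVar d P c 0 = 0 from varSeq_zero, abs_le] at this
  constructor <;> linarith

end RenewalData

/-- The failure of the Gaussian approximation to solve the renewal equation. -/
def gaussResidual (d : ℕ) (P : ℕ → Ed d → ℝ) (c : ℕ → ℝ) (j : ℕ) (x : Ed d) : ℝ :=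
  c j * gauss d (renewalVar d P c j) x - ∑ k ∈ Icc 1 j, c (j - k) *
    convZ d (renewalStep d P k) (j - k) (gauss d (renewalVar d P c (j - k))) x

/-- The constant in the bound on the residual. -/
def kRes (d : ℕ) : ℝ := 72 * ((d + 1) ^ 2 * kM d) * (kB d * zetaHalf) + 4 * kP d

theorem kRes_pos (d : ℕ) : 0 < kRes d := by
  have := kM_pos d
  have := kB_pos d
  have := kP_pos d
  have := one_le_zetaHalf
  unfold kRes
  positivity

namespace RenewalData

theorem renewalVar_pos (h : RenewalData d n κ C P c) (hd : 5 ≤ d)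
    (hκ : 120 * (κ * kB d * zetaHalf) ≤ 1) {j : ℕ} (hj : 1 ≤ j) (hjn : j ≤ n) :
    0 < renewalVar d P c j := by
  have := (h.renewalVar_mem hd hκ hjn).1
  have : (1 : ℝ) ≤ j := by exact_mod_cast hj
  linarith

theorem residual_eq (h : RenewalData d n κ C P c) (hd : 5 ≤ d)
    (hκ : 120 * (κ * kB d * zetaHalf) ≤ 1) {j : ℕ} (hj : 1 ≤ j) (hjn : j ≤ n) (x : Ed d) :
    gaussResidual d P c j x = -(c (j - 1) * (gauss d (renewalVar d P c (j - 1) + 1) x -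
      gauss d (renewalVar d P c j) x - (renewalVar d P c (j - 1) + 1 - renewalVar d P c j) *
        gaussDt d (renewalVar d P c j) x)) - ∑ k ∈ Icc 1 j, c (j - k) *
      (convG d (P k) (j - k) (renewalVar d P c (j - k)) x -
        mom0 d (P k) * gauss d (renewalVar d P c j) x -
        (mom0 d (P k) * (renewalVar d P c (j - k) - renewalVar d P c j) + mom2 d (P k)) *
          gaussDt d (renewalVar d P c j) x) := by
  have e1 := h.c_rec hj hjn
  have e2 := mul_varSeq (a := fun k => mom0 d (P k)) (b := fun k => mom2 d (P k)) hj
    (h.c_pos j hjn).ne'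
  rw [← renewalVar] at e2
  set s := renewalVar d P c with hs
  set G := gauss d (s j) x
  set D := gaussDt d (s j) x
  have e3 : ∑ k ∈ Icc 1 j, c (j - k) * convZ d (renewalStep d P k) (j - k) (gauss d (s (j - k))) x =
      c (j - 1) * gauss d (s (j - 1) + 1) x +
        ∑ k ∈ Icc 1 j, c (j - k) * convG d (P k) (j - k) (s (j - k)) x := by
    have : ∀ k ∈ Icc 1 j,
        c (j - k) * convZ d (renewalStep d P k) (j - k) (gauss d (s (j - k))) x =
          c (j - k) * convG d (P k) (j - k) (s (j - k)) x +
            if k = 1 then c (j - k) * gauss d (s (j - k) + 1) x else 0 := by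
      intro k hk
      obtain ⟨hk1, hkj⟩ := Finset.mem_Icc.mp hk
      have hp : j - k ≠ 0 → 0 < s (j - k) := fun h0 =>
        h.renewalVar_pos hd hκ (by omega) (by omega)
      rw [convZ_renewalStep (h.isBddInt_P hk1 (by omega)) (fun h0 => isBddInt_gauss (hp h0)),
        convG_eq_convZ, mul_add]
      congr 1
      split_ifs
      · congr 1
        rcases eq_or_ne (j - k) 0 with h0 | h0
        · rw [h0, convZ_zero, hs, show renewalVar d P c 0 = 0 from varSeq_zero, zero_add]
        · rw [convZ_pos h0, convl_gauss one_pos (hp h0), add_comm]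
      · ring
    rw [Finset.sum_congr rfl this, Finset.sum_add_distrib, Finset.sum_ite_eq',
      if_pos (by simp; omega), add_comm]
  have e4 : ∑ k ∈ Icc 1 j, c (j - k) * (convG d (P k) (j - k) (s (j - k)) x - mom0 d (P k) * G -
        (mom0 d (P k) * (s (j - k) - s j) + mom2 d (P k)) * D) =
      ∑ k ∈ Icc 1 j, c (j - k) * convG d (P k) (j - k) (s (j - k)) x -
        (G - s j * D) * (∑ k ∈ Icc 1 j, mom0 d (P k) * c (j - k)) -
        D * ∑ k ∈ Icc 1 j, (mom0 d (P k) * s (j - k) + mom2 d (P k)) * c (j - k) := by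
    rw [Finset.mul_sum, Finset.mul_sum, ← Finset.sum_sub_distrib, ← Finset.sum_sub_distrib]
    exact Finset.sum_congr rfl fun k _ => by ring
  rw [gaussResidual, ← hs, e3, e4]
  linear_combination (G - s j * D) * e1 + D * e2

theorem c_pred_le (h : RenewalData d n κ C P c) {j : ℕ} (hj : 1 ≤ j) (hjn : j ≤ n) :
    c (j - 1) ≤ 4 * c j := by
  have h1 := h.ratio j hjn 1 hj
  have h2 := h.c_one
  have h3 := h.c_pos (j - 1) (by omega)
  nlinarith

theorem abs_residual_le (h : RenewalData d n κ C P c) (hd : 5 ≤ d)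
    (hκ : 120 * (κ * kB d * zetaHalf) ≤ 1) {j : ℕ} (hj : 1 ≤ j) (hjn : j ≤ n) (x : Ed d) :
    |gaussResidual d P c j x| ≤ κ * kRes d * c j *
      ((j : ℝ) ^ (-(3 / 2) : ℝ) * gauss d (11 / 10 * j) x +
        (j : ℝ) ^ (-(d : ℝ) / 2) *
          ∑ k ∈ Icc 1 j, gammaShift d k (renewalVar d P c (j - k)) x) := by
  have hκ0 := h.kappa_nonneg
  have hkM := kM_pos d
  have hkB := kB_pos d
  have hkP := kP_pos d
  have hz := one_le_zetaHalf
  have hj1 : (1 : ℝ) ≤ j := by exact_mod_cast hj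
  have hj0 : (0 : ℝ) < j := by linarith
  have hcj := h.c_pos j hjn
  have hstep := h.abs_renewalVar_step_le hd hκ hj hjn
  obtain ⟨hs1, hs2⟩ := h.renewalVar_mem hd hκ hjn
  obtain ⟨hr1, hr2⟩ := h.renewalVar_mem hd hκ (j := j - 1) (by omega)
  rw [h.residual_eq hd hκ hj hjn]
  set s := renewalVar d P c with hs
  have hG : 0 ≤ gauss d (11 / 10 * j) x := gauss_nonneg (by positivity) x
  set G := gauss d (11 / 10 * j) x with hGdef
  set J := (j : ℝ) ^ (-(3 / 2) : ℝ) with hJ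
  have hJ0 : 0 < J := by positivity
  have hJ2 : 1 / (j : ℝ) ^ 2 ≤ J := by
    rw [hJ, one_div, ← Real.rpow_natCast, ← Real.rpow_neg hj0.le]
    exact Real.rpow_le_rpow_of_exponent_le hj1 (by norm_num)
  have hJ3 : (j : ℝ) ^ (1 / 2 : ℝ) / j ^ 2 = J := by
    rw [hJ, ← Real.rpow_natCast, ← Real.rpow_sub hj0]
    norm_num
  have hcast : ((j - 1 : ℕ) : ℝ) = j - 1 := by push_cast [hj]; ring
  rw [hcast] at hr1 hr2
  have b1 : |c (j - 1) * (gauss d (s (j - 1) + 1) x - gauss d (s j) x -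
      (s (j - 1) + 1 - s j) * gaussDt d (s j) x)| ≤
        72 * ((d + 1) ^ 2 * kM d) * (kB d * zetaHalf) * (κ * c j * (J * G)) := by
    rw [abs_mul, abs_of_pos (h.c_pos (j - 1) (by omega))]
    have t1 := abs_gauss_sub_le hj0 (s := s j) (t := s (j - 1) + 1) (by linarith) hs2 (by linarith)
      (by linarith) x
    have t2 : (s (j - 1) + 1 - s j) ^ 2 ≤ 6 * (κ * kB d) * zetaHalf := by
      rw [← sq_abs, show s (j - 1) + 1 - s j = -(s j - s (j - 1) - 1) by ring, abs_neg]
      have : 6 * (κ * kB d) * zetaHalf ≤ 1 := by linarith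
      nlinarith [abs_nonneg (s j - s (j - 1) - 1)]
    have t3 : 3 * ((d : ℝ) + 1) ^ 2 * kM d / j ^ 2 * G * (s (j - 1) + 1 - s j) ^ 2 ≤
        3 * ((d : ℝ) + 1) ^ 2 * kM d * J * G * (6 * (κ * kB d) * zetaHalf) := by
      rw [div_eq_mul_one_div]
      gcongr
    calc _ ≤ 4 * c j * (3 * ((d : ℝ) + 1) ^ 2 * kM d * J * G * (6 * (κ * kB d) * zetaHalf)) :=
          mul_le_mul (h.c_pred_le hj hjn) (t1.trans t3) (abs_nonneg _) (by positivity)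
      _ = _ := by ring
  have hS : ∀ k ∈ Icc 1 j, 0 ≤ gammaShift d k (s (j - k)) x := fun k hk =>
    gammaShift_nonneg (le_trans (by positivity)
      (h.renewalVar_mem hd hκ (j := j - k) (by omega)).1) x
  have b2 : ∀ k ∈ Icc 1 j, |c (j - k) * (convG d (P k) (j - k) (s (j - k)) x -
        mom0 d (P k) * gauss d (s j) x -
        (mom0 d (P k) * (s (j - k) - s j) + mom2 d (P k)) * gaussDt d (s j) x)| ≤
      2 * (kP d * κ * c j) * ((k : ℝ) ^ (-(1 / 2) : ℝ) / j ^ 2 * G +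
        (j : ℝ) ^ (-(d : ℝ) / 2) * gammaShift d k (s (j - k)) x) := by
    intro k hk
    obtain ⟨hk1, hkj⟩ := Finset.mem_Icc.mp hk
    have hc1 := h.c_pos (j - k) (by omega)
    have hc2 := h.c_pos k (by omega)
    have hk0 : (0 : ℝ) < k := by exact_mod_cast hk1
    obtain ⟨hu1, hu2⟩ := h.renewalVar_mem hd hκ (j := j - k) (by omega)
    have hst : |s (j - k) - s j| ≤ 2 * k := by
      have := h.renewalVar_sub hd hκ hjn hkj
      rw [abs_le] at this ⊢
      constructor <;> linarith
    have t1 := abs_laceTerm_le hd hk1 hkj (mul_nonneg hκ0 hc2.le) (h.P_meas k) (h.P_iso k)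
      (h.P_le k hk1 (by omega)) hs1 hs2 hu1 hu2 hst x
    have hX : 0 ≤ (k : ℝ) ^ (-(1 / 2) : ℝ) / j ^ 2 * G +
        (j : ℝ) ^ (-(d : ℝ) / 2) * gammaShift d k (s (j - k)) x :=
      add_nonneg (by positivity) (mul_nonneg (by positivity) (hS k hk))
    rw [abs_mul, abs_of_pos hc1]
    refine (mul_le_mul_of_nonneg_left t1 hc1.le).trans ?_
    set X := (k : ℝ) ^ (-(1 / 2) : ℝ) / j ^ 2 * G +
        (j : ℝ) ^ (-(d : ℝ) / 2) * gammaShift d k (s (j - k)) x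
    calc _ = kP d * κ * X * (c k * c (j - k)) := by ring
      _ ≤ kP d * κ * X * (2 * c j) :=
          mul_le_mul_of_nonneg_left (h.ratio j hjn k hkj) (by positivity)
      _ = _ := by ring
  have b3 : |∑ k ∈ Icc 1 j, c (j - k) * (convG d (P k) (j - k) (s (j - k)) x -
        mom0 d (P k) * gauss d (s j) x -
        (mom0 d (P k) * (s (j - k) - s j) + mom2 d (P k)) * gaussDt d (s j) x)| ≤
      2 * (kP d * κ * c j) * (2 * (J * G) +
        (j : ℝ) ^ (-(d : ℝ) / 2) * ∑ k ∈ Icc 1 j, gammaShift d k (s (j - k)) x) := by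
    refine (Finset.abs_sum_le_sum_abs _ _).trans ((Finset.sum_le_sum b2).trans ?_)
    rw [← Finset.mul_sum, Finset.sum_add_distrib, ← Finset.mul_sum, ← Finset.sum_mul,
      ← Finset.sum_div]
    refine mul_le_mul_of_nonneg_left (add_le_add ?_ le_rfl) (by positivity)
    rw [← mul_assoc, ← hJ3, ← mul_div_assoc]
    have := sum_rpow_neg_half_le j
    gcongr
  have hT : 0 ≤ (j : ℝ) ^ (-(d : ℝ) / 2) * ∑ k ∈ Icc 1 j, gammaShift d k (s (j - k)) x :=
    mul_nonneg (by positivity) (Finset.sum_nonneg hS)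
  set T := (j : ℝ) ^ (-(d : ℝ) / 2) * ∑ k ∈ Icc 1 j, gammaShift d k (s (j - k)) x
  refine (abs_sub _ _).trans ?_
  rw [abs_neg]
  refine (add_le_add b1 b3).trans ?_
  have p1 : 0 ≤ 72 * (((d : ℝ) + 1) ^ 2 * kM d) * (kB d * zetaHalf) * (κ * c j * T) := by positivity
  have p2 : 0 ≤ 2 * (kP d * κ * c j) * T := by positivity
  rw [kRes]
  linarith

end RenewalData

end Renewal

section RenewalBound

variable {d n : ℕ} {κ : ℝ} {C P : ℕ → Ed d → ℝ} {c : ℕ → ℝ}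

theorem rpow_add_inv_le {a b p : ℝ} (ha : 0 < a) (hb : 0 < b) (hp : 0 ≤ p) :
    (a⁻¹ + b⁻¹) ^ p ≤ 2 ^ p * (a ^ (-p) + b ^ (-p)) := by
  have key : ∀ u v : ℝ, 0 < u → 0 < v → u ≤ v → (u⁻¹ + v⁻¹) ^ p ≤ 2 ^ p * (u ^ (-p) + v ^ (-p)) := by
    intro u v hu hv huv
    have h1 : u⁻¹ + v⁻¹ ≤ 2 * u⁻¹ := by
      have := inv_anti₀ hu huv
      linarith
    calc _ ≤ (2 * u⁻¹) ^ p := Real.rpow_le_rpow (by positivity) h1 hp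
      _ = 2 ^ p * u ^ (-p) := by
          rw [Real.mul_rpow (by norm_num) (by positivity), Real.inv_rpow hu.le, Real.rpow_neg hu.le]
      _ ≤ _ := by
          have : 0 ≤ v ^ (-p) := by positivity
          gcongr
          linarith
  rcases le_total a b with h | h
  · exact key a b ha hb h
  · rw [add_comm, add_comm (a ^ (-p))]
    exact key b a hb ha h

theorem natCast_mul_rpow_le (hd : 5 ≤ d) {l : ℕ} (hl : 1 ≤ l) :
    (l : ℝ) * (l : ℝ) ^ (-((d : ℝ) / 2)) ≤ (l : ℝ) ^ (-(3 / 2) : ℝ) := by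
  refine le_trans (le_of_eq ?_) (rpow_one_sub_le hd hl)
  have hl0 : (0 : ℝ) < l := by exact_mod_cast hl
  rw [sub_eq_add_neg, Real.rpow_add hl0, Real.rpow_one]

theorem sum_sum_rpow_le (hd : 5 ≤ d) (n : ℕ) :
    ∑ j ∈ Icc 1 n, ∑ k ∈ Icc 1 j, ((n : ℝ) / (j * (n + 1 - k : ℕ))) ^ ((d : ℝ) / 2) ≤
      2 ^ ((d : ℝ) / 2) * (2 * zetaHalf) := by
  set p := (d : ℝ) / 2 with hp
  have hp0 : 0 ≤ p := by positivity
  have h1 : ∑ j ∈ Icc 1 n, ∑ k ∈ Icc 1 j, (j : ℝ) ^ (-p) ≤ zetaHalf := by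
    refine le_trans (Finset.sum_le_sum fun j hj => ?_) (sum_le_zetaHalf (Icc 1 n))
    rw [Finset.sum_const, Nat.card_Icc, nsmul_eq_mul, Nat.add_sub_cancel]
    exact natCast_mul_rpow_le hd (Finset.mem_Icc.mp hj).1
  have h2 : ∑ j ∈ Icc 1 n, ∑ k ∈ Icc 1 j, ((n + 1 - k : ℕ) : ℝ) ^ (-p) ≤ zetaHalf := by
    rw [Finset.sum_comm' (t' := Icc 1 n) (s' := fun k => Icc k n)
      (by simp only [Finset.mem_Icc]; omega)]
    have : ∀ k ∈ Icc 1 n, ∑ j ∈ Icc k n, ((n + 1 - k : ℕ) : ℝ) ^ (-p) ≤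
        ((n + 1 - k : ℕ) : ℝ) ^ (-(3 / 2) : ℝ) := by
      intro k hk
      have := Finset.mem_Icc.mp hk
      rw [Finset.sum_const, Nat.card_Icc, nsmul_eq_mul]
      exact natCast_mul_rpow_le hd (by omega)
    refine (Finset.sum_le_sum this).trans (le_trans (le_of_eq ?_) (sum_le_zetaHalf (Icc 1 n)))
    refine Finset.sum_nbij' (fun k => n + 1 - k) (fun k => n + 1 - k) ?_ ?_ ?_ ?_ ?_
    all_goals simp only [Finset.mem_Icc]
    all_goals intros
    all_goals first | omega | trivial
  calc _ ≤ ∑ j ∈ Icc 1 n, ∑ k ∈ Icc 1 j,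
        2 ^ p * ((j : ℝ) ^ (-p) + ((n + 1 - k : ℕ) : ℝ) ^ (-p)) := by
        refine Finset.sum_le_sum fun j hj => Finset.sum_le_sum fun k hk => ?_
        have hj' := Finset.mem_Icc.mp hj
        have hk' := Finset.mem_Icc.mp hk
        have hj0 : (0 : ℝ) < j := by exact_mod_cast hj'.1
        have hr0 : (0 : ℝ) < (n + 1 - k : ℕ) := by exact_mod_cast (by omega : 0 < n + 1 - k)
        refine le_trans (Real.rpow_le_rpow (by positivity) ?_ hp0) (rpow_add_inv_le hj0 hr0 hp0)
        have : (n : ℝ) ≤ j + (n + 1 - k : ℕ) := by exact_mod_cast (by omega : n ≤ j + (n + 1 - k))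
        rw [inv_add_inv hj0.ne' hr0.ne']
        gcongr
    _ = 2 ^ p * (∑ j ∈ Icc 1 n, ∑ k ∈ Icc 1 j, (j : ℝ) ^ (-p) +
        ∑ j ∈ Icc 1 n, ∑ k ∈ Icc 1 j, ((n + 1 - k : ℕ) : ℝ) ^ (-p)) := by
        simp_rw [← Finset.mul_sum, Finset.sum_add_distrib]
    _ ≤ _ := by
        gcongr
        linarith

/-- The convolution with `φ_τ` of the majorant of the residual at time `j`. -/
def resProfile (d : ℕ) (s : ℕ → ℝ) (j : ℕ) (τ : ℝ) (x : Ed d) : ℝ :=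
  (j : ℝ) ^ (-(3 / 2) : ℝ) * gauss d (11 / 10 * j + τ) x +
    (j : ℝ) ^ (-(d : ℝ) / 2) * ∑ k ∈ Icc 1 j, gammaShift d k (s (j - k) + τ) x

theorem isBddInt_gammaShift {k : ℕ} {t : ℝ} (ht : 0 ≤ t) : IsBddInt d (gammaShift d k t) := by
  refine IsBddInt.sum fun l hl => IsBddInt.const_mul (isBddInt_gauss ?_) _
  have : (0 : ℝ) < l := by exact_mod_cast (Finset.mem_Icc.mp hl).1
  positivity

theorem isBddInt_resProfile {s : ℕ → ℝ} {j : ℕ} (hs : ∀ i ≤ j, 0 ≤ s i) (hj : 1 ≤ j) {τ : ℝ}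
    (hτ : 0 ≤ τ) : IsBddInt d (resProfile d s j τ) := by
  have : (0 : ℝ) < j := by exact_mod_cast hj
  exact (IsBddInt.const_mul (isBddInt_gauss (by positivity)) _).add
    (IsBddInt.const_mul (IsBddInt.sum fun k _ => isBddInt_gammaShift (add_nonneg (hs _ (Nat.sub_le _ _)) hτ)) _)

theorem convl_add {f g h : Ed d → ℝ} (hf : IsBddInt d f) (hg : IsBddInt d g) (hh : IsBddInt d h)
    (x : Ed d) : convl d f (fun y => g y + h y) x = convl d f g x + convl d f h x := by
  simp only [convl, mul_add]
  exact integral_add (hf.integrable_mul hg x) (hf.integrable_mul hh x)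

theorem convl_gauss_gammaShift {k : ℕ} {t τ : ℝ} (ht : 0 ≤ t) (hτ : 0 < τ) (x : Ed d) :
    convl d (gauss d τ) (gammaShift d k t) x = gammaShift d k (t + τ) x := by
  have hp : ∀ l ∈ Icc 1 k, (0 : ℝ) < 2 * l / 5 + t := fun l hl => by
    have : (0 : ℝ) < l := by exact_mod_cast (Finset.mem_Icc.mp hl).1
    positivity
  unfold gammaShift
  rw [convl_sum (isBddInt_gauss hτ) fun l hl => (isBddInt_gauss (hp l hl)).const_mul _]
  refine Finset.sum_congr rfl fun l hl => ?_
  rw [convl_const_mul, convl_gauss hτ (hp l hl)]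
  congr 2
  ring

theorem convl_resProfile {s : ℕ → ℝ} {j : ℕ} (hs : ∀ i ≤ j, 0 ≤ s i) (hj : 1 ≤ j) {τ : ℝ} (hτ : 0 < τ)
    (x : Ed d) : convl d (resProfile d s j 0) (gauss d τ) x = resProfile d s j τ x := by
  have hj0 : (0 : ℝ) < 11 / 10 * (j : ℝ) := by
    have : (0 : ℝ) < j := by exact_mod_cast hj
    positivity
  have hg := isBddInt_gauss (d := d) hτ
  rw [convl_comm]
  unfold resProfile
  simp only [add_zero]
  rw [convl_add hg ((isBddInt_gauss hj0).const_mul _)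
    (IsBddInt.const_mul (IsBddInt.sum fun k _ => isBddInt_gammaShift (hs _ (Nat.sub_le _ _))) _), convl_const_mul,
    convl_const_mul, convl_gauss hτ hj0,
    convl_sum hg fun k _ => isBddInt_gammaShift (hs _ (Nat.sub_le _ _)), add_comm τ]
  simp only [convl_gauss_gammaShift (hs _ (Nat.sub_le _ _)) hτ]

theorem abs_convl_le {f g F G : Ed d → ℝ} (hF : IsBddInt d F) (hG : IsBddInt d G)
    (hf : ∀ x, |f x| ≤ F x) (hg : ∀ x, |g x| ≤ G x) (x : Ed d) :
    |convl d f g x| ≤ convl d F G x := by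
  rw [convl, ← Real.norm_eq_abs]
  refine norm_integral_le_of_norm_le (hF.integrable_mul hG x) (Eventually.of_forall fun y => ?_)
  rw [Real.norm_eq_abs, abs_mul]
  exact mul_le_mul (hf _) (hg _) (abs_nonneg _) ((abs_nonneg _).trans (hf _))

theorem gammaShift_le (hd : 5 ≤ d) {s : ℕ → ℝ} {n j k : ℕ} (hjn : j ≤ n) (hkj : k ≤ j)
    (hs1 : 95 / 100 * ((j - k : ℕ) : ℝ) ≤ s (j - k)) (hs2 : s (j - k) ≤ 105 / 100 * ((j - k : ℕ) : ℝ))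
    (x : Ed d) :
    gammaShift d k (s (j - k) + 11 / 10 * ((n - j : ℕ) : ℝ)) x ≤
      zetaHalf * (11 / 4 * ((n : ℝ) / (n + 1 - k : ℕ))) ^ ((d : ℝ) / 2) *
        gauss d (11 / 10 * n) x := by
  have hr0 : (0 : ℝ) < (n + 1 - k : ℕ) := by exact_mod_cast (by omega : 0 < n + 1 - k)
  have hG : 0 ≤ gauss d (11 / 10 * n) x := gauss_nonneg (by positivity) x
  have hz := one_le_zetaHalf
  rw [mul_assoc]
  refine le_trans ?_ (mul_le_mul_of_nonneg_right (sum_rpow_le_zetaHalf hd k) (by positivity))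
  rw [gammaShift, Finset.sum_mul]
  refine Finset.sum_le_sum fun l hl => mul_le_mul_of_nonneg_left ?_ (by positivity)
  obtain ⟨hl1, hlk⟩ := Finset.mem_Icc.mp hl
  have hl1' : (1 : ℝ) ≤ l := by exact_mod_cast hl1
  have hlk' : (l : ℝ) ≤ k := by exact_mod_cast hlk
  have e1 : ((j - k : ℕ) : ℝ) = j - k := Nat.cast_sub hkj
  have e2 : ((n - j : ℕ) : ℝ) = n - j := Nat.cast_sub hjn
  have e3 : ((n + 1 - k : ℕ) : ℝ) = n + 1 - k := by
    rw [Nat.cast_sub (by omega)]; push_cast; ring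
  have hjn' : (j : ℝ) ≤ n := by exact_mod_cast hjn
  have hkj' : (k : ℝ) ≤ j := by exact_mod_cast hkj
  rw [e1] at hs1 hs2
  refine gauss_le_gauss ?_ ?_ ?_ x
  · rw [e2]; linarith
  · rw [e2]; linarith
  · have : 2 / 5 * ((n + 1 - k : ℕ) : ℝ) ≤ 2 * l / 5 + (s (j - k) + 11 / 10 * ((n - j : ℕ) : ℝ)) := by
      rw [e2, e3]; linarith
    calc 11 / 10 * (n : ℝ) = 11 / 4 * ((n : ℝ) / (n + 1 - k : ℕ)) *
          (2 / 5 * ((n + 1 - k : ℕ) : ℝ)) := by field_simp; ring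
      _ ≤ _ := mul_le_mul_of_nonneg_left this (by positivity)

/-- The constant in the sum of the residuals. -/
def kSum (d : ℕ) : ℝ :=
  zetaHalf + zetaHalf * (11 / 4) ^ ((d : ℝ) / 2) * (2 ^ ((d : ℝ) / 2) * (2 * zetaHalf))

theorem kSum_pos (d : ℕ) : 0 < kSum d := by
  have := one_le_zetaHalf
  unfold kSum
  positivity

theorem sum_resProfile_le (hd : 5 ≤ d) {s : ℕ → ℝ} {n : ℕ}
    (hs1 : ∀ i ≤ n, 95 / 100 * (i : ℝ) ≤ s i) (hs2 : ∀ i ≤ n, s i ≤ 105 / 100 * (i : ℝ)) (x : Ed d) :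
    ∑ j ∈ Icc 1 n, resProfile d s j (11 / 10 * ((n - j : ℕ) : ℝ)) x ≤
      kSum d * gauss d (11 / 10 * n) x := by
  have hG : 0 ≤ gauss d (11 / 10 * n) x := gauss_nonneg (by positivity) x
  have hz := one_le_zetaHalf
  have h1 : ∀ j ∈ Icc 1 n, resProfile d s j (11 / 10 * ((n - j : ℕ) : ℝ)) x ≤
      (j : ℝ) ^ (-(3 / 2) : ℝ) * gauss d (11 / 10 * n) x +
      zetaHalf * (11 / 4) ^ ((d : ℝ) / 2) *
        (∑ k ∈ Icc 1 j, ((n : ℝ) / (j * (n + 1 - k : ℕ))) ^ ((d : ℝ) / 2)) *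
          gauss d (11 / 10 * n) x := by
    intro j hj
    obtain ⟨hj1, hjn⟩ := Finset.mem_Icc.mp hj
    have hj0 : (0 : ℝ) < j := by exact_mod_cast hj1
    rw [resProfile, show 11 / 10 * (j : ℝ) + 11 / 10 * ((n - j : ℕ) : ℝ) = 11 / 10 * n by
      rw [Nat.cast_sub hjn]; ring]
    refine add_le_add le_rfl ?_
    rw [Finset.mul_sum, Finset.mul_sum, Finset.sum_mul]
    refine Finset.sum_le_sum fun k hk => ?_
    obtain ⟨hk1, hkj⟩ := Finset.mem_Icc.mp hk
    have hr0 : (0 : ℝ) < (n + 1 - k : ℕ) := by exact_mod_cast (by omega : 0 < n + 1 - k)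
    refine (mul_le_mul_of_nonneg_left (gammaShift_le hd hjn hkj (hs1 _ (by omega))
      (hs2 _ (by omega)) x) (by positivity)).trans (le_of_eq ?_)
    rw [Real.mul_rpow (by norm_num) (by positivity),
      show (n : ℝ) / (j * (n + 1 - k : ℕ)) = (j : ℝ)⁻¹ * ((n : ℝ) / (n + 1 - k : ℕ)) by
        field_simp, Real.mul_rpow (by positivity) (by positivity), Real.inv_rpow hj0.le,
      ← Real.rpow_neg hj0.le, neg_div]
    ring
  refine (Finset.sum_le_sum h1).trans ?_
  rw [Finset.sum_add_distrib, ← Finset.sum_mul, ← Finset.sum_mul, ← Finset.mul_sum, ← add_mul, kSum]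
  have := sum_sum_rpow_le hd n
  have := sum_le_zetaHalf (Icc 1 n)
  gcongr

/-- The constant in the Gaussian upper bound. -/
def kA (d : ℕ) : ℝ := 2 * kM d + 1

/-- The inverse of the admissible size of the perturbation. -/
def kSmall (d : ℕ) : ℝ := 120 * (kB d * zetaHalf) + 4 * (kRes d * kSum d)

theorem kSmall_pos (d : ℕ) : 0 < kSmall d := by
  have := kB_pos d
  have := kRes_pos d
  have := kSum_pos d
  have := one_le_zetaHalf
  unfold kSmall
  positivity

namespace RenewalData

theorem isBddInt_residual (h : RenewalData d n κ C P c) (hd : 5 ≤ d)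
    (hκ : 120 * (κ * kB d * zetaHalf) ≤ 1) {j : ℕ} (hj : 1 ≤ j) (hjn : j ≤ n) :
    IsBddInt d (gaussResidual d P c j) := by
  refine ((isBddInt_gauss (h.renewalVar_pos hd hκ hj hjn)).const_mul _).sub
    (IsBddInt.sum fun k hk => IsBddInt.const_mul ?_ _)
  obtain ⟨hk1, hkj⟩ := Finset.mem_Icc.mp hk
  exact (h.isBddInt_step hk1 (by omega)).convZ fun h0 =>
    isBddInt_gauss (h.renewalVar_pos hd hκ (by omega) (by omega))

theorem sub_gauss_eq (h : RenewalData d n κ C P c) (hd : 5 ≤ d)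
    (hκ : 120 * (κ * kB d * zetaHalf) ≤ 1) (hn : 1 ≤ n) (x : Ed d) :
    C n x - c n * gauss d (renewalVar d P c n) x = -1 * ∑ j ∈ Icc 1 n,
      convZ d (gaussResidual d P c j) (n - j) (C (n - j)) x := by
  refine duhamel (Q := renewalStep d P) (F := fun m y => C m y - c m * gauss d (renewalVar d P c m) y)
    (fun k h1 h2 => h.isBddInt_step h1 h2) (fun k h1 h2 => h.isBddInt_C h1 h2)
    (fun k h1 h2 => h.isBddInt_residual hd hκ h1 h2) h.C_rec (fun m hm hmn y => ?_) hn le_rfl x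
  have e : ∀ k ∈ Icc 1 (m - 1), convl d (renewalStep d P k)
      (fun y => C (m - k) y - c (m - k) * gauss d (renewalVar d P c (m - k)) y) y =
      convZ d (renewalStep d P k) (m - k) (C (m - k)) y -
        c (m - k) * convZ d (renewalStep d P k) (m - k) (gauss d (renewalVar d P c (m - k))) y := by
    intro k hk
    obtain ⟨hk1, hkj⟩ := Finset.mem_Icc.mp hk
    rw [convl_sub (h.isBddInt_step hk1 (by omega)) (h.isBddInt_C (by omega) (by omega))
      ((isBddInt_gauss (h.renewalVar_pos hd hκ (by omega) (by omega))).const_mul _), convl_const_mul,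
      convZ_pos (by omega), convZ_pos (by omega)]
  have hI : Icc 1 m = insert m (Icc 1 (m - 1)) := by
    ext; simp only [Finset.mem_Icc, Finset.mem_insert]; omega
  rw [Finset.sum_congr rfl e, Finset.sum_sub_distrib, gaussResidual, h.C_rec m hm hmn y, hI,
    Finset.sum_insert (by simp; omega), Finset.sum_insert (by simp; omega), Nat.sub_self,
    convZ_zero, convZ_zero, h.c_zero]
  ring

theorem C_le_gauss (h : RenewalData d n κ C P c) (hd : 5 ≤ d) (hκ : κ * kSmall d ≤ 1)
    (hn : 1 ≤ n)
    (hA : ∀ m, 1 ≤ m → m < n → ∀ x, C m x ≤ kA d * c m * gauss d (11 / 10 * m) x) (x : Ed d) :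
    C n x ≤ kA d * c n * gauss d (11 / 10 * n) x := by
  have hκ0 := h.kappa_nonneg
  have hkM := kM_pos d
  have hkB := kB_pos d
  have hkR := kRes_pos d
  have hkS := kSum_pos d
  have hz := one_le_zetaHalf
  have hn0 : (0 : ℝ) < n := by exact_mod_cast hn
  have hcn := h.c_pos n le_rfl
  have hA0 : 0 < kA d := by unfold kA; positivity
  have hA1 : 1 ≤ kA d := by unfold kA; linarith
  have q1 : 0 ≤ κ * (kB d * zetaHalf) := by positivity
  have q2 : 0 ≤ κ * (kRes d * kSum d) := by positivity
  rw [kSmall] at hκ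
  have hκ1 : 120 * (κ * kB d * zetaHalf) ≤ 1 := by linarith
  have hκ2 : κ * (kRes d * kSum d) ≤ 1 / 4 := by linarith
  have heq := h.sub_gauss_eq hd hκ1 hn x
  have hs1 : ∀ i ≤ n, 95 / 100 * (i : ℝ) ≤ renewalVar d P c i := fun i hi =>
    (h.renewalVar_mem hd hκ1 hi).1
  have hs2 : ∀ i ≤ n, renewalVar d P c i ≤ 105 / 100 * (i : ℝ) := fun i hi =>
    (h.renewalVar_mem hd hκ1 hi).2
  have hG : 0 ≤ gauss d (11 / 10 * n) x := gauss_nonneg (by positivity) x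
  set s := renewalVar d P c
  have term : ∀ j ∈ Icc 1 n, |convZ d (gaussResidual d P c j) (n - j) (C (n - j)) x| ≤
      2 * (κ * kRes d * kA d * c n) * resProfile d s j (11 / 10 * ((n - j : ℕ) : ℝ)) x := by
    intro j hj
    obtain ⟨hj1, hjn⟩ := Finset.mem_Icc.mp hj
    have hs0 : ∀ i ≤ j, 0 ≤ s i := fun i hi => le_trans (by positivity) (hs1 i (hi.trans hjn))
    have hcj := h.c_pos j hjn
    have hcr := h.ratio n le_rfl j hjn
    have hE : ∀ y, |gaussResidual d P c j y| ≤ κ * kRes d * c j * resProfile d s j 0 y := by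
      intro y
      simpa only [resProfile, add_zero] using h.abs_residual_le hd hκ1 hj1 hjn y
    have hprof : 0 ≤ resProfile d s j (11 / 10 * ((n - j : ℕ) : ℝ)) x :=
      add_nonneg (mul_nonneg (by positivity) (gauss_nonneg (by positivity) x))
        (mul_nonneg (by positivity) (Finset.sum_nonneg fun k _ => gammaShift_nonneg
          (add_nonneg (hs0 _ (Nat.sub_le _ _)) (by positivity)) x))
    rcases eq_or_ne (n - j) 0 with h0 | h0
    · rw [h0, Nat.cast_zero, mul_zero] at hprof ⊢
      rw [convZ_zero]
      refine (hE x).trans (mul_le_mul_of_nonneg_right ?_ hprof)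
      obtain rfl : j = n := by omega
      have : 0 ≤ κ * kRes d * c j := by positivity
      nlinarith
    · have hm0 : (0 : ℝ) < ((n - j : ℕ) : ℝ) := by exact_mod_cast Nat.pos_of_ne_zero h0
      have hC : ∀ y, |C (n - j) y| ≤
          kA d * c (n - j) * gauss d (11 / 10 * ((n - j : ℕ) : ℝ)) y := by
        intro y
        rw [abs_of_nonneg (h.C_nonneg _ y)]
        exact hA (n - j) (by omega) (by omega) y
      rw [convZ_pos h0]
      refine (abs_convl_le ((isBddInt_resProfile hs0 hj1 le_rfl).const_mul _)
        ((isBddInt_gauss (by positivity)).const_mul _) hE hC x).trans ?_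
      rw [convl_const_mul, convl_comm, convl_const_mul, convl_comm,
        convl_resProfile hs0 hj1 (by positivity)]
      set R := resProfile d s j (11 / 10 * ((n - j : ℕ) : ℝ)) x
      calc _ = κ * kRes d * kA d * R * (c j * c (n - j)) := by ring
        _ ≤ κ * kRes d * kA d * R * (2 * c n) := mul_le_mul_of_nonneg_left hcr (by positivity)
        _ = _ := by ring
  have hsum := sum_resProfile_le hd hs1 hs2 x
  have hb : |C n x - c n * gauss d (s n) x| ≤
      2 * (κ * kRes d * kA d * c n) * (kSum d * gauss d (11 / 10 * n) x) := by
    rw [heq, neg_one_mul, abs_neg]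
    refine (Finset.abs_sum_le_sum_abs _ _).trans ((Finset.sum_le_sum term).trans ?_)
    rw [← Finset.mul_sum]
    exact mul_le_mul_of_nonneg_left hsum (by positivity)
  have hmain := gauss_le_kM hn0 (by linarith [hs1 n le_rfl]) (hs2 n le_rfl) x
  have h1 := (abs_le.mp hb).2
  have h2 : c n * gauss d (s n) x ≤ c n * (kM d * gauss d (11 / 10 * n) x) :=
    mul_le_mul_of_nonneg_left hmain hcn.le
  have h3 : 2 * (κ * kRes d * kA d * c n) * (kSum d * gauss d (11 / 10 * n) x) ≤
      1 / 2 * (kA d * c n * gauss d (11 / 10 * n) x) := by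
    have : 0 ≤ kA d * c n * gauss d (11 / 10 * n) x := by positivity
    nlinarith
  have h4 : c n * (kM d * gauss d (11 / 10 * n) x) ≤
      1 / 2 * (kA d * c n * gauss d (11 / 10 * n) x) := by
    have : 0 ≤ c n * gauss d (11 / 10 * n) x := by positivity
    unfold kA
    nlinarith
  linarith

end RenewalData

end RenewalBound

section Assembly

variable {d : ℕ} {lam ρ : ℝ}

/-- The connectivity function of the weakly self-avoiding walk. -/
def connR (d : ℕ) (lam ρ : ℝ) (n : ℕ) (x : Ed d) : ℝ := (CE d lam ρ n x).toReal

/-- The lace function, as the difference of its positive and negative contributions. -/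
def laceR (d : ℕ) (lam ρ : ℝ) (n : ℕ) (x : Ed d) : ℝ :=
  (PE (jP d lam ρ n) n x).toReal - (PE (jM d lam ρ n) n x).toReal

theorem PE_mono {F G : (ℕ → Ed d) → ℝ≥0∞} (h : ∀ y, F y ≤ G y) (n : ℕ) (x : Ed d) :
    PE F n x ≤ PE G n x := by
  unfold PE
  exact lmarginal_mono h _

theorem isBddInt_toReal {f : Ed d → ℝ≥0∞} (hf : Measurable f) {M : ℝ≥0∞} (hM : M ≠ ⊤) {t : ℝ}
    (ht : 0 < t) (h : ∀ x, f x ≤ M * ENNReal.ofReal (gauss d t x)) :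
    IsBddInt d fun x => (f x).toReal := by
  refine ((isBddInt_gauss ht).const_mul M.toReal).of_abs_le hf.ennreal_toReal fun x => ?_
  rw [abs_of_nonneg ENNReal.toReal_nonneg]
  have := ENNReal.toReal_mono (ENNReal.mul_ne_top hM ENNReal.ofReal_ne_top) (h x)
  rwa [ENNReal.toReal_mul, ENNReal.toReal_ofReal (gauss_nonneg ht.le x)] at this

theorem lintegral_mul_eq_ofReal_convl {f g : Ed d → ℝ≥0∞} (hf : ∀ x, f x ≠ ⊤) (hg : ∀ x, g x ≠ ⊤)
    (hfb : IsBddInt d fun x => (f x).toReal) (hgb : IsBddInt d fun x => (g x).toReal) (x : Ed d) :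
    ∫⁻ v, f v * g (x - v) =
      ENNReal.ofReal (convl d (fun x => (f x).toReal) (fun x => (g x).toReal) x) := by
  rw [convl, ofReal_integral_eq_lintegral_ofReal (hfb.integrable_mul hgb x)
    (Eventually.of_forall fun v => mul_nonneg ENNReal.toReal_nonneg ENNReal.toReal_nonneg)]
  refine lintegral_congr fun v => ?_
  rw [ENNReal.ofReal_mul ENNReal.toReal_nonneg, ENNReal.ofReal_toReal (hf v),
    ENNReal.ofReal_toReal (hg _)]

theorem CE_ne_top (hl0 : 0 ≤ lam) (hl1 : lam ≤ 1) {n : ℕ} (hn : 1 ≤ n) (x : Ed d) :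
    CE d lam ρ n x ≠ ⊤ :=
  ne_top_of_le_ne_top ENNReal.ofReal_ne_top (CE_le_gauss hl0 hl1 hn x)

theorem PE_jA_ne_top (hl0 : 0 ≤ lam) (hl1 : lam ≤ 1) {n : ℕ} (hn : 1 ≤ n) (x : Ed d) :
    PE (jA d lam ρ n) n x ≠ ⊤ := by
  obtain ⟨M, hM, h⟩ := PE_jA_le (d := d) (ρ := ρ) hl0 hl1 n hn
  exact ne_top_of_le_ne_top (ENNReal.mul_ne_top hM ENNReal.ofReal_ne_top) (h x)

theorem cE_ne_top (hl0 : 0 ≤ lam) (hl1 : lam ≤ 1) (n : ℕ) : cE d lam ρ n ≠ ⊤ :=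
  ne_top_of_le_ne_top ENNReal.one_ne_top (cE_le_one hl0 hl1 n)

theorem isBddInt_connR (hl0 : 0 ≤ lam) (hl1 : lam ≤ 1) {n : ℕ} (hn : 1 ≤ n) :
    IsBddInt d (connR d lam ρ n) :=
  isBddInt_toReal (measurable_CE n) ENNReal.one_ne_top (t := n) (by exact_mod_cast hn) fun x => by
    rw [one_mul]; exact CE_le_gauss hl0 hl1 hn x

theorem isBddInt_PE (hl0 : 0 ≤ lam) (hl1 : lam ≤ 1) {n : ℕ} (hn : 1 ≤ n)
    {F : (ℕ → Ed d) → ℝ≥0∞} (hF : Measurable F) (hle : ∀ y, F y ≤ jA d lam ρ n y) :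
    IsBddInt d fun x => (PE F n x).toReal := by
  obtain ⟨M, hM, h⟩ := PE_jA_le (d := d) (ρ := ρ) hl0 hl1 n hn
  exact isBddInt_toReal (measurable_PE hF n) hM (t := n) (by exact_mod_cast hn) fun x =>
    (PE_mono hle n x).trans (h x)

theorem abs_laceR_le (hl0 : 0 ≤ lam) (hl1 : lam ≤ 1) {n : ℕ} (hn : 1 ≤ n) (x : Ed d) :
    |laceR d lam ρ n x| ≤ (PE (jA d lam ρ n) n x).toReal := by
  have hA := PE_jA_ne_top (d := d) (ρ := ρ) hl0 hl1 hn x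
  have h1 := ENNReal.toReal_mono hA (PE_mono (jP_le_jA n) n x)
  have h2 := ENNReal.toReal_mono hA (PE_mono (jM_le_jA n) n x)
  have h3 : 0 ≤ (PE (jP d lam ρ n) n x).toReal := ENNReal.toReal_nonneg
  have h4 : 0 ≤ (PE (jM d lam ρ n) n x).toReal := ENNReal.toReal_nonneg
  rw [laceR, abs_le]
  constructor <;> linarith

theorem isBddInt_laceR (hl0 : 0 ≤ lam) (hl1 : lam ≤ 1) {n : ℕ} (hn : 1 ≤ n) :
    IsBddInt d (laceR d lam ρ n) :=
  (isBddInt_PE hl0 hl1 hn (measurable_jP n) (jP_le_jA n)).sub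
    (isBddInt_PE hl0 hl1 hn (measurable_jM n) (jM_le_jA n))

theorem laceR_isometry (n : ℕ) (T : Ed d ≃ₗᵢ[ℝ] Ed d) (x : Ed d) :
    laceR d lam ρ n (T x) = laceR d lam ρ n x := by
  unfold laceR
  rw [PE_isometry (measurable_jP n) T (fun y => by simp only [jP, Jsaw_isometry, phiE_isometry]),
    PE_isometry (measurable_jM n) T (fun y => by simp only [jM, Jsaw_isometry, phiE_isometry])]

theorem connR_one (hl0 : 0 ≤ lam) (hl1 : lam ≤ 1) (x : Ed d) :
    connR d lam ρ 1 x = gauss d 1 x + laceR d lam ρ 1 x := by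
  have hA := PE_jA_ne_top (d := d) (ρ := ρ) hl0 hl1 le_rfl x
  have h := congrArg ENNReal.toReal (CE_lace_one (d := d) (ρ := ρ) hl1 x)
  rw [ENNReal.toReal_add (CE_ne_top hl0 hl1 le_rfl x)
      (ne_top_of_le_ne_top hA (PE_mono (jM_le_jA 1) 1 x)),
    ENNReal.toReal_add ENNReal.ofReal_ne_top (ne_top_of_le_ne_top hA (PE_mono (jP_le_jA 1) 1 x)),
    ENNReal.toReal_ofReal (gauss_nonneg zero_le_one x)] at h
  rw [connR, laceR]
  linarith

theorem connR_rec (hl0 : 0 ≤ lam) (hl1 : lam ≤ 1) {n : ℕ} (hn : 2 ≤ n) (x : Ed d) :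
    connR d lam ρ n x = convl d (gauss d 1) (connR d lam ρ (n - 1)) x +
      (∑ m ∈ Ico 1 n, convl d (laceR d lam ρ m) (connR d lam ρ (n - m)) x + laceR d lam ρ n x) := by
  have hA : ∀ m, 1 ≤ m → ∀ v, PE (jA d lam ρ m) m v ≠ ⊤ := fun m hm v => PE_jA_ne_top hl0 hl1 hm v
  have hP : ∀ m, 1 ≤ m → ∀ v, PE (jP d lam ρ m) m v ≠ ⊤ := fun m hm v =>
    ne_top_of_le_ne_top (hA m hm v) (PE_mono (jP_le_jA m) m v)
  have hM : ∀ m, 1 ≤ m → ∀ v, PE (jM d lam ρ m) m v ≠ ⊤ := fun m hm v =>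
    ne_top_of_le_ne_top (hA m hm v) (PE_mono (jM_le_jA m) m v)
  have bP : ∀ m, 1 ≤ m → IsBddInt d fun v => (PE (jP d lam ρ m) m v).toReal := fun m hm =>
    isBddInt_PE hl0 hl1 hm (measurable_jP m) (jP_le_jA m)
  have bM : ∀ m, 1 ≤ m → IsBddInt d fun v => (PE (jM d lam ρ m) m v).toReal := fun m hm =>
    isBddInt_PE hl0 hl1 hm (measurable_jM m) (jM_le_jA m)
  have bC : ∀ m, 1 ≤ m → IsBddInt d fun v => (CE d lam ρ m v).toReal := fun m hm =>
    isBddInt_connR hl0 hl1 hm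
  have nonneg : ∀ (F : ℕ → Ed d → ℝ≥0∞), ∀ m ∈ Ico 1 n,
      0 ≤ convl d (fun v => (F m v).toReal) (connR d lam ρ (n - m)) x := fun F m _ =>
    integral_nonneg fun v => mul_nonneg ENNReal.toReal_nonneg ENNReal.toReal_nonneg
  have hg : ∀ v, (ENNReal.ofReal (gauss d 1 v)).toReal = gauss d 1 v := fun v =>
    ENNReal.toReal_ofReal (gauss_nonneg zero_le_one v)
  have e0 : ∫⁻ v, ENNReal.ofReal (gauss d 1 v) * CE d lam ρ (n - 1) (x - v) =
      ENNReal.ofReal (convl d (gauss d 1) (connR d lam ρ (n - 1)) x) := by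
    rw [lintegral_mul_eq_ofReal_convl (fun _ => ENNReal.ofReal_ne_top)
      (fun v => CE_ne_top hl0 hl1 (by omega) v) (by simp_rw [hg]; exact isBddInt_gauss one_pos)
      (bC _ (by omega))]
    simp_rw [hg]
    rfl
  have h0 : 0 ≤ convl d (gauss d 1) (connR d lam ρ (n - 1)) x :=
    integral_nonneg fun v => mul_nonneg (gauss_nonneg zero_le_one v) ENNReal.toReal_nonneg
  have eM : ∑ m ∈ Ico 1 n, ∫⁻ v, PE (jM d lam ρ m) m v * CE d lam ρ (n - m) (x - v) =
      ENNReal.ofReal (∑ m ∈ Ico 1 n,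
        convl d (fun v => (PE (jM d lam ρ m) m v).toReal) (connR d lam ρ (n - m)) x) := by
    rw [ENNReal.ofReal_sum_of_nonneg (nonneg fun m => PE (jM d lam ρ m) m)]
    refine Finset.sum_congr rfl fun m hm => ?_
    obtain ⟨hm1, hmn⟩ := Finset.mem_Ico.mp hm
    exact lintegral_mul_eq_ofReal_convl (hM m hm1) (fun v => CE_ne_top hl0 hl1 (by omega) v)
      (bM m hm1) (bC _ (by omega)) x
  have eP : ∑ m ∈ Ico 1 n, ∫⁻ v, PE (jP d lam ρ m) m v * CE d lam ρ (n - m) (x - v) =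
      ENNReal.ofReal (∑ m ∈ Ico 1 n,
        convl d (fun v => (PE (jP d lam ρ m) m v).toReal) (connR d lam ρ (n - m)) x) := by
    rw [ENNReal.ofReal_sum_of_nonneg (nonneg fun m => PE (jP d lam ρ m) m)]
    refine Finset.sum_congr rfl fun m hm => ?_
    obtain ⟨hm1, hmn⟩ := Finset.mem_Ico.mp hm
    exact lintegral_mul_eq_ofReal_convl (hP m hm1) (fun v => CE_ne_top hl0 hl1 (by omega) v)
      (bP m hm1) (bC _ (by omega)) x
  have h := congrArg ENNReal.toReal (CE_lace (d := d) (ρ := ρ) hl1 hn x)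
  rw [e0, eM, eP] at h
  rw [ENNReal.toReal_add (CE_ne_top hl0 hl1 (by omega) x)
      (ENNReal.add_ne_top.mpr ⟨ENNReal.ofReal_ne_top, hM n (by omega) x⟩),
    ENNReal.toReal_add ENNReal.ofReal_ne_top (hM n (by omega) x),
    ENNReal.toReal_add ENNReal.ofReal_ne_top
      (ENNReal.add_ne_top.mpr ⟨ENNReal.ofReal_ne_top, hP n (by omega) x⟩),
    ENNReal.toReal_add ENNReal.ofReal_ne_top (hP n (by omega) x),
    ENNReal.toReal_ofReal (Finset.sum_nonneg (nonneg fun m => PE (jM d lam ρ m) m)),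
    ENNReal.toReal_ofReal (Finset.sum_nonneg (nonneg fun m => PE (jP d lam ρ m) m)),
    ENNReal.toReal_ofReal h0] at h
  have es : ∑ m ∈ Ico 1 n, convl d (laceR d lam ρ m) (connR d lam ρ (n - m)) x =
      ∑ m ∈ Ico 1 n, convl d (fun v => (PE (jP d lam ρ m) m v).toReal) (connR d lam ρ (n - m)) x -
      ∑ m ∈ Ico 1 n,
        convl d (fun v => (PE (jM d lam ρ m) m v).toReal) (connR d lam ρ (n - m)) x := by
    rw [← Finset.sum_sub_distrib]
    refine Finset.sum_congr rfl fun m hm => ?_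
    obtain ⟨hm1, hmn⟩ := Finset.mem_Ico.mp hm
    have hC := isBddInt_connR (d := d) (ρ := ρ) hl0 hl1 (n := n - m) (by omega)
    rw [convl, convl, convl, ← integral_sub ((bP m hm1).integrable_mul hC x)
      ((bM m hm1).integrable_mul hC x)]
    simp only [laceR, sub_mul]
  rw [es, connR, laceR]
  linarith

theorem connR_renewal (hl0 : 0 ≤ lam) (hl1 : lam ≤ 1) {m : ℕ} (hm : 1 ≤ m) (x : Ed d) :
    connR d lam ρ m x = ∑ k ∈ Icc 1 m,
      convZ d (renewalStep d (laceR d lam ρ) k) (m - k) (connR d lam ρ (m - k)) x := by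
  rw [Finset.sum_congr rfl fun k hk => convZ_renewalStep
    (isBddInt_laceR hl0 hl1 (Finset.mem_Icc.mp hk).1)
    (fun h0 => isBddInt_connR hl0 hl1 (Nat.one_le_iff_ne_zero.mpr h0)) x, Finset.sum_add_distrib,
    Finset.sum_ite_eq' (Icc 1 m) 1, if_pos (Finset.mem_Icc.mpr ⟨le_rfl, hm⟩)]
  rcases hm.eq_or_lt with rfl | hm
  · rw [Finset.Icc_self, Finset.sum_singleton, Nat.sub_self, convZ_zero, convZ_zero,
      connR_one hl0 hl1, add_comm]
  · rw [connR_rec hl0 hl1 hm, convZ_pos (by omega), ← Finset.Ico_insert_right hm.le,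
      Finset.sum_insert (by simp), Nat.sub_self, convZ_zero,
      Finset.sum_congr rfl fun k hk => congrFun (convZ_pos (d := d) (i := m - k) (by
        have := Finset.mem_Ico.mp hk; omega)) x]
    ring

theorem ofReal_le_two_mul {a b : ℝ} (ha : 1 / 2 ≤ a) (hb : 0 ≤ b) :
    ENNReal.ofReal b ≤ 2 * (ENNReal.ofReal a * ENNReal.ofReal b) := by
  rw [← ENNReal.ofReal_mul (by linarith), ← ENNReal.ofReal_ofNat 2, ← ENNReal.ofReal_mul zero_le_two]
  exact ENNReal.ofReal_le_ofReal (by nlinarith)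

theorem one_le_two_mul_cE_one (hl : lam ≤ 1 / 2) : 1 ≤ 2 * cE d lam ρ 1 := by
  have h : ∀ x : Ed d, ENNReal.ofReal (gauss d 1 x) ≤ 2 * CE d lam ρ 1 x := fun x => by
    unfold CE
    rw [show Ioo 0 1 = (∅ : Finset ℕ) from rfl, pint, lmarginal_empty, kE, phiE, PhiProd_succ]
    have hk : 1 / 2 ≤ Ksaw d lam ρ 0 1 (Function.update 0 1 x) := by
      have e := Ksaw_lace (d := d) (lam := lam) (ρ := ρ) le_rfl (Function.update 0 1 x)
      simp only [Finset.Icc_self, Finset.sum_singleton, Ksaw_self, Jsaw_one, edgeW] at e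
      rw [e]
      have h0 := indBall_nonneg (ρ := ρ) (Function.update (0 : ℕ → Ed d) 1 x 1 -
        Function.update (0 : ℕ → Ed d) 1 x 0)
      have h1 := indBall_le_one (ρ := ρ) (Function.update (0 : ℕ → Ed d) 1 x 1 -
        Function.update (0 : ℕ → Ed d) 1 x 0)
      nlinarith
    have hg := ofReal_le_two_mul hk (gauss_nonneg (d := d) zero_le_one x)
    simpa using hg
  calc (1 : ℝ≥0∞) = ∫⁻ x, ENNReal.ofReal (gauss d 1 x) := (lintegral_gauss one_pos).symm
    _ ≤ ∫⁻ x, 2 * CE d lam ρ 1 x := lintegral_mono h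
    _ = 2 * cE d lam ρ 1 := by rw [lintegral_const_mul _ (measurable_CE 1), cE_eq le_rfl]

/-- The constants entering the induction, all finite in dimension at least five. -/
structure SmallCoupling (d : ℕ) (lam : ℝ) (A β : ℝ≥0∞) (κ : ℝ) : Prop where
  nonneg : 0 ≤ lam
  le_half : lam ≤ 1 / 2
  lace : ENNReal.ofReal lam * (8 * kSeg d A * A) +
    ENNReal.ofReal lam * (32 * kSeg d A * zE d) * β ≤ β
  ratio : ENNReal.ofReal lam * (4 * A ^ 2 * kU d * zE d) ≤ 2⁻¹
  renewal : lam * κ * kSmall d ≤ 1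
  kappa_nonneg : 0 ≤ κ
  lace_const : kLace d A β * ENNReal.ofReal (kTriple d) ≤ ENNReal.ofReal κ

theorem one_le_kA : 1 ≤ ENNReal.ofReal (kA d) := by
  have := kM_pos d
  rw [ENNReal.one_le_ofReal, kA]
  linarith

theorem GammaSAW_nonneg (n : ℕ) (x : Ed d) : 0 ≤ GammaSAW d 1 n x := by
  unfold GammaSAW
  exact mul_nonneg (by positivity) (Finset.sum_nonneg fun k _ =>
    mul_nonneg (by positivity) (gauss_nonneg (by positivity) x))

theorem PE_jA_toReal_le (hd : 5 ≤ d) (hρ : ρ ≤ 1) {β : ℝ≥0∞} {κ : ℝ}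
    (h : SmallCoupling d lam (ENNReal.ofReal (kA d)) β κ) {n : ℕ} (hn : 1 ≤ n)
    (hA : ∀ m, 1 ≤ m → m < n → ∀ x,
      CE d lam ρ m x ≤ ENNReal.ofReal (kA d) * cE d lam ρ m * gE d (22 * m) x)
    (hR : ∀ m ≤ n, ∀ k ≤ m, cE d lam ρ k * cE d lam ρ (m - k) ≤ 2 * cE d lam ρ m) (x : Ed d) :
    (PE (jA d lam ρ n) n x).toReal ≤ lam * κ * (cE d lam ρ n).toReal * GammaSAW d 1 n x := by
  have hl1 : lam ≤ 1 := h.le_half.trans (by norm_num)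
  have hc := cE_ne_top (d := d) (ρ := ρ) h.nonneg hl1 n
  have hΓ := GammaSAW_nonneg n x
  have hκ := h.kappa_nonneg
  have hl0 := h.nonneg
  have hk : 0 ≤ kTriple d := by unfold kTriple; positivity
  have key : PE (jA d lam ρ n) n x ≤ ENNReal.ofReal (lam * κ * (cE d lam ρ n).toReal *
      GammaSAW d 1 n x) := by
    calc _ ≤ ENNReal.ofReal lam * kLace d (ENNReal.ofReal (kA d)) β * cE d lam ρ n * tE d n x x :=
          PE_jA_le_tE (by omega) h.nonneg hl1 hρ one_le_kA hn (one_le_two_mul_cE_one h.le_half)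
            hA hR h.lace x
      _ ≤ ENNReal.ofReal lam * kLace d (ENNReal.ofReal (kA d)) β * cE d lam ρ n *
          (ENNReal.ofReal (kTriple d) * ENNReal.ofReal (GammaSAW d 1 n x)) := by
        rw [← ENNReal.ofReal_mul hk]
        gcongr
        exact tE_le hd hn x
      _ = ENNReal.ofReal lam * (kLace d (ENNReal.ofReal (kA d)) β * ENNReal.ofReal (kTriple d)) *
          cE d lam ρ n * ENNReal.ofReal (GammaSAW d 1 n x) := by ring
      _ ≤ ENNReal.ofReal lam * ENNReal.ofReal κ * cE d lam ρ n *
          ENNReal.ofReal (GammaSAW d 1 n x) := by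
        gcongr
        exact h.lace_const
      _ = _ := by
        rw [ENNReal.ofReal_mul (by positivity), ENNReal.ofReal_mul (by positivity),
          ENNReal.ofReal_mul (by positivity), ENNReal.ofReal_toReal hc]
  exact ENNReal.toReal_le_of_le_ofReal (by positivity) key

theorem renewalData (hd : 5 ≤ d) (hρ : ρ ≤ 1) {β : ℝ≥0∞} {κ : ℝ}
    (h : SmallCoupling d lam (ENNReal.ofReal (kA d)) β κ) {n : ℕ}
    (hA : ∀ m, 1 ≤ m → m < n → ∀ x,
      CE d lam ρ m x ≤ ENNReal.ofReal (kA d) * cE d lam ρ m * gE d (22 * m) x)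
    (hR : ∀ m ≤ n, ∀ k ≤ m, cE d lam ρ k * cE d lam ρ (m - k) ≤ 2 * cE d lam ρ m) :
    RenewalData d n (lam * κ) (connR d lam ρ) (laceR d lam ρ) fun m => (cE d lam ρ m).toReal := by
  have hl0 := h.nonneg
  have hl1 : lam ≤ 1 := h.le_half.trans (by norm_num)
  have hc := cE_ne_top (d := d) (ρ := ρ) hl0 hl1
  have hc1 : 1 ≤ 2 * (cE d lam ρ 1).toReal := by
    have := ENNReal.toReal_mono (ENNReal.mul_ne_top ENNReal.ofNat_ne_top (hc 1))
      (one_le_two_mul_cE_one (d := d) (ρ := ρ) h.le_half)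
    simpa using this
  have hratio : ∀ m ≤ n, ∀ k ≤ m,
      (cE d lam ρ k).toReal * (cE d lam ρ (m - k)).toReal ≤ 2 * (cE d lam ρ m).toReal := by
    intro m hm k hk
    have := ENNReal.toReal_mono (ENNReal.mul_ne_top ENNReal.ofNat_ne_top (hc m)) (hR m hm k hk)
    simpa using this
  have hc0 : (cE d lam ρ 0).toReal = 1 := by rw [cE_zero, ENNReal.toReal_one]
  refine
    { kappa_nonneg := mul_nonneg hl0 h.kappa_nonneg
      c_zero := hc0
      c_pos := ?_
      c_one := hc1
      ratio := hratio
      P_meas := fun k => (measurable_PE (measurable_jP k) k).ennreal_toReal.sub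
        (measurable_PE (measurable_jM k) k).ennreal_toReal
      P_iso := laceR_isometry
      P_le := fun k hk hkn x => (abs_laceR_le hl0 hl1 hk x).trans
        (PE_jA_toReal_le hd hρ h hk (fun m hm hmk => hA m hm (by omega))
          (fun m hm => hR m (by omega)) x)
      C_meas := fun k => (measurable_CE k).ennreal_toReal
      C_nonneg := fun _ _ => ENNReal.toReal_nonneg
      C_le := fun k hk _ x => ENNReal.toReal_le_of_le_ofReal (gauss_nonneg (by positivity) x)
        (CE_le_gauss hl0 hl1 hk x)
      C_int := fun k hk _ => ?_
      C_rec := fun m hm _ x => connR_renewal hl0 hl1 hm x }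
  · intro m hm
    induction m with
    | zero => rw [hc0]; exact one_pos
    | succ m ih =>
      have h1 := hratio (m + 1) hm 1 (by omega)
      rw [Nat.add_sub_cancel] at h1
      have h2 := ih (by omega)
      nlinarith
  · rw [cE_eq hk]
    exact integral_toReal (measurable_CE k).aemeasurable
      (Eventually.of_forall fun x => (CE_ne_top hl0 hl1 hk x).lt_top)

theorem CE_le_and_ratio (hd : 5 ≤ d) (hρ : ρ ≤ 1) {β : ℝ≥0∞} {κ : ℝ}
    (h : SmallCoupling d lam (ENNReal.ofReal (kA d)) β κ) (n : ℕ) :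
    (1 ≤ n → ∀ x, CE d lam ρ n x ≤ ENNReal.ofReal (kA d) * cE d lam ρ n * gE d (22 * n) x) ∧
      ∀ k ≤ n, cE d lam ρ k * cE d lam ρ (n - k) ≤ 2 * cE d lam ρ n := by
  have hl0 := h.nonneg
  have hl1 : lam ≤ 1 := h.le_half.trans (by norm_num)
  induction n using Nat.strong_induction_on with
  | _ n ih =>
  have hA : ∀ m, 1 ≤ m → m < n → ∀ x,
      CE d lam ρ m x ≤ ENNReal.ofReal (kA d) * cE d lam ρ m * gE d (22 * m) x :=
    fun m hm hmn => (ih m hmn).1 hm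
  have hRn : ∀ k ≤ n, cE d lam ρ k * cE d lam ρ (n - k) ≤ 2 * cE d lam ρ n := fun k hk =>
    cE_mul_le hl0 hl1 hρ (by omega) hA (fun m hm => (ih m hm).2) h.ratio hk
  refine ⟨fun hn x => ?_, hRn⟩
  have hR : ∀ m ≤ n, ∀ k ≤ m, cE d lam ρ k * cE d lam ρ (m - k) ≤ 2 * cE d lam ρ m := by
    intro m hm
    rcases hm.eq_or_lt with rfl | hm
    · exact hRn
    · exact (ih m hm).2
  have hc := cE_ne_top (d := d) (ρ := ρ) hl0 hl1
  have hkA : 0 ≤ kA d := by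
    have := one_le_kA (d := d)
    rw [ENNReal.one_le_ofReal] at this
    linarith
  have hgE : ∀ m : ℕ, ∀ x : Ed d, gE d (22 * m) x = ENNReal.ofReal (gauss d (11 / 10 * m) x) := by
    intro m x
    rw [gE]; congr 2; push_cast; ring
  have hg0 : ∀ m : ℕ, ∀ x : Ed d, 0 ≤ gauss d (11 / 10 * m) x := fun m x =>
    gauss_nonneg (by positivity) x
  have key : ∀ m : ℕ, ∀ x : Ed d, ENNReal.ofReal (kA d) * cE d lam ρ m * gE d (22 * m) x =
      ENNReal.ofReal (kA d * (cE d lam ρ m).toReal * gauss d (11 / 10 * m) x) := fun m x => by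
    rw [ENNReal.ofReal_mul (mul_nonneg hkA ENNReal.toReal_nonneg), ENNReal.ofReal_mul hkA,
      ENNReal.ofReal_toReal (hc m), hgE]
  rw [key, ← ENNReal.ofReal_toReal (CE_ne_top hl0 hl1 hn x)]
  refine ENNReal.ofReal_le_ofReal ?_
  refine (renewalData hd hρ h hA hR).C_le_gauss hd h.renewal hn (fun m hm hmn y => ?_) x
  have hy := hA m hm hmn y
  rw [key] at hy
  exact ENNReal.toReal_le_of_le_ofReal
    (mul_nonneg (mul_nonneg hkA ENNReal.toReal_nonneg) (hg0 m y)) hy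

theorem exists_ofReal_mul_le {c e : ℝ≥0∞} (hc : c ≠ ⊤) (he : e ≠ 0) :
    ∃ l > (0 : ℝ), ∀ lam ≤ l, ENNReal.ofReal lam * c ≤ e := by
  obtain ⟨l, hl, hle⟩ := ENNReal.exists_nnreal_pos_mul_lt hc he
  refine ⟨l, by exact_mod_cast hl, fun lam h => ?_⟩
  refine le_trans ?_ hle.le
  gcongr
  exact ENNReal.ofReal_le_iff_le_toReal ENNReal.coe_ne_top |>.mpr h

theorem exists_smallCoupling (hd : 5 ≤ d) :
    ∃ lam0 > (0 : ℝ), ∃ β : ℝ≥0∞, ∃ κ > (0 : ℝ), ∀ lam, 0 ≤ lam → lam ≤ lam0 →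
      SmallCoupling d lam (ENNReal.ofReal (kA d)) β κ := by
  set A := ENNReal.ofReal (kA d) with hA
  have hAt : A ≠ ⊤ := ENNReal.ofReal_ne_top
  have hz := zE_ne_top hd
  have hS := kS_ne_top (d := d)
  have hU := kU_ne_top (d := d)
  have hSeg : kSeg d A ≠ ⊤ := by
    unfold kSeg
    finiteness
  set β := 16 * kSeg d A * A with hβ
  have hβt : β ≠ ⊤ := by rw [hβ]; finiteness
  have hL : kLace d A β * ENNReal.ofReal (kTriple d) ≠ ⊤ := by
    unfold kLace
    finiteness
  set κ := (kLace d A β * ENNReal.ofReal (kTriple d)).toReal + 1 with hκ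
  have hκ0 : 0 < κ := by positivity
  obtain ⟨l1, h1, H1⟩ := exists_ofReal_mul_le (c := 32 * kSeg d A * zE d) (e := 2⁻¹)
    (by finiteness) (by simp)
  obtain ⟨l2, h2, H2⟩ := exists_ofReal_mul_le (c := 4 * A ^ 2 * kU d * zE d) (e := 2⁻¹)
    (by finiteness) (by simp)
  have hk := mul_pos hκ0 (kSmall_pos (d := d))
  refine ⟨min (min l1 l2) (min (1 / 2) (κ * kSmall d)⁻¹), by positivity, β, κ, hκ0,
    fun lam hl0 hl => ?_⟩
  simp only [le_min_iff] at hl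
  obtain ⟨⟨hl1, hl2⟩, hl3, hl4⟩ := hl
  have hl : ENNReal.ofReal lam ≤ 1 := by
    rw [ENNReal.ofReal_le_one]; linarith
  refine ⟨hl0, hl3, ?_, H2 lam hl2, ?_, hκ0.le, ?_⟩
  · calc _ ≤ 1 * (8 * kSeg d A * A) + 2⁻¹ * β := by
          gcongr
          exact H1 lam hl1
      _ = 2⁻¹ * β + 2⁻¹ * β := by
          rw [hβ, show (16 : ℝ≥0∞) * kSeg d A * A = 2 * (8 * kSeg d A * A) by ring,
            ENNReal.inv_mul_cancel_left two_ne_zero ENNReal.ofNat_ne_top, one_mul]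
      _ = β := by rw [← add_mul, ENNReal.inv_two_add_inv_two, one_mul]
  · rw [mul_assoc]
    exact (mul_le_mul_of_nonneg_right hl4 hk.le).trans (inv_mul_cancel₀ hk.ne').le
  · rw [← ENNReal.ofReal_toReal hL]
    exact ENNReal.ofReal_le_ofReal (by linarith)

end Assembly

/-- Uniform bound on the normalized lace functions `B_m = Π_m / (λ c_m)` of the
weakly self-avoiding walk. -/
theorem saw_lace_function_bound (d : ℕ) (hd : 5 ≤ d) :
    ∃ lam0 > (0 : ℝ), ∃ K > (0 : ℝ), ∀ ρ : ℝ, 0 < ρ → ρ ≤ 1 →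
      ∀ lam : ℝ, 0 < lam → lam ≤ lam0 → ∀ m : ℕ, 1 ≤ m → ∀ x : Ed d,
        |Pisaw d lam ρ m x / (lam * csawInt d lam ρ m)| ≤
          K * (m : ℝ) ^ (-(d : ℝ) / 2) *
            ∑ k ∈ Finset.Icc 1 m, (k : ℝ) ^ (1 - (d : ℝ) / 2) * gauss d (2 * k / 5) x := by
  obtain ⟨lam0, h0, β, κ, hκ, H⟩ := exists_smallCoupling hd
  refine ⟨lam0, h0, κ, hκ, fun ρ _ hρ lam hl hle m hm x => ?_⟩
  have h := H lam hl.le hle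
  have hl1 : lam ≤ 1 := h.le_half.trans (by norm_num)
  have hA := fun i => (CE_le_and_ratio hd hρ h i).1
  have hR := fun i => (CE_le_and_ratio hd hρ h i).2
  have hc : 0 < (cE d lam ρ m).toReal :=
    (renewalData hd hρ h (fun i hi _ => hA i hi) (fun i _ => hR i)).c_pos m le_rfl
  have hP := (abs_Pisaw_le hl.le hl1 hm x).trans
    (PE_jA_toReal_le hd hρ h hm (fun i hi _ => hA i hi) (fun i _ => hR i) x)
  rw [csawInt_eq hl.le hl1 hm, abs_div, abs_of_pos (mul_pos hl hc), div_le_iff₀ (mul_pos hl hc)]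
  refine hP.trans_eq ?_
  rw [GammaSAW]
  ring
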